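/- arXiv:1809.02725 — 2 statements merged into one kernel-verified Lean document; each statement's English description precedes it below -/
import Mathlib

section
/- For every c > 1 and every α with log 3/log 2 − 1 < α ≤ 2, there exists a continuous 2π-periodic function ψ : ℝ → ℝ that is even, nonconstant, nonincreasing on [0, π], satisfies ψ(x) > 0 for every x ∈ ℝ, and solves the stationary equation (c − D_α)ψ = ψ², i.e. for every n ∈ ℤ one has (c + |n|^α)·ψ̂(n) = (ψ²)̂(n). -/
open MeasureTheory

/-- The `n`-th Fourier coefficient of a (2π-periodic) function `f : ℝ → ℝ`:
`f̂(n) = (1/(2π)) ∫_{-π}^{π} f(x) e^{-inx} dx`. -/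
noncomputable def fourierCoeff2pi (f : ℝ → ℝ) (n : ℤ) : ℂ :=
  (1 / (2 * Real.pi) : ℂ) *
    ∫ x in (-Real.pi)..Real.pi, (f x : ℂ) * Complex.exp (-(Complex.I * (n : ℂ) * (x : ℂ)))

namespace SingleLobe

open Real Set Filter Topology

/-- A bounded multiplier sequence preserving the cone of absolutely summable sequences which pair
nonnegatively with every element of `E`. -/
structure ConeMultiplier (E : Set (ℤ → ℝ)) (m : ℤ → ℝ) : Prop where
  bounded : ∃ C, ∀ n, |m n| ≤ C
  nonneg : ∀ a : ℤ → ℝ, Summable a → (∀ e ∈ E, 0 ≤ ∑' n, a n * e n) →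
    ∀ e ∈ E, 0 ≤ ∑' n, m n * a n * e n

/-- All sequences in `E` are bounded by `2`. -/
def BoundedByTwo (E : Set (ℤ → ℝ)) : Prop := ∀ e ∈ E, ∀ n, |e n| ≤ 2

theorem summable_mul_of_bounded {a m : ℤ → ℝ} {C : ℝ} (ha : Summable a) (hm : ∀ n, |m n| ≤ C) :
    Summable fun n => m n * a n := by
  refine Summable.of_norm_bounded (ha.abs.mul_left C) fun n => ?_
  rw [norm_mul]
  exact mul_le_mul_of_nonneg_right (hm n) (abs_nonneg _)

theorem summable_mul_of_bounded' {a m : ℤ → ℝ} {C : ℝ} (ha : Summable a) (hm : ∀ n, |m n| ≤ C) :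
    Summable fun n => a n * m n := by
  simpa [mul_comm] using summable_mul_of_bounded ha hm

namespace ConeMultiplier

variable {E : Set (ℤ → ℝ)}

theorem one : ConeMultiplier E fun _ => 1 :=
  ⟨⟨1, by simp⟩, fun a _ h => by simpa using h⟩

theorem mul {m k : ℤ → ℝ} (hm : ConeMultiplier E m) (hk : ConeMultiplier E k) :
    ConeMultiplier E fun n => m n * k n := by
  obtain ⟨C, hC⟩ := hm.bounded
  obtain ⟨D, hD⟩ := hk.bounded
  refine ⟨⟨C * D, fun n => ?_⟩, fun a ha h e he => ?_⟩
  · rw [abs_mul]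
    exact mul_le_mul (hC n) (hD n) (abs_nonneg _) ((abs_nonneg _).trans (hC n))
  · simpa [mul_assoc] using
      hm.nonneg _ (summable_mul_of_bounded ha hD) (fun e he => hk.nonneg a ha h e he) e he

theorem pow {k : ℤ → ℝ} (hk : ConeMultiplier E k) (j : ℕ) : ConeMultiplier E fun n => k n ^ j := by
  induction j with
  | zero => simpa using one
  | succ j ih => simpa [pow_succ] using ih.mul hk

theorem const_mul {m : ℤ → ℝ} (hm : ConeMultiplier E m) {t : ℝ} (ht : 0 ≤ t) :
    ConeMultiplier E fun n => t * m n := by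
  obtain ⟨C, hC⟩ := hm.bounded
  refine ⟨⟨t * C, fun n => ?_⟩, fun a ha h e he => ?_⟩
  · rw [abs_mul, abs_of_nonneg ht]
    exact mul_le_mul_of_nonneg_left (hC n) ht
  · have := mul_nonneg ht (hm.nonneg a ha h e he)
    rw [← tsum_mul_left] at this
    simpa [mul_assoc] using this

theorem add (hE : BoundedByTwo E) {m k : ℤ → ℝ} (hm : ConeMultiplier E m)
    (hk : ConeMultiplier E k) : ConeMultiplier E fun n => m n + k n := by
  obtain ⟨C, hC⟩ := hm.bounded
  obtain ⟨D, hD⟩ := hk.bounded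
  refine ⟨⟨C + D, fun n => (abs_add_le _ _).trans (add_le_add (hC n) (hD n))⟩,
    fun a ha h e he => ?_⟩
  have h1 := summable_mul_of_bounded' (summable_mul_of_bounded ha hC) (hE e he)
  have h2 := summable_mul_of_bounded' (summable_mul_of_bounded ha hD) (hE e he)
  have := add_nonneg (hm.nonneg a ha h e he) (hk.nonneg a ha h e he)
  rw [← h1.tsum_add h2] at this
  simpa [add_mul] using this

theorem sum (hE : BoundedByTwo E) {ι : Type*} {m : ι → ℤ → ℝ} (s : Finset ι)
    (hm : ∀ i ∈ s, ConeMultiplier E (m i)) : ConeMultiplier E fun n => ∑ i ∈ s, m i n := by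
  classical
  induction s using Finset.induction_on with
  | empty => exact ⟨⟨0, by simp⟩, by simp⟩
  | insert i s hi ih =>
    simp only [Finset.sum_insert hi]
    exact (hm i (Finset.mem_insert_self _ _)).add hE
      (ih fun j hj => hm j (Finset.mem_insert_of_mem hj))

theorem of_tendsto (hE : BoundedByTwo E) {m : ℕ → ℤ → ℝ} {l : ℤ → ℝ} {C : ℝ}
    (hm : ∀ k, ConeMultiplier E (m k)) (hC : ∀ k n, |m k n| ≤ C)
    (hl : ∀ n, Tendsto (fun k => m k n) atTop (𝓝 (l n))) : ConeMultiplier E l := by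
  refine ⟨⟨C, fun n => le_of_tendsto (hl n).abs (.of_forall fun k => hC k n)⟩,
    fun a ha h e he => ?_⟩
  have : Tendsto (fun k => ∑' n, m k n * a n * e n) atTop (𝓝 (∑' n, l n * a n * e n)) := by
    refine tendsto_tsum_of_dominated_convergence (bound := fun n => C * |a n| * 2)
      ((ha.abs.mul_left C).mul_right 2)
      (fun n => ((hl n).mul_const _).mul_const _) (.of_forall fun k n => ?_)
    rw [norm_mul, norm_mul]
    have hC0 := (abs_nonneg _).trans (hC k n)
    exact mul_le_mul (mul_le_mul_of_nonneg_right (hC k n) (abs_nonneg _)) (hE e he n)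
      (abs_nonneg _) (mul_nonneg hC0 (abs_nonneg _))
  exact ge_of_tendsto' this fun k => (hm k).nonneg a ha h e he

theorem neumann (hE : BoundedByTwo E) {k : ℤ → ℝ} (hk : ConeMultiplier E k) {M s : ℝ}
    (hs : 0 < s) (hM : ∀ n, |k n| ≤ M) : ConeMultiplier E fun n => 1 / (s + (M - k n)) := by
  have hM0 : 0 ≤ M := (abs_nonneg _).trans (hM 0)
  have hsM : 0 < s + M := by linarith
  have hr : ∀ n, |k n / (s + M)| ≤ M / (s + M) := fun n => by
    rw [abs_div, abs_of_pos hsM]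
    exact div_le_div_of_nonneg_right (hM n) hsM.le
  have hr0 : 0 ≤ M / (s + M) := by positivity
  have hr1 : M / (s + M) < 1 := by rw [div_lt_one hsM]; linarith
  have hsum : ∀ n, HasSum (fun j : ℕ => 1 / (s + M) * (k n / (s + M)) ^ j)
      (1 / (s + (M - k n))) := fun n => by
    have h1 : |k n / (s + M)| < 1 := (hr n).trans_lt hr1
    have h2 : s + (M - k n) ≠ 0 := by have := (abs_le.1 (hM n)).2; linarith
    have h3 := (hasSum_geometric_of_abs_lt_one h1).mul_left (1 / (s + M))
    have h4 : 1 - k n / (s + M) = (s + (M - k n)) / (s + M) := by field_simp; ring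
    have h5 : 1 / (s + M) * (1 - k n / (s + M))⁻¹ = 1 / (s + (M - k n)) := by
      rw [h4]; field_simp
    rwa [h5] at h3
  refine of_tendsto hE (m := fun J n => ∑ j ∈ Finset.range J, 1 / (s + M) * (k n / (s + M)) ^ j)
    (C := 1 / (s + M) * (1 - M / (s + M))⁻¹) (fun J => ?_) (fun J n => ?_)
    (fun n => (hsum n).tendsto_sum_nat)
  · refine sum hE _ fun j _ => ?_
    refine const_mul (pow ?_ j) (by positivity)
    have := hk.const_mul (t := (s + M)⁻¹) (by positivity)
    simpa [div_eq_inv_mul] using this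
  · rw [← Finset.mul_sum, abs_mul, abs_of_pos (by positivity : 0 < 1 / (s + M))]
    refine mul_le_mul_of_nonneg_left ?_ (by positivity)
    calc |∑ j ∈ Finset.range J, (k n / (s + M)) ^ j|
        ≤ ∑ j ∈ Finset.range J, (M / (s + M)) ^ j := by
          refine (Finset.abs_sum_le_sum_abs _ _).trans (Finset.sum_le_sum fun j _ => ?_)
          rw [abs_pow]
          exact pow_le_pow_left₀ (abs_nonneg _) (hr n) j
      _ ≤ (1 - M / (s + M))⁻¹ := by
          rw [← tsum_geometric_of_lt_one hr0 hr1]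
          exact (summable_geometric_of_lt_one hr0 hr1).sum_le_tsum _ fun _ _ => by positivity

theorem resolvent_of_tendsto (hE : BoundedByTwo E) {k : ℕ → ℤ → ℝ} {M : ℕ → ℝ} {b : ℤ → ℝ} {s : ℝ}
    (hs : 0 < s) (hk : ∀ j, ConeMultiplier E (k j)) (hM : ∀ j n, |k j n| ≤ M j)
    (hb : ∀ n, Tendsto (fun j => M j - k j n) atTop (𝓝 (b n))) :
    ConeMultiplier E fun n => 1 / (s + b n) := by
  have h0 : ∀ j n, 0 ≤ M j - k j n := fun j n => by have := (abs_le.1 (hM j n)).2; linarith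
  have hb0 : ∀ n, 0 ≤ b n := fun n => ge_of_tendsto' (hb n) fun j => h0 j n
  refine of_tendsto hE (C := 1 / s) (fun j => (hk j).neumann hE hs (hM j)) (fun j n => ?_)
    (fun n => tendsto_const_nhds.div ((hb n).const_add s) (by linarith [hb0 n]))
  rw [abs_of_nonneg (by have := h0 j n; positivity)]
  exact one_div_le_one_div_of_le hs (by linarith [h0 j n])

theorem integral (hE : BoundedByTwo E) {φ : ℝ → ℤ → ℝ} {p q C : ℝ} (hpq : p ≤ q)
    (hφ : ∀ t ∈ Ioc p q, ConeMultiplier E (φ t)) (hC : ∀ t ∈ Ioc p q, ∀ n, |φ t n| ≤ C)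
    (hc : ∀ n, ContinuousOn (fun t => φ t n) (Icc p q)) :
    ConeMultiplier E fun n => ∫ t in p..q, φ t n := by
  refine ⟨⟨C * |q - p|, fun n => ?_⟩, fun a ha h e he => ?_⟩
  · exact intervalIntegral.norm_integral_le_of_norm_le_const (f := fun t => φ t n) fun t ht =>
      hC t (by rwa [uIoc_of_le hpq] at ht) n
  · have key : HasSum (fun n => ∫ t in p..q, φ t n * a n * e n)
        (∫ t in p..q, ∑' n, φ t n * a n * e n) := by
      refine intervalIntegral.hasSum_integral_of_dominated_convergence
        (fun n _ => C * |a n| * 2) (fun n => ?_) (fun n => ?_) ?_ ?_ ?_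
      · have : ContinuousOn (fun t => φ t n * a n * e n) (uIoc p q) := by
          rw [uIoc_of_le hpq]
          exact (((hc n).mono Ioc_subset_Icc_self).mul continuousOn_const).mul continuousOn_const
        exact this.aestronglyMeasurable measurableSet_uIoc
      · refine .of_forall fun t ht => ?_
        rw [uIoc_of_le hpq] at ht
        rw [norm_mul, norm_mul]
        have hC0 := (abs_nonneg _).trans (hC t ht n)
        exact mul_le_mul (mul_le_mul_of_nonneg_right (hC t ht n) (abs_nonneg _)) (hE e he n)
          (abs_nonneg _) (mul_nonneg hC0 (abs_nonneg _))
      · exact .of_forall fun t _ => (ha.abs.mul_left C).mul_right 2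
      · simp
      · refine .of_forall fun t ht => ?_
        rw [uIoc_of_le hpq] at ht
        exact (summable_mul_of_bounded' (summable_mul_of_bounded ha (hC t ht)) (hE e he)).hasSum
    have h2 : ∀ n, (∫ t in p..q, φ t n) * a n * e n = ∫ t in p..q, φ t n * a n * e n := fun n => by
      simp only [intervalIntegral.integral_mul_const]
    simp only [h2]
    rw [key.tsum_eq]
    refine intervalIntegral.integral_nonneg_of_ae_restrict hpq ?_
    rw [Filter.EventuallyLE, ← restrict_Ioc_eq_restrict_Icc,
      ae_restrict_iff' measurableSet_Ioc]
    exact .of_forall fun t ht => (hφ t ht).nonneg a ha h e he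

/-- If `s / (s + b)` is a cone multiplier for all `s > 0` then so is `1 / (c + b ^ β)`. -/
theorem resolvent_rpow (hE : BoundedByTwo E) {b : ℤ → ℝ} (hb : ∀ n, 0 ≤ b n)
    (h : ∀ s > 0, ConeMultiplier E fun n => 1 / (s + b n)) {β c : ℝ} (hβ : β ∈ Ioo (0 : ℝ) 1)
    (hc : 0 < c) : ConeMultiplier E fun n => 1 / (c + b n ^ β) := by
  set κ : ℝ := (∫ t in Ioi 0, rpowIntegrand₀₁ β t 1)⁻¹ with hκ
  have hκ0 : 0 ≤ κ := (inv_pos.2 (integral_rpowIntegrand₀₁_one_pos hβ)).le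
  have hp : ∀ j : ℕ, (0 : ℝ) < 1 / (j + 1) := fun j => by positivity
  have hpq : ∀ j : ℕ, (1 : ℝ) / (j + 1) ≤ j + 1 := fun j => by
    rw [div_le_iff₀ (by positivity)]
    have : (0 : ℝ) ≤ j := j.cast_nonneg
    nlinarith
  have hcont : ∀ (j : ℕ) n, ContinuousOn (fun t : ℝ => t ^ β * (1 / (t + b n)))
      (Icc (1 / ((j : ℝ) + 1)) (j + 1)) := fun j n => by
    have hpos : ∀ t ∈ Icc (1 / ((j : ℝ) + 1)) (j + 1), 0 < t := fun t ht => (hp j).trans_le ht.1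
    refine ContinuousOn.mul (fun t ht => ?_) (ContinuousOn.div continuousOn_const
      (by fun_prop) fun t ht => ?_)
    · exact (Real.continuousAt_rpow_const _ _ (.inl (hpos t ht).ne')).continuousWithinAt
    · linarith [hpos t ht, hb n]
  have hcont0 : ∀ j : ℕ, ContinuousOn (fun t : ℝ => t ^ β * t⁻¹)
      (Icc (1 / ((j : ℝ) + 1)) (j + 1)) := fun j => by
    have hpos : ∀ t ∈ Icc (1 / ((j : ℝ) + 1)) (j + 1), 0 < t := fun t ht => (hp j).trans_le ht.1
    refine ContinuousOn.mul (fun t ht => ?_) (ContinuousOn.inv₀ continuousOn_id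
      fun t ht => (hpos t ht).ne')
    exact (Real.continuousAt_rpow_const _ _ (.inl (hpos t ht).ne')).continuousWithinAt
  refine resolvent_of_tendsto hE
    (k := fun j n => κ * ∫ t in (1 / ((j : ℝ) + 1))..(j + 1), t ^ β * (1 / (t + b n)))
    (M := fun j => κ * ∫ t in (1 / ((j : ℝ) + 1))..(j + 1), t ^ β * t⁻¹) hc
    (fun j => ?_) (fun j n => ?_) (fun n => ?_)
  · refine const_mul (integral hE (C := ((j : ℝ) + 1) ^ β * ((j : ℝ) + 1)) (hpq j) (fun t ht => ?_)
      (fun t ht n => ?_) (hcont j)) hκ0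
    · have ht0 : 0 < t := (hp j).trans ht.1
      exact (h t ht0).const_mul (by positivity)
    · have ht0 : 0 < t := (hp j).trans ht.1
      have hbn := hb n
      rw [abs_of_nonneg (by positivity)]
      refine mul_le_mul (Real.rpow_le_rpow ht0.le ht.2 hβ.1.le) ?_ (by positivity) (by positivity)
      rw [div_le_iff₀ (by positivity)]
      have := ht.1
      rw [div_lt_iff₀ (by positivity)] at this
      nlinarith [mul_nonneg hbn (by positivity : (0 : ℝ) ≤ j + 1)]
  · rw [abs_of_nonneg]
    · refine mul_le_mul_of_nonneg_left (intervalIntegral.integral_mono_on (hpq j)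
        ((hcont j n).intervalIntegrable_of_Icc (hpq j))
        ((hcont0 j).intervalIntegrable_of_Icc (hpq j)) fun t ht => ?_) hκ0
      have ht0 : 0 < t := (hp j).trans_le ht.1
      refine mul_le_mul_of_nonneg_left ?_ (by positivity)
      rw [one_div]
      exact inv_anti₀ ht0 (by linarith [hb n])
    · refine mul_nonneg hκ0 (intervalIntegral.integral_nonneg (hpq j) fun t ht => ?_)
      have ht0 : 0 < t := (hp j).trans_le ht.1
      have := hb n
      positivity
  · rw [rpow_eq_const_mul_integral hβ (hb n), ← hκ]
    simp only [← mul_sub]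
    refine Tendsto.const_mul _ ?_
    have h1 : ∀ j : ℕ, (∫ t in (1 / ((j : ℝ) + 1))..(j + 1), t ^ β * t⁻¹) -
        (∫ t in (1 / ((j : ℝ) + 1))..(j + 1), t ^ β * (1 / (t + b n))) =
        ∫ t in Ioc (1 / ((j : ℝ) + 1)) (j + 1), rpowIntegrand₀₁ β t (b n) := fun j => by
      rw [← intervalIntegral.integral_sub ((hcont0 j).intervalIntegrable_of_Icc (hpq j))
        ((hcont j n).intervalIntegrable_of_Icc (hpq j)), intervalIntegral.integral_of_le (hpq j)]
      refine setIntegral_congr_fun measurableSet_Ioc fun t _ => ?_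
      simp only [rpowIntegrand₀₁, one_div]
      ring
    simp only [h1]
    have hcov : AECover (volume.restrict (Ioi (0 : ℝ))) atTop
        fun j : ℕ => Ioc (1 / ((j : ℝ) + 1)) (j + 1) :=
      (aecover_Ioi_of_Ioi tendsto_one_div_add_atTop_nhds_zero_nat).inter
        (aecover_Iic (tendsto_natCast_atTop_atTop.atTop_add tendsto_const_nhds)).restrict
    have := hcov.integral_tendsto_of_countably_generated (integrableOn_rpowIntegrand₀₁_Ioi hβ (hb n))
    refine this.congr fun j => ?_
    rw [Measure.restrict_restrict measurableSet_Ioc, inter_eq_left.2]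
    exact fun t ht => (hp j).trans ht.1

end ConeMultiplier

/-- The even `2π`-periodic extension of the restriction of `g` to `[0, π]`. -/
noncomputable def evenPer (g : ℝ → ℝ) (x : ℝ) : ℝ := g (arccos (cos x))

/-- The cosine series with coefficients `a`. -/
noncomputable def cosSeries (a : ℤ → ℝ) (x : ℝ) : ℝ := ∑' n : ℤ, a n * cos (n * x)

/-- The cosine coefficients of a function on `[0, π]`. -/
noncomputable def cosCoeff (g : ℝ → ℝ) (n : ℤ) : ℝ := 1 / π * ∫ x in (0 : ℝ)..π, g x * cos (n * x)

theorem evenPer_periodic (g : ℝ → ℝ) : Function.Periodic (evenPer g) (2 * π) := fun x => by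
  simp [evenPer]

theorem evenPer_neg (g : ℝ → ℝ) (x : ℝ) : evenPer g (-x) = evenPer g x := by
  simp [evenPer]

theorem evenPer_of_mem (g : ℝ → ℝ) {x : ℝ} (hx : x ∈ Icc 0 π) : evenPer g x = g x := by
  rw [evenPer, arccos_cos hx.1 hx.2]

theorem cos_int_mul_eq_of_cos_eq {x y : ℝ} (h : cos x = cos y) (n : ℤ) :
    cos (n * x) = cos (n * y) := by
  obtain ⟨k, hk⟩ := cos_eq_cos_iff.1 h
  rcases hk with rfl | rfl
  · rw [show (n : ℝ) * (2 * k * π + x) = n * x + (n * k : ℤ) * (2 * π) by push_cast; ring,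
      cos_add_int_mul_two_pi]
  · rw [show (n : ℝ) * (2 * k * π - x) = (n * k : ℤ) * (2 * π) - n * x by push_cast; ring,
      cos_int_mul_two_pi_sub]

theorem cos_int_mul_arccos_cos (n : ℤ) (x : ℝ) : cos (n * arccos (cos x)) = cos (n * x) :=
  cos_int_mul_eq_of_cos_eq (by rw [cos_arccos (neg_one_le_cos x) (cos_le_one x)]) n

theorem evenPer_cosSeries (a : ℤ → ℝ) : evenPer (cosSeries a) = cosSeries a := by
  ext x
  simp only [evenPer, cosSeries, cos_int_mul_arccos_cos]

theorem summable_mul_cos {a : ℤ → ℝ} (ha : Summable a) (x : ℝ) :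
    Summable fun n : ℤ => a n * cos (n * x) :=
  summable_mul_of_bounded' (m := fun n : ℤ => cos (n * x)) ha fun _ => abs_cos_le_one _

theorem continuous_cosSeries {a : ℤ → ℝ} (ha : Summable a) : Continuous (cosSeries a) := by
  refine continuous_tsum (u := fun n => |a n|) (fun n => by fun_prop) ha.abs fun n x => ?_
  rw [norm_mul]
  exact mul_le_of_le_one_right (abs_nonneg _) (abs_cos_le_one _)

theorem two_mul_sinc (n : ℤ) (h x : ℝ) :
    ∫ t in (x - h)..(x + h), cos (n * t) = 2 * h * (sinc (n * h) * cos (n * x)) := by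
  rcases eq_or_ne n 0 with rfl | hn
  · simp; ring
  · rcases eq_or_ne h 0 with rfl | hh
    · simp
    have hn' : (n : ℝ) ≠ 0 := by exact_mod_cast hn
    have := intervalIntegral.integral_comp_mul_left (a := x - h) (b := x + h) cos hn'
    rw [this, integral_cos, sinc_of_ne_zero (mul_ne_zero hn' hh), smul_eq_mul, sin_sub_sin]
    rw [show (n * (x + h) - n * (x - h)) / 2 = n * h by ring,
      show (n * (x + h) + n * (x - h)) / 2 = n * x by ring]
    field_simp

theorem hasSum_integral_cosSeries_mul {a : ℤ → ℝ} (ha : Summable a) {g : ℝ → ℝ} {p q : ℝ}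
    (hg : IntervalIntegrable g volume p q) :
    HasSum (fun n : ℤ => a n * ∫ t in p..q, g t * cos (n * t))
      (∫ t in p..q, g t * cosSeries a t) := by
  simp only [← intervalIntegral.integral_const_mul]
  refine intervalIntegral.hasSum_integral_of_dominated_convergence (fun n t => |a n| * |g t|)
    (fun n => ?_) (fun _ => ?_) ?_ ?_ ?_
  · have h1 : Continuous fun t : ℝ => cos (n * t) := by fun_prop
    exact (hg.def'.aestronglyMeasurable.mul h1.aestronglyMeasurable).const_mul _
  · refine .of_forall fun t _ => ?_
    rw [norm_mul, norm_mul]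
    exact mul_le_mul_of_nonneg_left (mul_le_of_le_one_right (abs_nonneg _) (abs_cos_le_one _))
      (abs_nonneg _)
  · exact .of_forall fun t _ => ha.abs.mul_right _
  · simp only [tsum_mul_right]
    exact hg.abs.const_mul _
  · refine .of_forall fun t _ => ?_
    simpa only [cosSeries, mul_left_comm] using (summable_mul_cos ha t).hasSum.mul_left (g t)

theorem integral_cosSeries {a : ℤ → ℝ} (ha : Summable a) (x h : ℝ) :
    ∫ t in (x - h)..(x + h), cosSeries a t =
      2 * h * cosSeries (fun n => sinc (n * h) * a n) x := by
  have := hasSum_integral_cosSeries_mul ha (g := fun _ => 1) (p := x - h) (q := x + h) (by simp)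
  simp only [one_mul, two_mul_sinc] at this
  rw [← this.tsum_eq, cosSeries, ← tsum_mul_left]
  exact tsum_congr fun n => by ring

theorem integral_window_le {F : ℝ → ℝ} (hi : ∀ p q, IntervalIntegrable F volume p q) {h x y : ℝ}
    (hxy : x ≤ y) (hF : ∀ᵐ t, t ∈ Icc x y → F (t + h) ≤ F (t - h)) :
    ∫ t in (y - h)..(y + h), F t ≤ ∫ t in (x - h)..(x + h), F t := by
  rw [← sub_nonneg, intervalIntegral.integral_interval_sub_interval_comm (hi _ _) (hi _ _) (hi _ _),
    sub_nonneg, ← intervalIntegral.integral_comp_add_right (a := x) (b := y) F h,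
    ← intervalIntegral.integral_comp_sub_right (a := x) (b := y) F h]
  have h1 : IntervalIntegrable (fun t => F (t + h)) volume x y := by
    simpa using (hi (x + h) (y + h)).comp_add_right h
  have h2 : IntervalIntegrable (fun t => F (t - h)) volume x y := by
    simpa using (hi (x - h) (y - h)).comp_sub_right h
  exact intervalIntegral.integral_mono_ae_restrict hxy h1 h2
    ((ae_restrict_iff' measurableSet_Icc).2 hF)

theorem integral_evenPer_antitone {g : ℝ → ℝ} (hg : AntitoneOn g (Ioc 0 π))
    (hi : ∀ p q, IntervalIntegrable (evenPer g) volume p q) {h : ℝ} (hh : h ∈ Ioc 0 π) :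
    AntitoneOn (fun x => ∫ t in (x - h)..(x + h), evenPer g t) (Icc 0 π) := by
  intro x hx y hy hxy
  refine integral_window_le hi hxy ?_
  have hne : ∀ᵐ t : ℝ, t ≠ h := by simp [ae_iff]
  filter_upwards [hne] with t ht htm
  have ht0 : 0 ≤ t := hx.1.trans htm.1
  have htπ : t ≤ π := htm.2.trans hy.2
  have hlt : cos (t - h) < 1 := by
    refine lt_of_le_of_ne (cos_le_one _) fun hc => ht ?_
    rw [cos_eq_one_iff_of_lt_of_lt (by linarith [hh.2, pi_pos]) (by linarith [hh.1, pi_pos])] at hc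
    linarith
  have hle : cos (t + h) ≤ cos (t - h) := by
    rw [cos_add, cos_sub]
    have := mul_nonneg (sin_nonneg_of_nonneg_of_le_pi ht0 htπ)
      (sin_nonneg_of_nonneg_of_le_pi hh.1.le hh.2)
    linarith
  have hpos := arccos_pos.2 hlt
  have hmono := arccos_le_arccos hle
  exact hg ⟨hpos, arccos_le_pi _⟩ ⟨hpos.trans_le hmono, arccos_le_pi _⟩ hmono

/-- Evaluation functionals. -/
def evalTests : Set (ℤ → ℝ) := {e | ∃ x : ℝ, e = fun n : ℤ => cos (n * x)}

/-- Differences of evaluation functionals at ordered points of `[0, π]`. -/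
def diffTests : Set (ℤ → ℝ) :=
  {e | ∃ x ∈ Icc 0 π, ∃ y ∈ Icc 0 π, x ≤ y ∧ e = fun n : ℤ => cos (n * x) - cos (n * y)}

theorem boundedByTwo_evalTests : BoundedByTwo evalTests := by
  rintro e ⟨x, rfl⟩ n
  exact (abs_cos_le_one _).trans one_le_two

theorem boundedByTwo_diffTests : BoundedByTwo diffTests := by
  rintro e ⟨x, -, y, -, -, rfl⟩ n
  refine (abs_sub _ _).trans ?_
  linarith [abs_cos_le_one (n * x), abs_cos_le_one (n * y)]

theorem evalTests_nonneg_iff {a : ℤ → ℝ} :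
    (∀ e ∈ evalTests, 0 ≤ ∑' n, a n * e n) ↔ ∀ x, 0 ≤ cosSeries a x := by
  constructor
  · exact fun h x => h _ ⟨x, rfl⟩
  · rintro h e ⟨x, rfl⟩
    exact h x

theorem diffTests_nonneg_iff {a : ℤ → ℝ} (ha : Summable a) :
    (∀ e ∈ diffTests, 0 ≤ ∑' n, a n * e n) ↔ AntitoneOn (cosSeries a) (Icc 0 π) := by
  have key : ∀ x y : ℝ, ∑' n : ℤ, a n * (cos (n * x) - cos (n * y)) =
      cosSeries a x - cosSeries a y := fun x y => by
    simp only [mul_sub]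
    exact (summable_mul_cos ha x).tsum_sub (summable_mul_cos ha y)
  constructor
  · intro h x hx y hy hxy
    have := h _ ⟨x, hx, y, hy, hxy, rfl⟩
    rw [key] at this
    linarith
  · rintro h e ⟨x, hx, y, hy, hxy, rfl⟩
    rw [key]
    linarith [h hx hy hxy]

theorem abs_sinc_mul_le (h : ℝ) (n : ℤ) : |sinc (n * h)| ≤ 1 := abs_sinc_le_one _

theorem coneMultiplier_sinc_evalTests {h : ℝ} (hh : h ∈ Ioc 0 π) :
    ConeMultiplier evalTests fun n => sinc (n * h) := by
  refine ⟨⟨1, abs_sinc_mul_le h⟩, fun a ha hpos => ?_⟩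
  rw [evalTests_nonneg_iff] at hpos ⊢
  intro x
  have h1 := integral_cosSeries ha x h
  have h2 : 0 ≤ ∫ t in (x - h)..(x + h), cosSeries a t :=
    intervalIntegral.integral_nonneg (by linarith [hh.1]) fun t _ => hpos t
  rw [h1] at h2
  exact nonneg_of_mul_nonneg_right h2 (by linarith [hh.1])

theorem coneMultiplier_sinc_diffTests {h : ℝ} (hh : h ∈ Ioc 0 π) :
    ConeMultiplier diffTests fun n => sinc (n * h) := by
  refine ⟨⟨1, abs_sinc_mul_le h⟩, fun a ha hpos => ?_⟩
  rw [diffTests_nonneg_iff ha] at hpos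
  rw [diffTests_nonneg_iff (summable_mul_of_bounded ha (abs_sinc_mul_le h))]
  have h1 := integral_evenPer_antitone (hpos.mono Ioc_subset_Icc_self) (fun p q => by
    rw [evenPer_cosSeries]
    exact (continuous_cosSeries ha).intervalIntegrable p q) hh
  simp only [evenPer_cosSeries, integral_cosSeries ha] at h1
  intro x hx y hy hxy
  exact le_of_mul_le_mul_left (h1 hx hy hxy) (by linarith [hh.1])

theorem abs_sinc_sub_le {t : ℝ} (ht : |t| ≤ 1) : |1 - sinc t - t ^ 2 / 6| ≤ t ^ 4 / 100 := by
  rcases eq_or_ne t 0 with rfl | h0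
  · simp
  · have h1 := sin_bound ht
    have h2 : 1 - sinc t - t ^ 2 / 6 = -((sin t - (t - t ^ 3 / 6)) / t) := by
      rw [sinc_of_ne_zero h0]; field_simp; ring
    rw [h2, abs_neg, abs_div, div_le_iff₀ (abs_pos.2 h0)]
    refine h1.trans (le_of_eq ?_)
    have : t ^ 4 = |t| ^ 4 := by rw [← abs_pow, abs_of_nonneg (by positivity)]
    rw [this]; ring

theorem tendsto_sinc_symbol (n : ℤ) :
    Tendsto (fun j : ℕ => 6 * ((j : ℝ) + 1) ^ 2 -
      6 * ((j : ℝ) + 1) ^ 2 * sinc (n * (1 / ((j : ℝ) + 1)))) atTop (𝓝 ((n : ℝ) ^ 2)) := by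
  have h0 := tendsto_one_div_add_atTop_nhds_zero_nat (𝕜 := ℝ)
  rw [tendsto_iff_norm_sub_tendsto_zero]
  have h2 : Tendsto (fun j : ℕ => 6 / 100 * (n : ℝ) ^ 4 * (1 / ((j : ℝ) + 1)) ^ 2) atTop (𝓝 0) := by
    simpa using (h0.pow 2).const_mul (6 / 100 * (n : ℝ) ^ 4)
  have h3 : Tendsto (fun j : ℕ => |(n : ℝ) * (1 / ((j : ℝ) + 1))|) atTop (𝓝 0) := by
    simpa using (h0.const_mul (n : ℝ)).abs
  refine squeeze_zero' (.of_forall fun _ => norm_nonneg _) ?_ h2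
  filter_upwards [h3.eventually_le_const one_pos] with j hj
  have h4 := abs_sinc_sub_le hj
  set u : ℝ := (j : ℝ) + 1 with hu
  have hu0 : 0 < u := by positivity
  have h5 : 6 * u ^ 2 - 6 * u ^ 2 * sinc (n * (1 / u)) - (n : ℝ) ^ 2 =
      6 * u ^ 2 * (1 - sinc (n * (1 / u)) - (n * (1 / u)) ^ 2 / 6) := by
    field_simp
  rw [h5, norm_mul, norm_eq_abs, norm_eq_abs, abs_of_pos (by positivity : 0 < 6 * u ^ 2)]
  refine (mul_le_mul_of_nonneg_left h4 (by positivity)).trans (le_of_eq ?_)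
  field_simp

theorem coneMultiplier_resolvent {E : Set (ℤ → ℝ)} (hE : BoundedByTwo E)
    (hbox : ∀ h ∈ Ioc 0 π, ConeMultiplier E fun n => sinc (n * h)) {c α : ℝ} (hc : 0 < c)
    (hα : 0 < α) (hα₂ : α ≤ 2) : ConeMultiplier E fun n => 1 / (c + |(n : ℝ)| ^ α) := by
  have hsq : ∀ s > 0, ConeMultiplier E fun n => 1 / (s + (n : ℝ) ^ 2) := fun s hs => by
    refine ConeMultiplier.resolvent_of_tendsto hE hs (fun j => (hbox (1 / ((j : ℝ) + 1))
      ⟨by positivity, ?_⟩).const_mul (t := 6 * ((j : ℝ) + 1) ^ 2) (by positivity))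
      (fun j n => ?_) tendsto_sinc_symbol
    · have : 1 / ((j : ℝ) + 1) ≤ 1 := by
        rw [div_le_one (by positivity)]
        linarith [(j.cast_nonneg : (0 : ℝ) ≤ j)]
      linarith [pi_gt_three]
    · rw [abs_mul, abs_of_nonneg (by positivity)]
      exact mul_le_of_le_one_right (by positivity) (abs_sinc_le_one _)
  rcases hα₂.eq_or_lt with rfl | hlt
  · simpa using hsq c hc
  · have := ConeMultiplier.resolvent_rpow hE (fun n => sq_nonneg (n : ℝ)) hsq (β := α / 2)
      ⟨by linarith, by linarith⟩ hc
    convert this using 4 with n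
    rw [← sq_abs, ← rpow_natCast, ← rpow_mul (abs_nonneg _)]
    congr 1
    push_cast; ring

/-- The normalised cosine integral over the period starting at `a`. -/
noncomputable def fullCos (a : ℝ) (f : ℝ → ℝ) (n : ℤ) : ℝ :=
  1 / (2 * π) * ∫ x in a..(a + 2 * π), f x * cos (n * x)

/-- The normalised sine integral over the period starting at `a`. -/
noncomputable def fullSin (a : ℝ) (f : ℝ → ℝ) (n : ℤ) : ℝ :=
  1 / (2 * π) * ∫ x in a..(a + 2 * π), f x * sin (n * x)

theorem integral_mul_exp {f : ℝ → ℝ} {p q : ℝ} (hf : IntervalIntegrable f volume p q) (n : ℤ) :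
    ∫ x in p..q, (f x : ℂ) * Complex.exp (-(Complex.I * (n : ℂ) * (x : ℂ))) =
      ((∫ x in p..q, f x * cos (n * x) : ℝ) : ℂ) -
        ((∫ x in p..q, f x * sin (n * x) : ℝ) : ℂ) * Complex.I := by
  have h1 : IntervalIntegrable (fun x => f x * cos (n * x)) volume p q :=
    hf.mul_continuousOn (by fun_prop)
  have h2 : IntervalIntegrable (fun x => f x * sin (n * x)) volume p q :=
    hf.mul_continuousOn (by fun_prop)
  rw [← intervalIntegral.integral_ofReal, ← intervalIntegral.integral_ofReal,
    ← intervalIntegral.integral_mul_const, ← intervalIntegral.integral_sub]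
  · refine intervalIntegral.integral_congr fun x _ => ?_
    have : -(Complex.I * (n : ℂ) * (x : ℂ)) = ((-(n * x) : ℝ) : ℂ) * Complex.I := by
      push_cast; ring
    simp only [this, Complex.exp_mul_I, ← Complex.ofReal_cos, ← Complex.ofReal_sin, cos_neg,
      sin_neg]
    push_cast; ring
  · exact ⟨h1.1.ofReal, h1.2.ofReal⟩
  · exact IntervalIntegrable.mul_const ⟨h2.1.ofReal, h2.2.ofReal⟩ _

theorem norm_fourierCoeffOn_sq {f : ℝ → ℝ} {a : ℝ} (hab : a < a + 2 * π)
    (hf : IntervalIntegrable f volume a (a + 2 * π)) (n : ℤ) :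
    ‖fourierCoeffOn hab (fun x => (f x : ℂ)) n‖ ^ 2 = fullCos a f n ^ 2 + fullSin a f n ^ 2 := by
  have : fourierCoeffOn hab (fun x => (f x : ℂ)) n =
      ((fullCos a f n : ℝ) : ℂ) + ((-fullSin a f n : ℝ) : ℂ) * Complex.I := by
    rw [fourierCoeffOn_eq_integral]
    have h1 : ∀ x : ℝ, fourier (-n) (x : AddCircle (a + 2 * π - a)) • (f x : ℂ) =
        (f x : ℂ) * Complex.exp (-(Complex.I * (n : ℂ) * (x : ℂ))) := fun x => by
      rw [fourier_coe_apply, smul_eq_mul, mul_comm]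
      congr 2
      have : (π : ℂ) ≠ 0 := by exact_mod_cast pi_ne_zero
      push_cast
      field_simp
      ring_nf
    simp only [h1]
    rw [integral_mul_exp hf, fullCos, fullSin, add_sub_cancel_left, Complex.real_smul]
    push_cast; ring
  rw [this, ← Complex.normSq_eq_norm_sq, Complex.normSq_add_mul_I]
  ring

theorem fullCos_add {f g : ℝ → ℝ} {a : ℝ} (hf : IntervalIntegrable f volume a (a + 2 * π))
    (hg : IntervalIntegrable g volume a (a + 2 * π)) (n : ℤ) :
    fullCos a (f + g) n = fullCos a f n + fullCos a g n := by
  simp only [fullCos, Pi.add_apply, add_mul]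
  rw [intervalIntegral.integral_add, mul_add]
  exacts [hf.mul_continuousOn (by fun_prop), hg.mul_continuousOn (by fun_prop)]

theorem fullSin_add {f g : ℝ → ℝ} {a : ℝ} (hf : IntervalIntegrable f volume a (a + 2 * π))
    (hg : IntervalIntegrable g volume a (a + 2 * π)) (n : ℤ) :
    fullSin a (f + g) n = fullSin a f n + fullSin a g n := by
  simp only [fullSin, Pi.add_apply, add_mul]
  rw [intervalIntegral.integral_add, mul_add]
  exacts [hf.mul_continuousOn (by fun_prop), hg.mul_continuousOn (by fun_prop)]

theorem intervalIntegrable_of_memLp_two {f : ℝ → ℝ} {p q : ℝ} (hpq : p ≤ q)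
    (hf : MemLp f 2 (volume.restrict (Ioc p q))) : IntervalIntegrable f volume p q := by
  rw [intervalIntegrable_iff_integrableOn_Ioc_of_le hpq]
  exact hf.integrable (by norm_num)

theorem intervalIntegrable_mul_of_memLp_two {f g : ℝ → ℝ} {p q : ℝ} (hpq : p ≤ q)
    (hf : MemLp f 2 (volume.restrict (Ioc p q))) (hg : MemLp g 2 (volume.restrict (Ioc p q))) :
    IntervalIntegrable (fun x => f x * g x) volume p q := by
  rw [intervalIntegrable_iff_integrableOn_Ioc_of_le hpq]
  exact hf.integrable_mul hg

theorem memLp_two_Ioc_iff {f : ℝ → ℝ} {p q : ℝ} (hpq : p ≤ q) :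
    MemLp f 2 (volume.restrict (Ioc p q)) ↔ IntervalIntegrable f volume p q ∧
      IntervalIntegrable (fun x => f x ^ 2) volume p q := by
  rw [intervalIntegrable_iff_integrableOn_Ioc_of_le hpq,
    intervalIntegrable_iff_integrableOn_Ioc_of_le hpq]
  constructor
  · exact fun h => ⟨h.integrable (by norm_num), h.integrable_sq⟩
  · exact fun h => (memLp_two_iff_integrable_sq h.1.aestronglyMeasurable).2 h.2

theorem hasSum_fullCos_sq_add_fullSin_sq {f : ℝ → ℝ} {a : ℝ}
    (hf : MemLp f 2 (volume.restrict (Ioc a (a + 2 * π)))) :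
    HasSum (fun n => fullCos a f n ^ 2 + fullSin a f n ^ 2)
      (1 / (2 * π) * ∫ x in a..(a + 2 * π), f x ^ 2) := by
  have hab : a < a + 2 * π := by linarith [pi_pos]
  have := hasSum_sq_fourierCoeffOn hab (f := fun x => (f x : ℂ)) hf.ofReal
  simpa [norm_fourierCoeffOn_sq hab (intervalIntegrable_of_memLp_two hab.le hf)] using this

/-- Parseval's identity over one period. -/
theorem hasSum_fullCos_mul_add_fullSin_mul {f g : ℝ → ℝ} {a : ℝ}
    (hf : MemLp f 2 (volume.restrict (Ioc a (a + 2 * π))))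
    (hg : MemLp g 2 (volume.restrict (Ioc a (a + 2 * π)))) :
    HasSum (fun n => fullCos a f n * fullCos a g n + fullSin a f n * fullSin a g n)
      (1 / (2 * π) * ∫ x in a..(a + 2 * π), f x * g x) := by
  have hab : a ≤ a + 2 * π := by linarith [pi_pos]
  have h1 := hasSum_fullCos_sq_add_fullSin_sq (hf.add hg)
  have h2 := hasSum_fullCos_sq_add_fullSin_sq hf
  have h3 := hasSum_fullCos_sq_add_fullSin_sq hg
  have h4 := ((h1.sub h2).sub h3).mul_left (1 / 2)
  have if1 := intervalIntegrable_of_memLp_two hab hf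
  have ig1 := intervalIntegrable_of_memLp_two hab hg
  convert h4 using 1
  · rfl
  · ext n
    rw [fullCos_add if1 ig1, fullSin_add if1 ig1]
    ring
  · have e : ∫ x in a..(a + 2 * π), (f + g) x ^ 2 = (∫ x in a..(a + 2 * π), f x ^ 2) +
        2 * (∫ x in a..(a + 2 * π), f x * g x) + ∫ x in a..(a + 2 * π), g x ^ 2 := by
      have j1 := ((memLp_two_Ioc_iff hab).1 hf).2
      have j2 := ((memLp_two_Ioc_iff hab).1 hg).2
      have j3 := (intervalIntegrable_mul_of_memLp_two hab hf hg).const_mul 2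
      rw [← intervalIntegral.integral_const_mul, ← intervalIntegral.integral_add j1 j3,
        ← intervalIntegral.integral_add (j1.add j3) j2]
      refine intervalIntegral.integral_congr fun x _ => ?_
      simp only [Pi.add_apply]
      ring
    rw [e]
    ring

theorem integral_neg_pi_pi_evenPer (g : ℝ → ℝ) (hg : IntervalIntegrable g volume 0 π) :
    IntervalIntegrable (evenPer g) volume (-π) π ∧
      ∫ x in (-π)..π, evenPer g x = 2 * ∫ x in (0 : ℝ)..π, g x := by
  have h1 : IntervalIntegrable (evenPer g) volume 0 π :=
    hg.congr fun x hx => (evenPer_of_mem g (by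
      rw [uIoc_of_le pi_pos.le] at hx
      exact Ioc_subset_Icc_self hx)).symm
  have h2 : IntervalIntegrable (evenPer g) volume (-π) 0 := by
    have := (IntervalIntegrable.iff_comp_neg).1 h1
    simp only [evenPer_neg, neg_zero] at this
    exact this.symm
  refine ⟨h2.trans h1, ?_⟩
  have h3 : ∫ x in (0 : ℝ)..π, evenPer g x = ∫ x in (0 : ℝ)..π, g x :=
    intervalIntegral.integral_congr fun x hx =>
      evenPer_of_mem g (by rwa [uIcc_of_le pi_pos.le] at hx)
  have h4 : ∫ x in (-π)..0, evenPer g x = ∫ x in (0 : ℝ)..π, evenPer g x := by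
    have := intervalIntegral.integral_comp_neg (a := 0) (b := π) (evenPer g)
    simp only [evenPer_neg, neg_zero] at this
    exact this.symm
  rw [← intervalIntegral.integral_add_adjacent_intervals h2 h1, h4, h3]
  ring

theorem intervalIntegrable_evenPer {g : ℝ → ℝ} (hg : IntervalIntegrable g volume 0 π) (p q : ℝ) :
    IntervalIntegrable (evenPer g) volume p q := by
  have := (integral_neg_pi_pi_evenPer g hg).1
  refine (evenPer_periodic g).intervalIntegrable (t := -π) two_pi_pos.ne' ?_ p q
  rwa [show -π + 2 * π = π by ring]

theorem integral_evenPer_period {g : ℝ → ℝ} (hg : IntervalIntegrable g volume 0 π) (a : ℝ) :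
    ∫ x in a..(a + 2 * π), evenPer g x = 2 * ∫ x in (0 : ℝ)..π, g x := by
  rw [(evenPer_periodic g).intervalIntegral_add_eq a (-π), show -π + 2 * π = π by ring,
    (integral_neg_pi_pi_evenPer g hg).2]

theorem memLp_two_evenPer {g : ℝ → ℝ} (hg : MemLp g 2 (volume.restrict (Ioc 0 π))) {p q : ℝ}
    (hpq : p ≤ q) : MemLp (evenPer g) 2 (volume.restrict (Ioc p q)) := by
  rw [memLp_two_Ioc_iff pi_pos.le] at hg
  rw [memLp_two_Ioc_iff hpq]
  exact ⟨intervalIntegrable_evenPer hg.1 p q, intervalIntegrable_evenPer hg.2 p q⟩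

theorem intervalIntegrable_mul_cos {g : ℝ → ℝ} {p q : ℝ} (hg : IntervalIntegrable g volume p q)
    (n : ℤ) : IntervalIntegrable (fun x => g x * cos (n * x)) volume p q :=
  hg.mul_continuousOn (by fun_prop)

theorem evenPer_mul_cos (g : ℝ → ℝ) (n : ℤ) :
    evenPer (fun x => g x * cos (n * x)) = fun x => evenPer g x * cos (n * x) := by
  ext x
  simp only [evenPer, cos_int_mul_arccos_cos]

theorem fullCos_evenPer {g : ℝ → ℝ} (hg : IntervalIntegrable g volume 0 π) (a : ℝ) (n : ℤ) :
    fullCos a (evenPer g) n = cosCoeff g n := by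
  have := integral_evenPer_period (intervalIntegrable_mul_cos hg n) a
  rw [evenPer_mul_cos] at this
  rw [fullCos, this, cosCoeff]
  field_simp

theorem integral_odd {F : ℝ → ℝ} (hF : ∀ x, F (-x) = -F x) (p : ℝ) : ∫ x in (-p)..p, F x = 0 := by
  have := intervalIntegral.integral_comp_neg (a := -p) (b := p) F
  simp only [hF, neg_neg, intervalIntegral.integral_neg] at this
  linarith

theorem fullSin_evenPer (g : ℝ → ℝ) (a : ℝ) (n : ℤ) : fullSin a (evenPer g) n = 0 := by
  have hp : Function.Periodic (fun x => evenPer g x * sin (n * x)) (2 * π) := fun x => by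
    simp only [evenPer_periodic g x, mul_add, sin_add_int_mul_two_pi]
  rw [fullSin, hp.intervalIntegral_add_eq a (-π), show -π + 2 * π = π by ring, integral_odd,
    mul_zero]
  intro x
  simp [evenPer_neg]

/-- Parseval's identity for cosine coefficients. -/
theorem hasSum_cosCoeff_mul {f g : ℝ → ℝ} (hf : MemLp f 2 (volume.restrict (Ioc 0 π)))
    (hg : MemLp g 2 (volume.restrict (Ioc 0 π))) :
    HasSum (fun n => cosCoeff f n * cosCoeff g n) (1 / π * ∫ x in (0 : ℝ)..π, f x * g x) := by
  have hab : (0 : ℝ) ≤ 0 + 2 * π := by linarith [pi_pos]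
  have := hasSum_fullCos_mul_add_fullSin_mul (memLp_two_evenPer hf hab) (memLp_two_evenPer hg hab)
  simp only [fullCos_evenPer (intervalIntegrable_of_memLp_two pi_pos.le hf),
    fullCos_evenPer (intervalIntegrable_of_memLp_two pi_pos.le hg), fullSin_evenPer,
    mul_zero, add_zero] at this
  have h2 := integral_evenPer_period (intervalIntegrable_mul_of_memLp_two pi_pos.le hf hg) 0
  have h3 : evenPer (fun x => f x * g x) = fun x => evenPer f x * evenPer g x := rfl
  rw [h3] at h2
  rw [h2] at this
  convert this using 1
  field_simp

theorem cosCoeff_sub {f g : ℝ → ℝ} (hf : IntervalIntegrable f volume 0 π)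
    (hg : IntervalIntegrable g volume 0 π) (n : ℤ) :
    cosCoeff (f - g) n = cosCoeff f n - cosCoeff g n := by
  simp only [cosCoeff, Pi.sub_apply, sub_mul]
  rw [intervalIntegral.integral_sub, mul_sub]
  exacts [intervalIntegrable_mul_cos hf n, intervalIntegrable_mul_cos hg n]

theorem ae_eq_of_cosCoeff_eq {f g : ℝ → ℝ} (hf : MemLp f 2 (volume.restrict (Ioc 0 π)))
    (hg : MemLp g 2 (volume.restrict (Ioc 0 π))) (h : ∀ n, cosCoeff f n = cosCoeff g n) :
    f =ᵐ[volume.restrict (Ioc 0 π)] g := by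
  have h1 := hasSum_cosCoeff_mul (hf.sub hg) (hf.sub hg)
  simp only [cosCoeff_sub (intervalIntegrable_of_memLp_two pi_pos.le hf)
    (intervalIntegrable_of_memLp_two pi_pos.le hg), h, sub_self, mul_zero] at h1
  have h2 := h1.unique hasSum_zero
  have h3 : ∫ x in (0 : ℝ)..π, (f - g) x * (f - g) x = 0 := by
    simpa [pi_ne_zero] using h2
  rw [intervalIntegral.integral_of_le pi_pos.le, integral_eq_zero_iff_of_nonneg
    (fun x => mul_self_nonneg _) ((hf.sub hg).integrable_mul (hf.sub hg))] at h3
  filter_upwards [h3] with x hx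
  simpa [sub_eq_zero] using hx

theorem fullCos_window (x : ℝ) {h : ℝ} (hh : h ∈ Ioc 0 π) (n : ℤ) :
    fullCos (x - π) ((Ioc (x - h) (x + h)).indicator fun _ => 1) n =
      h / π * (sinc (n * h) * cos (n * x)) := by
  have h1 : ∀ t, (Ioc (x - h) (x + h)).indicator (fun _ => (1 : ℝ)) t * cos (n * t) =
      (Ioc (x - h) (x + h)).indicator (fun t => cos (n * t)) t := fun t => by
    by_cases ht : t ∈ Ioc (x - h) (x + h) <;> simp [ht]
  have h2 : Ioc (x - π) (x + π) ∩ Ioc (x - h) (x + h) = Ioc (x - h) (x + h) :=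
    inter_eq_right.2 (Ioc_subset_Ioc (by linarith [hh.2]) (by linarith [hh.2]))
  rw [fullCos, show x - π + 2 * π = x + π by ring]
  simp only [h1]
  rw [intervalIntegral.integral_of_le (by linarith [pi_pos]),
    setIntegral_indicator measurableSet_Ioc, h2,
    ← intervalIntegral.integral_of_le (by linarith [hh.1]), two_mul_sinc]
  field_simp

/-- Averages of the even periodic extension are cosine series. -/
theorem hasSum_window {g : ℝ → ℝ} (hg : MemLp g 2 (volume.restrict (Ioc 0 π))) {h : ℝ}
    (hh : h ∈ Ioc 0 π) (x : ℝ) :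
    HasSum (fun n : ℤ => sinc (n * h) * cosCoeff g n * cos (n * x))
      (1 / (2 * h) * ∫ t in (x - h)..(x + h), evenPer g t) := by
  have hab : x - π ≤ x - π + 2 * π := by linarith [pi_pos]
  have hw : MemLp ((Ioc (x - h) (x + h)).indicator fun _ => (1 : ℝ)) 2
      (volume.restrict (Ioc (x - π) (x - π + 2 * π))) :=
    (memLp_const 1).indicator measurableSet_Ioc
  have h1 := hasSum_fullCos_mul_add_fullSin_mul hw (memLp_two_evenPer hg hab)
  simp only [fullCos_evenPer (intervalIntegrable_of_memLp_two pi_pos.le hg), fullSin_evenPer,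
    fullCos_window x hh, mul_zero, add_zero] at h1
  have h2 : ∀ t, (Ioc (x - h) (x + h)).indicator (fun _ => (1 : ℝ)) t * evenPer g t =
      (Ioc (x - h) (x + h)).indicator (evenPer g) t := fun t => by
    by_cases ht : t ∈ Ioc (x - h) (x + h) <;> simp [ht]
  have h3 : Ioc (x - π) (x + π) ∩ Ioc (x - h) (x + h) = Ioc (x - h) (x + h) :=
    inter_eq_right.2 (Ioc_subset_Ioc (by linarith [hh.2]) (by linarith [hh.2]))
  simp only [h2] at h1
  rw [show x - π + 2 * π = x + π by ring, intervalIntegral.integral_of_le (by linarith [pi_pos]),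
    setIntegral_indicator measurableSet_Ioc, h3,
    ← intervalIntegral.integral_of_le (by linarith [hh.1])] at h1
  have hh0 := hh.1.ne'
  convert h1.mul_left (π / h) using 1
  · rfl
  · ext n
    field_simp
  · field_simp

/-- The symbol `c + |n| ^ α`. -/
noncomputable def symb (c α : ℝ) (n : ℤ) : ℝ := c + |(n : ℝ)| ^ α

theorem le_symb (c α : ℝ) (n : ℤ) : c ≤ symb c α n :=
  le_add_of_nonneg_right (rpow_nonneg (abs_nonneg _) _)

theorem symb_pos {c : ℝ} (hc : 0 < c) (α : ℝ) (n : ℤ) : 0 < symb c α n := hc.trans_le (le_symb c α n)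

theorem rpow_le_symb {c : ℝ} (hc : 0 < c) (α : ℝ) (n : ℤ) : |(n : ℝ)| ^ α ≤ symb c α n :=
  le_add_of_nonneg_left hc.le

theorem symb_neg (c α : ℝ) (n : ℤ) : symb c α (-n) = symb c α n := by simp [symb]

theorem symb_zero (c : ℝ) {α : ℝ} (hα : α ≠ 0) : symb c α 0 = c := by simp [symb, zero_rpow hα]

theorem symb_one (c α : ℝ) : symb c α 1 = c + 1 := by simp [symb]

theorem cosCoeff_neg (g : ℝ → ℝ) (n : ℤ) : cosCoeff g (-n) = cosCoeff g n := by simp [cosCoeff]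

theorem summable_of_le_abs_rpow {F : ℤ → ℝ} {b : ℝ} (hb : 1 < b) (h0 : ∀ n, 0 ≤ F n)
    (hF : ∀ n : ℤ, n ≠ 0 → F n ≤ |(n : ℝ)| ^ (-b)) : Summable F := by
  refine .of_norm_bounded_eventually (summable_abs_int_rpow hb) ?_
  rw [eventually_cofinite]
  refine (finite_singleton (0 : ℤ)).subset fun n hn => ?_
  by_contra h
  exact hn (by rw [norm_of_nonneg (h0 n)]; exact hF n h)

theorem summable_inv_symb_sq {c α : ℝ} (hc : 0 < c) (hα : 1 / 2 < α) :
    Summable fun n => (1 / symb c α n) ^ 2 := by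
  refine summable_of_le_abs_rpow (b := 2 * α) (by linarith) (fun n => sq_nonneg _) fun n hn => ?_
  have hn0 : 0 < |(n : ℝ)| := by positivity
  have h1 := rpow_le_symb hc α n
  have h2 : 0 < |(n : ℝ)| ^ α := by positivity
  have h3 : |(n : ℝ)| ^ (-(2 * α)) = (1 / |(n : ℝ)| ^ α) ^ 2 := by
    rw [rpow_neg hn0.le, mul_comm, rpow_mul hn0.le]
    simp
  rw [h3]
  have h4 := symb_pos hc α n
  gcongr

theorem summable_mul_of_sq {a b : ℤ → ℝ} (ha : Summable fun n => a n ^ 2)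
    (hb : Summable fun n => b n ^ 2) : Summable fun n => a n * b n := by
  refine .of_norm_bounded (ha.add hb) fun n => ?_
  rw [norm_mul, norm_eq_abs, norm_eq_abs, ← sq_abs (a n), ← sq_abs (b n)]
  nlinarith [sq_nonneg (|a n| - |b n|), sq_nonneg (|a n|), sq_nonneg (|b n|)]

theorem summable_cosCoeff_sq {g : ℝ → ℝ} (hg : MemLp g 2 (volume.restrict (Ioc 0 π))) :
    Summable fun n => cosCoeff g n ^ 2 := by
  simpa only [sq] using (hasSum_cosCoeff_mul hg hg).summable

theorem summable_resolvent {c α : ℝ} (hc : 0 < c) (hα : 1 / 2 < α) {g : ℝ → ℝ}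
    (hg : MemLp g 2 (volume.restrict (Ioc 0 π))) :
    Summable fun n => 1 / symb c α n * cosCoeff g n :=
  summable_mul_of_sq (summable_inv_symb_sq hc hα) (summable_cosCoeff_sq hg)

theorem summable_sinc_cosCoeff {g : ℝ → ℝ} (hg : MemLp g 2 (volume.restrict (Ioc 0 π))) {h : ℝ}
    (hh : h ∈ Ioc 0 π) : Summable fun n : ℤ => sinc (n * h) * cosCoeff g n := by
  simpa using (hasSum_window hg hh 0).summable

theorem cosSeries_sinc_cosCoeff {g : ℝ → ℝ} (hg : MemLp g 2 (volume.restrict (Ioc 0 π))) {h : ℝ}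
    (hh : h ∈ Ioc 0 π) (x : ℝ) : cosSeries (fun n : ℤ => sinc (n * h) * cosCoeff g n) x =
      1 / (2 * h) * ∫ t in (x - h)..(x + h), evenPer g t :=
  (hasSum_window hg hh x).tsum_eq

theorem one_div_mem_Ioc (j : ℕ) : 1 / ((j : ℝ) + 1) ∈ Ioc 0 π := by
  refine ⟨by positivity, ?_⟩
  have : 1 / ((j : ℝ) + 1) ≤ 1 := by
    rw [div_le_one (by positivity)]
    linarith [(j.cast_nonneg : (0 : ℝ) ≤ j)]
  linarith [pi_gt_three]

theorem resolvent_nonneg_of_windows {E : Set (ℤ → ℝ)} (hE : BoundedByTwo E)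
    (hbox : ∀ h ∈ Ioc 0 π, ConeMultiplier E fun n => sinc (n * h)) {c α : ℝ} (hc : 0 < c)
    (hα : 1 / 2 < α) (hα₂ : α ≤ 2) {g : ℝ → ℝ} (hg : MemLp g 2 (volume.restrict (Ioc 0 π)))
    (h : ∀ h ∈ Ioc 0 π, ∀ e ∈ E, 0 ≤ ∑' n : ℤ, sinc (n * h) * cosCoeff g n * e n) :
    ∀ e ∈ E, 0 ≤ ∑' n, 1 / symb c α n * cosCoeff g n * e n := by
  intro e he
  have hm := coneMultiplier_resolvent hE hbox hc (by linarith : 0 < α) hα₂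
  have hlim : Tendsto (fun j : ℕ => ∑' n : ℤ, 1 / symb c α n *
      (sinc (n * (1 / ((j : ℝ) + 1))) * cosCoeff g n) * e n) atTop
      (𝓝 (∑' n, 1 / symb c α n * cosCoeff g n * e n)) := by
    refine tendsto_tsum_of_dominated_convergence
      (bound := fun n => |1 / symb c α n * cosCoeff g n| * 2)
      ((summable_resolvent hc hα hg).abs.mul_right 2) (fun n => ?_) (.of_forall fun j n => ?_)
    · have h0 := tendsto_one_div_add_atTop_nhds_zero_nat (𝕜 := ℝ)
      have h1 : Tendsto (fun j : ℕ => sinc (n * (1 / ((j : ℝ) + 1)))) atTop (𝓝 1) := by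
        have := (continuous_sinc.tendsto 0).comp
          (by simpa only [mul_zero] using h0.const_mul (n : ℝ))
        rwa [sinc_zero] at this
      simpa using ((h1.mul_const (cosCoeff g n)).const_mul (1 / symb c α n)).mul_const (e n)
    · rw [norm_mul, mul_left_comm, norm_mul, norm_eq_abs, norm_eq_abs, norm_eq_abs]
      refine mul_le_mul ?_ (hE e he n) (abs_nonneg _) (abs_nonneg _)
      exact mul_le_of_le_one_left (abs_nonneg _) (abs_sinc_le_one _)
  exact ge_of_tendsto' hlim fun j => hm.nonneg _
    (summable_sinc_cosCoeff hg (one_div_mem_Ioc j)) (h _ (one_div_mem_Ioc j)) e he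

/-- The resolvent applied to a function on `[0, π]`. -/
noncomputable def resolvent (c α : ℝ) (g : ℝ → ℝ) : ℝ → ℝ :=
  cosSeries fun n => 1 / symb c α n * cosCoeff g n

theorem resolvent_nonneg {c α : ℝ} (hc : 0 < c) (hα : 1 / 2 < α) (hα₂ : α ≤ 2) {g : ℝ → ℝ}
    (hg : MemLp g 2 (volume.restrict (Ioc 0 π))) (h0 : ∀ x, 0 ≤ g x) (x : ℝ) :
    0 ≤ resolvent c α g x := by
  refine evalTests_nonneg_iff.1 (resolvent_nonneg_of_windows boundedByTwo_evalTests
    (fun h hh => coneMultiplier_sinc_evalTests hh) hc hα hα₂ hg fun h hh => ?_) x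
  rw [evalTests_nonneg_iff]
  intro y
  rw [cosSeries_sinc_cosCoeff hg hh]
  have := hh.1
  exact mul_nonneg (by positivity)
    (intervalIntegral.integral_nonneg (by linarith) fun t _ => h0 _)

theorem resolvent_antitoneOn {c α : ℝ} (hc : 0 < c) (hα : 1 / 2 < α) (hα₂ : α ≤ 2) {g : ℝ → ℝ}
    (hg : MemLp g 2 (volume.restrict (Ioc 0 π))) (hanti : AntitoneOn g (Ioc 0 π)) :
    AntitoneOn (resolvent c α g) (Icc 0 π) := by
  refine (diffTests_nonneg_iff (summable_resolvent hc hα hg)).1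
    (resolvent_nonneg_of_windows boundedByTwo_diffTests
    (fun h hh => coneMultiplier_sinc_diffTests hh) hc hα hα₂ hg fun h hh => ?_)
  rw [diffTests_nonneg_iff (summable_sinc_cosCoeff hg hh)]
  intro x hx y hy hxy
  rw [cosSeries_sinc_cosCoeff hg hh, cosSeries_sinc_cosCoeff hg hh]
  have h1 := hh.1
  exact mul_le_mul_of_nonneg_left (integral_evenPer_antitone hanti (intervalIntegrable_evenPer
    (intervalIntegrable_of_memLp_two pi_pos.le hg)) hh hx hy hxy) (by positivity)

/-- The cosine series recovers its coefficients. -/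
theorem cosCoeff_cosSeries {a : ℤ → ℝ} (ha : Summable a) (heven : ∀ n, a (-n) = a n) (n : ℤ) :
    cosCoeff (cosSeries a) n = a n := by
  have h1 := hasSum_integral_cosSeries_mul ha (g := fun t => cos (n * t)) (p := 0) (q := π)
    (Continuous.intervalIntegrable (by fun_prop) _ _)
  have h2 : ∀ m : ℤ, ∫ t in (0 : ℝ)..π, cos (n * t) * cos (m * t) =
      (if m = n then π / 2 else 0) + (if m = -n then π / 2 else 0) := by
    have key : ∀ k : ℤ, ∫ t in (0 : ℝ)..π, cos (k * t) = if k = 0 then π else 0 := fun k => by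
      have := two_mul_sinc k (π / 2) (π / 2)
      rw [sub_self, add_halves] at this
      rw [this]
      split_ifs with hk
      · simp only [hk, Int.cast_zero, zero_mul, sinc_zero, cos_zero]; ring
      · have hk' : (k : ℝ) ≠ 0 := by exact_mod_cast hk
        rw [sinc_of_ne_zero (by positivity)]
        have h3 : sin (k * (π / 2)) * cos (k * (π / 2)) = 0 := by
          have := sin_two_mul (k * (π / 2))
          rw [show 2 * (k * (π / 2)) = k * π by ring, sin_int_mul_pi] at this
          linarith
        rw [div_mul_eq_mul_div, h3]; simp
    intro m
    have h4 : ∀ t, cos (n * t) * cos (m * t) =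
        1 / 2 * cos ((m - n : ℤ) * t) + 1 / 2 * cos ((m + n : ℤ) * t) := fun t => by
      push_cast
      rw [sub_mul, add_mul, cos_sub, cos_add]; ring
    simp only [h4]
    rw [intervalIntegral.integral_add, intervalIntegral.integral_const_mul,
      intervalIntegral.integral_const_mul, key, key]
    · simp only [sub_eq_zero, add_eq_zero_iff_eq_neg, mul_ite, mul_zero]
      congr 2 <;> ring
    all_goals exact Continuous.intervalIntegrable (by fun_prop) _ _
  have h5 : HasSum (fun m => a m * ((if m = n then π / 2 else 0) + (if m = -n then π / 2 else 0)))
      (a n * (π / 2) + a n * (π / 2)) := by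
    have h6 : (fun m => a m * ((if m = n then π / 2 else 0) + (if m = -n then π / 2 else 0))) =
        fun m => (if m = n then a n * (π / 2) else 0) + (if m = -n then a n * (π / 2) else 0) := by
      ext m
      have e1 : m = n → a m = a n := fun h => by rw [h]
      have e2 : m = -n → a m = a n := fun h => by rw [h, heven]
      split_ifs with i1 i2 i2
      · rw [e1 i1]; ring
      · rw [e1 i1]; ring
      · rw [e2 i2]; ring
      · ring
    rw [h6]
    exact (hasSum_ite_eq n _).add (hasSum_ite_eq (-n) _)
  simp only [h2] at h1
  have h6 := h1.unique h5
  have h7 : ∫ t in (0 : ℝ)..π, cosSeries a t * cos (n * t) =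
      ∫ t in (0 : ℝ)..π, cos (n * t) * cosSeries a t := by simp only [mul_comm]
  rw [cosCoeff, h7, h6]
  field_simp
  ring

theorem sinc_sq_le {t : ℝ} (ht : t ≠ 0) : sinc t ^ 2 ≤ |t| ^ (-(4 / 9) : ℝ) := by
  have h0 : 0 < |t| := abs_pos.2 ht
  rcases le_total |t| 1 with h | h
  · have h1 : sinc t ^ 2 ≤ 1 := by
      rw [← sq_abs]
      exact pow_le_one₀ (abs_nonneg _) (abs_sinc_le_one t)
    exact h1.trans (one_le_rpow_of_pos_of_le_one_of_nonpos h0 h (by norm_num))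
  · have h1 : sinc t ^ 2 ≤ |t| ^ (-2 : ℝ) := by
      rw [rpow_neg h0.le, sinc_of_ne_zero ht, div_pow, ← sq_abs t]
      rw [show (2 : ℝ) = (2 : ℕ) by norm_num, rpow_natCast, div_eq_mul_inv]
      refine mul_le_of_le_one_left (by positivity) ?_
      rw [← sq_abs]
      exact pow_le_one₀ (abs_nonneg _) (abs_sin_le_one t)
    exact h1.trans (rpow_le_rpow_of_exponent_le h (by norm_num))

theorem exists_sinc_weight {c α : ℝ} (hc : 0 < c) (hα : 5 / 9 < α) :
    ∃ k : ℤ → ℝ, Summable k ∧ ∀ x ∈ Ioc 0 π, ∀ n : ℤ,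
      sinc (n * x) ^ 2 / symb c α n ≤ x ^ (-(4 / 9) : ℝ) * k n := by
  have hs : Summable fun n : ℤ => |(n : ℝ)| ^ (-(4 / 9) : ℝ) / symb c α n := by
    refine summable_of_le_abs_rpow (b := 4 / 9 + α) (by linarith)
      (fun n => div_nonneg (by positivity) (symb_pos hc α n).le) fun n hn => ?_
    have hn0 : 0 < |(n : ℝ)| := by positivity
    rw [neg_add, rpow_add hn0, rpow_neg hn0.le α, ← div_eq_mul_inv]
    exact div_le_div_of_nonneg_left (by positivity) (by positivity) (rpow_le_symb hc α n)
  refine ⟨fun n => |(n : ℝ)| ^ (-(4 / 9) : ℝ) / symb c α n + if n = 0 then π ^ (4 / 9 : ℝ) / c else 0,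
    hs.add (hasSum_ite_eq 0 _).summable, fun x hx n => ?_⟩
  have hx0 : 0 < x := hx.1
  rcases eq_or_ne n 0 with rfl | hn
  · have h1 : 1 ≤ x ^ (-(4 / 9) : ℝ) * π ^ (4 / 9 : ℝ) := by
      rw [rpow_neg hx0.le, inv_mul_eq_div, one_le_div (by positivity)]
      exact rpow_le_rpow hx0.le hx.2 (by norm_num)
    have h2 : 1 / symb c α 0 ≤ 1 / c := one_div_le_one_div_of_le hc (le_symb c α 0)
    have h3 : 0 ≤ x ^ (-(4 / 9) : ℝ) * (|((0 : ℤ) : ℝ)| ^ (-(4 / 9) : ℝ) / symb c α 0) :=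
      mul_nonneg (by positivity) (div_nonneg (by positivity) (symb_pos hc α 0).le)
    have h4 : 1 / c ≤ x ^ (-(4 / 9) : ℝ) * (π ^ (4 / 9 : ℝ) / c) := by
      rw [← mul_div_assoc]
      exact div_le_div_of_nonneg_right h1 hc.le
    simp only [Int.cast_zero, zero_mul, sinc_zero, if_true, mul_add] at h3 ⊢
    linarith
  · have hnx : (n : ℝ) * x ≠ 0 := mul_ne_zero (by exact_mod_cast hn) hx0.ne'
    simp only [if_neg hn, add_zero]
    rw [← mul_div_assoc]
    refine div_le_div_of_nonneg_right ((sinc_sq_le hnx).trans (le_of_eq ?_)) (symb_pos hc α n).le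
    rw [abs_mul, abs_of_pos hx0, mul_rpow (abs_nonneg _) hx0.le, mul_comm]

theorem le_cosSeries_sinc {b : ℤ → ℝ} (hb : Summable b)
    (hanti : AntitoneOn (cosSeries b) (Icc 0 π)) {x : ℝ} (hx : x ∈ Ioc 0 π) :
    cosSeries b x ≤ ∑' n : ℤ, sinc (n * x) * b n := by
  have h1 := integral_cosSeries hb 0 x
  have h2 : ∫ _t in (0 - x)..(0 + x), cosSeries b x ≤ ∫ t in (0 - x)..(0 + x), cosSeries b t := by
    refine intervalIntegral.integral_mono_on (by linarith [hx.1]) (by simp)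
      ((continuous_cosSeries hb).intervalIntegrable _ _) fun t ht => ?_
    have h3 : cosSeries b t = cosSeries b |t| := by
      rw [← evenPer_cosSeries b]
      simp only [evenPer, cos_abs]
    rw [h3]
    have h4 : |t| ≤ x := abs_le.2 ⟨by linarith [ht.1], by linarith [ht.2]⟩
    exact hanti ⟨abs_nonneg _, h4.trans hx.2⟩ ⟨hx.1.le, hx.2⟩ h4
  rw [h1, intervalIntegral.integral_const, smul_eq_mul] at h2
  have h5 : cosSeries (fun n : ℤ => sinc (n * x) * b n) 0 = ∑' n : ℤ, sinc (n * x) * b n := by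
    simp [cosSeries]
  rw [h5] at h2
  have := hx.1
  nlinarith

theorem exists_cosSeries_bound {c α : ℝ} (hc : 0 < c) (hα : 5 / 9 < α) :
    ∃ C : ℝ, ∀ b : ℤ → ℝ, Summable b → Summable (fun n => symb c α n * b n ^ 2) →
      ∑' n, symb c α n * b n ^ 2 ≤ 1 → AntitoneOn (cosSeries b) (Icc 0 π) →
      ∀ x ∈ Ioc 0 π, cosSeries b x ≤ C * x ^ (-(2 / 9) : ℝ) := by
  obtain ⟨k, hk, hle⟩ := exists_sinc_weight hc hα
  refine ⟨1 / 2 * (1 + ∑' n, k n), fun b hb hs h1 hanti x hx => ?_⟩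
  have hx0 : 0 < x := hx.1
  set r : ℝ := x ^ (-(2 / 9) : ℝ) with hr
  have hr0 : 0 < r := by positivity
  have hrr : x ^ (-(4 / 9) : ℝ) = r * r := by
    rw [hr, ← rpow_add hx0]; norm_num
  have hterm : ∀ n : ℤ, sinc (n * x) * b n ≤
      r / 2 * (symb c α n * b n ^ 2) + r / 2 * k n := fun n => by
    have hL := symb_pos hc α n
    have h2 := hle x hx n
    rw [hrr, div_le_iff₀ hL] at h2
    have h3 : 0 ≤ (r * symb c α n * b n - sinc (n * x)) ^ 2 := sq_nonneg _
    have h4 : 2 * r * symb c α n * (sinc (n * x) * b n) ≤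
        2 * r * symb c α n * (r / 2 * (symb c α n * b n ^ 2) + r / 2 * k n) := by
      nlinarith
    exact le_of_mul_le_mul_left h4 (by positivity)
  have hsum : Summable fun n : ℤ => sinc (n * x) * b n :=
    summable_mul_of_bounded hb (abs_sinc_mul_le x)
  calc cosSeries b x ≤ ∑' n : ℤ, sinc (n * x) * b n := le_cosSeries_sinc hb hanti hx
    _ ≤ ∑' n, (r / 2 * (symb c α n * b n ^ 2) + r / 2 * k n) :=
      hsum.tsum_le_tsum hterm ((hs.mul_left _).add (hk.mul_left _))
    _ = r / 2 * ∑' n, symb c α n * b n ^ 2 + r / 2 * ∑' n, k n := by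
      rw [(hs.mul_left _).tsum_add (hk.mul_left _), tsum_mul_left, tsum_mul_left]
    _ ≤ 1 / 2 * (1 + ∑' n, k n) * r := by nlinarith

theorem tendsto_of_antitoneOn_of_tendsto_rat {F : ℕ → ℝ → ℝ} {f : ℝ → ℝ} {x : ℝ}
    (hx : x ∈ Ioo 0 π) (hF : ∀ k, AntitoneOn (F k) (Ioc 0 π)) (hc : ContinuousAt f x)
    (hlim : ∀ q : ℚ, (q : ℝ) ∈ Ioc 0 π → Tendsto (fun k => F k q) atTop (𝓝 (f q))) :
    Tendsto (fun k => F k x) atTop (𝓝 (f x)) := by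
  have hxI : x ∈ Ioc 0 π := ⟨hx.1, hx.2.le⟩
  rw [tendsto_order]
  constructor
  · intro a ha
    obtain ⟨l, u, hlu, hsub⟩ := mem_nhds_iff_exists_Ioo_subset.1 (hc.eventually_const_lt ha)
    obtain ⟨q, hq1, hq2⟩ := exists_rat_btwn (lt_min hlu.2 hx.2)
    have hqI : (q : ℝ) ∈ Ioc 0 π := ⟨hx.1.trans hq1, (hq2.trans_le (min_le_right _ _)).le⟩
    have hfq : a < f q := hsub ⟨hlu.1.trans hq1, hq2.trans_le (min_le_left _ _)⟩
    filter_upwards [(hlim q hqI).eventually_const_lt hfq] with k hk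
    exact hk.trans_le (hF k hxI hqI hq1.le)
  · intro a ha
    obtain ⟨l, u, hlu, hsub⟩ := mem_nhds_iff_exists_Ioo_subset.1 (hc.eventually_lt_const ha)
    obtain ⟨q, hq1, hq2⟩ := exists_rat_btwn (max_lt hlu.1 hx.1)
    have hqI : (q : ℝ) ∈ Ioc 0 π := ⟨(le_max_right _ _).trans_lt hq1, hq2.le.trans hx.2.le⟩
    have hfq : f q < a := hsub ⟨(le_max_left _ _).trans_lt hq1, hq2.trans hlu.2⟩
    filter_upwards [(hlim q hqI).eventually_lt_const hfq] with k hk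
    exact (hF k hqI hxI hq2.le).trans_lt hk

/-- Helly's selection principle for antitone functions with a pointwise bound. -/
theorem exists_subseq_tendsto_of_antitoneOn {F : ℕ → ℝ → ℝ} {B : ℝ → ℝ}
    (hF : ∀ k, AntitoneOn (F k) (Ioc 0 π)) (h0 : ∀ k, ∀ x, 0 ≤ F k x)
    (hB : ∀ k, ∀ x ∈ Ioc 0 π, F k x ≤ B x) :
    ∃ (f : ℝ → ℝ) (φ : ℕ → ℕ), StrictMono φ ∧ AntitoneOn f (Ioc 0 π) ∧ (∀ x, 0 ≤ f x) ∧
      (∀ x ∈ Ioc 0 π, f x ≤ B x) ∧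
      ∀ᵐ x ∂volume.restrict (Ioc 0 π), Tendsto (fun k => F (φ k) x) atTop (𝓝 (f x)) := by
  set G : ℕ → ℝ → ℝ := fun k => (Ioc 0 π).indicator (F k) with hG
  have hGF : ∀ k, ∀ x ∈ Ioc 0 π, G k x = F k x := fun k x hx => indicator_of_mem hx _
  have hK : IsCompact (Set.univ.pi fun x : ℝ => Icc 0 |B x|) := isCompact_univ_pi fun x =>
    isCompact_Icc
  obtain ⟨f, hfK, hf⟩ := hK.exists_mapClusterPt (f := (atTop : Filter ℕ)) (u := G) (by
    rw [le_principal_iff, mem_map]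
    refine univ_mem' fun k x _ => ?_
    by_cases hx : x ∈ Ioc 0 π
    · rw [hGF k x hx]
      exact ⟨h0 k x, (hB k x hx).trans (le_abs_self _)⟩
    · simp only [hG, indicator_of_notMem hx]
      exact ⟨le_rfl, abs_nonneg _⟩)
  have hclosed : ∀ s : Set (ℝ → ℝ), IsClosed s → (∀ k, G k ∈ s) → f ∈ s := fun s hs hk =>
    isClosed_iff_clusterPt.1 hs f (ClusterPt.mono hf (by
      rw [le_principal_iff, mem_map]; exact univ_mem' hk))
  have hfanti : AntitoneOn f (Ioc 0 π) := fun x hx y hy hxy =>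
    hclosed {g | g y ≤ g x} (isClosed_le (continuous_apply y) (continuous_apply x)) fun k => by
      change G k y ≤ G k x
      rw [hGF k x hx, hGF k y hy]
      exact hF k hx hy hxy
  have hfB : ∀ x ∈ Ioc 0 π, f x ≤ B x := fun x hx =>
    hclosed {g | g x ≤ B x} (isClosed_le (continuous_apply x) continuous_const) fun k => by
      change G k x ≤ B x
      rw [hGF k x hx]
      exact hB k x hx
  have hR : MapClusterPt (fun q : ℚ => f q) atTop (fun k => fun q : ℚ => G k q) := by
    have hcont : Continuous fun g : ℝ → ℝ => fun q : ℚ => g q :=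
      continuous_pi fun q => continuous_apply _
    exact hf.continuousAt_comp hcont.continuousAt
  obtain ⟨φ, hφ, hlim⟩ := hR.tendsto_subseq
  rw [tendsto_pi_nhds] at hlim
  refine ⟨f, φ, hφ, hfanti, fun x => (hfK x trivial).1, hfB, ?_⟩
  have hcount := hfanti.countable_not_continuousWithinAt
  rw [ae_restrict_iff' measurableSet_Ioc]
  have hne : ∀ᵐ t : ℝ, t ≠ π := by simp [ae_iff]
  filter_upwards [hne, hcount.ae_notMem volume] with x hxπ hx hxI
  have hx' : x ∈ Ioo 0 π := ⟨hxI.1, lt_of_le_of_ne hxI.2 hxπ⟩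
  have hc : ContinuousWithinAt f (Ioc 0 π) x := by
    by_contra h
    exact hx ⟨hxI, h⟩
  refine tendsto_of_antitoneOn_of_tendsto_rat hx' (fun k => hF (φ k))
    (hc.continuousAt (Ioc_mem_nhds hx'.1 hx'.2)) fun q hq => ?_
  have := hlim q
  simpa only [Function.comp_apply, hGF _ _ hq] using this

/-- Nonnegative antitone functions on `(0, π]` with a power bound and energy at most one. -/
structure Admissible (c α C : ℝ) (f : ℝ → ℝ) : Prop where
  antitone : AntitoneOn f (Ioc 0 π)
  nonneg : ∀ x, 0 ≤ f x
  bound : ∀ x ∈ Ioc 0 π, f x ≤ C * x ^ (-(2 / 9) : ℝ)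
  energy : ∀ s : Finset ℤ, ∑ n ∈ s, symb c α n * cosCoeff f n ^ 2 ≤ 1

namespace Admissible

variable {c α C : ℝ} {f : ℝ → ℝ}

theorem pow_le (hf : Admissible c α C f) (m : ℕ) {x : ℝ} (hx : x ∈ Ioc 0 π) :
    f x ^ m ≤ C ^ m * x ^ (-(2 / 9) * m : ℝ) := by
  rw [rpow_mul hx.1.le, rpow_natCast, ← mul_pow]
  exact pow_le_pow_left₀ (hf.nonneg x) (hf.bound x hx) m

theorem intervalIntegrable_bound (C : ℝ) {m : ℕ} (hm : m ≤ 4) :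
    IntervalIntegrable (fun x => C ^ m * x ^ (-(2 / 9) * m : ℝ)) volume 0 π := by
  refine (intervalIntegral.intervalIntegrable_rpow' ?_).const_mul _
  have : (m : ℝ) ≤ 4 := by exact_mod_cast hm
  linarith

theorem aestronglyMeasurable_pow (hf : Admissible c α C f) (m : ℕ) :
    AEStronglyMeasurable (fun x => f x ^ m) (volume.restrict (Ioc 0 π)) :=
  ((aemeasurable_restrict_of_antitoneOn measurableSet_Ioc hf.antitone).pow_const
    m).aestronglyMeasurable

theorem intervalIntegrable_pow (hf : Admissible c α C f) {m : ℕ} (hm : m ≤ 4) :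
    IntervalIntegrable (fun x => f x ^ m) volume 0 π := by
  have h1 := intervalIntegrable_bound C hm
  rw [intervalIntegrable_iff_integrableOn_Ioc_of_le pi_pos.le] at h1 ⊢
  refine h1.mono' (hf.aestronglyMeasurable_pow m) ?_
  rw [ae_restrict_iff' measurableSet_Ioc]
  refine .of_forall fun x hx => ?_
  rw [norm_of_nonneg (pow_nonneg (hf.nonneg x) m)]
  exact hf.pow_le m hx

theorem memLp_two_pow (hf : Admissible c α C f) {m : ℕ} (hm : m ≤ 2) :
    MemLp (fun x => f x ^ m) 2 (volume.restrict (Ioc 0 π)) := by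
  rw [memLp_two_Ioc_iff pi_pos.le]
  refine ⟨hf.intervalIntegrable_pow (by omega), ?_⟩
  simp only [← pow_mul]
  exact hf.intervalIntegrable_pow (by omega)

theorem memLp_two (hf : Admissible c α C f) : MemLp f 2 (volume.restrict (Ioc 0 π)) := by
  simpa using hf.memLp_two_pow (m := 1) (by norm_num)

theorem tendsto_integral {F : ℕ → ℝ → ℝ} (hF : ∀ k, Admissible c α C (F k))
    (hlim : ∀ᵐ x ∂volume.restrict (Ioc 0 π), Tendsto (fun k => F k x) atTop (𝓝 (f x)))
    {m : ℕ} (hm : m ≤ 4) {w : ℝ → ℝ} (hw : Continuous w) (hw1 : ∀ x, |w x| ≤ 1) :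
    Tendsto (fun k => ∫ x in (0 : ℝ)..π, F k x ^ m * w x) atTop
      (𝓝 (∫ x in (0 : ℝ)..π, f x ^ m * w x)) := by
  rw [ae_restrict_iff' measurableSet_Ioc] at hlim
  refine intervalIntegral.tendsto_integral_filter_of_dominated_convergence
    (fun x => C ^ m * x ^ (-(2 / 9) * m : ℝ)) (.of_forall fun k => ?_) (.of_forall fun k => ?_)
    (intervalIntegrable_bound C hm) ?_
  · rw [uIoc_of_le pi_pos.le]
    exact ((hF k).aestronglyMeasurable_pow m).mul hw.aestronglyMeasurable
  · refine .of_forall fun x hx => ?_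
    rw [uIoc_of_le pi_pos.le] at hx
    rw [norm_mul, norm_of_nonneg (pow_nonneg ((hF k).nonneg x) m)]
    exact (mul_le_of_le_one_right (pow_nonneg ((hF k).nonneg x) m) (hw1 x)).trans
      ((hF k).pow_le m hx)
  · filter_upwards [hlim] with x hx hxI
    rw [uIoc_of_le pi_pos.le] at hxI
    exact ((hx hxI).pow m).mul_const _

theorem tendsto_cosCoeff {F : ℕ → ℝ → ℝ} (hF : ∀ k, Admissible c α C (F k))
    (hlim : ∀ᵐ x ∂volume.restrict (Ioc 0 π), Tendsto (fun k => F k x) atTop (𝓝 (f x))) (n : ℤ) :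
    Tendsto (fun k => cosCoeff (F k) n) atTop (𝓝 (cosCoeff f n)) := by
  have := tendsto_integral hF hlim (m := 1) (by norm_num) (w := fun x => cos (n * x))
    (by fun_prop) fun x => abs_cos_le_one _
  simp only [pow_one] at this
  exact this.const_mul _

theorem exists_maximizer (hne : ∃ f, Admissible c α C f) :
    ∃ f, Admissible c α C f ∧ ∀ g, Admissible c α C g →
      ∫ x in (0 : ℝ)..π, g x ^ 3 ≤ ∫ x in (0 : ℝ)..π, f x ^ 3 := by
  set S : Set ℝ := (fun f : ℝ → ℝ => ∫ x in (0 : ℝ)..π, f x ^ 3) '' {f | Admissible c α C f} with hS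
  have hSne : S.Nonempty := by
    obtain ⟨f, hf⟩ := hne
    exact ⟨_, f, hf, rfl⟩
  have hSbdd : BddAbove S := by
    refine ⟨∫ x in (0 : ℝ)..π, C ^ 3 * x ^ (-(2 / 9) * (3 : ℕ) : ℝ), ?_⟩
    rintro _ ⟨f, hf, rfl⟩
    have hf' : Admissible c α C f := hf
    refine intervalIntegral.integral_mono_on_of_le_Ioo pi_pos.le
      (hf'.intervalIntegrable_pow (by norm_num)) (intervalIntegrable_bound C (by norm_num))
      fun x hx => hf'.pow_le 3 (Ioo_subset_Ioc_self hx)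
  obtain ⟨u, -, hu, huS⟩ := exists_seq_tendsto_sSup hSne hSbdd
  choose F hF hFu using huS
  have hF' : ∀ k, Admissible c α C (F k) := hF
  obtain ⟨f, φ, hφ, hanti, h0, hB, hlim⟩ := exists_subseq_tendsto_of_antitoneOn
    (fun k => (hF' k).antitone) (fun k => (hF' k).nonneg) (fun k => (hF' k).bound)
  have hJ := tendsto_integral (fun k => hF' (φ k)) hlim (m := 3) (by norm_num) (w := fun _ => 1)
    continuous_const (by simp)
  simp only [mul_one] at hJ
  have hJ2 : Tendsto (fun k => ∫ x in (0 : ℝ)..π, F (φ k) x ^ 3) atTop (𝓝 (sSup S)) := by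
    refine (hu.comp hφ.tendsto_atTop).congr fun k => ?_
    exact (hFu (φ k)).symm
  have hJ3 := tendsto_nhds_unique hJ hJ2
  refine ⟨f, ⟨hanti, h0, hB, fun s => ?_⟩, fun g hg => ?_⟩
  · refine le_of_tendsto' (tendsto_finsetSum s fun n _ =>
      ((tendsto_cosCoeff (fun k => hF' (φ k)) hlim n).pow 2).const_mul (symb c α n)) fun k => ?_
    exact (hF' (φ k)).energy s
  · rw [hJ3]
    exact le_csSup hSbdd ⟨g, hg, rfl⟩

end Admissible

/-- A nonnegative antitone cosine series of energy at most one is admissible. -/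
theorem exists_admissible_constant {c α : ℝ} (hc : 0 < c) (hα : 5 / 9 < α) :
    ∃ C : ℝ, ∀ b : ℤ → ℝ, Summable b → (∀ n, b (-n) = b n) →
      Summable (fun n => symb c α n * b n ^ 2) → ∑' n, symb c α n * b n ^ 2 ≤ 1 →
      AntitoneOn (cosSeries b) (Icc 0 π) → (∀ x, 0 ≤ cosSeries b x) →
      Admissible c α C (cosSeries b) := by
  obtain ⟨C, hC⟩ := exists_cosSeries_bound hc hα
  refine ⟨C, fun b hb heven hs h1 hanti h0 => ⟨hanti.mono Ioc_subset_Icc_self, h0,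
    hC b hb hs h1 hanti, fun s => ?_⟩⟩
  simp only [cosCoeff_cosSeries hb heven]
  exact (hs.sum_le_tsum s fun n _ =>
    mul_nonneg (symb_pos hc α n).le (sq_nonneg _)).trans h1

theorem memLp_two_of_continuous {f : ℝ → ℝ} (hf : Continuous f) :
    MemLp f 2 (volume.restrict (Ioc 0 π)) :=
  (memLp_two_Ioc_iff pi_pos.le).2 ⟨hf.intervalIntegrable _ _, (hf.pow 2).intervalIntegrable _ _⟩

theorem cosSeries_mul_left (t : ℝ) (a : ℤ → ℝ) (x : ℝ) :
    cosSeries (fun n => t * a n) x = t * cosSeries a x := by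
  simp only [cosSeries, mul_assoc, tsum_mul_left]

theorem cosCoeff_congr_ae {f g : ℝ → ℝ} (h : f =ᵐ[volume.restrict (Ioc 0 π)] g) (n : ℤ) :
    cosCoeff f n = cosCoeff g n := by
  rw [cosCoeff, cosCoeff, intervalIntegral.integral_of_le pi_pos.le,
    intervalIntegral.integral_of_le pi_pos.le]
  congr 1
  refine integral_congr_ae ?_
  filter_upwards [h] with x hx
  rw [hx]

theorem Admissible.summable_energy {c α C : ℝ} (hc : 0 < c) {f : ℝ → ℝ}
    (hf : Admissible c α C f) : Summable (fun n => symb c α n * cosCoeff f n ^ 2) ∧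
      ∑' n, symb c α n * cosCoeff f n ^ 2 ≤ 1 := by
  have h0 : ∀ n, 0 ≤ symb c α n * cosCoeff f n ^ 2 := fun n =>
    mul_nonneg (symb_pos hc α n).le (sq_nonneg _)
  have hs := summable_of_sum_le h0 hf.energy
  exact ⟨hs, hs.tsum_le_of_sum_le hf.energy⟩

/-- The equality case of the Cauchy-Schwarz inequality for the weighted energy. -/
theorem eq_of_energy_le {L b p : ℤ → ℝ} {N T : ℝ} (hL : ∀ n, 0 < L n) (hN : 0 < N)
    (hb : HasSum (fun n => L n * b n ^ 2) (N ^ 2)) (hp : Summable fun n => L n * p n ^ 2)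
    (hp1 : ∑' n, L n * p n ^ 2 ≤ 1) (hT : HasSum (fun n => L n * (b n * p n)) T) :
    T ≤ N ∧ (N ≤ T → ∀ n, b n = N * p n) := by
  have h1 : HasSum (fun n => L n * (b n - N * p n) ^ 2)
      (N ^ 2 - 2 * N * T + N ^ 2 * ∑' n, L n * p n ^ 2) := by
    have h := (hb.sub (hT.mul_left (2 * N))).add (hp.hasSum.mul_left (N ^ 2))
    rwa [show (fun n => L n * b n ^ 2 - 2 * N * (L n * (b n * p n)) + N ^ 2 * (L n * p n ^ 2)) =
      fun n => L n * (b n - N * p n) ^ 2 from funext fun n => by ring] at h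
  have h0 : ∀ n, 0 ≤ L n * (b n - N * p n) ^ 2 := fun n => mul_nonneg (hL n).le (sq_nonneg _)
  have hN2 : N ^ 2 * ∑' n, L n * p n ^ 2 ≤ N ^ 2 := mul_le_of_le_one_right (sq_nonneg _) hp1
  refine ⟨?_, fun hNT n => ?_⟩
  · have h2 := h1.nonneg h0
    nlinarith
  · have h2 : L n * (b n - N * p n) ^ 2 ≤ 0 := (le_hasSum h1 n fun m _ => h0 m).trans (by nlinarith)
    have h3 := le_antisymm h2 (h0 n)
    rw [mul_eq_zero, or_iff_right (hL n).ne', sq_eq_zero_iff] at h3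
    linarith

/-- A maximizer of the cubic functional solves the stationary equation. -/
theorem exists_wave_of_maximizer {c α C : ℝ} (hc : 0 < c) (hα : 5 / 9 < α) (hα₂ : α ≤ 2)
    (hC : ∀ b : ℤ → ℝ, Summable b → (∀ n, b (-n) = b n) →
      Summable (fun n => symb c α n * b n ^ 2) → ∑' n, symb c α n * b n ^ 2 ≤ 1 →
      AntitoneOn (cosSeries b) (Icc 0 π) → (∀ x, 0 ≤ cosSeries b x) →
      Admissible c α C (cosSeries b)) {f : ℝ → ℝ} (hf : Admissible c α C f)
    (hmax : ∀ g, Admissible c α C g →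
      ∫ x in (0 : ℝ)..π, g x ^ 3 ≤ ∫ x in (0 : ℝ)..π, f x ^ 3)
    (hJ : 0 < ∫ x in (0 : ℝ)..π, f x ^ 3) :
    ∃ (a : ℤ → ℝ) (N : ℝ), 0 < N ∧ Summable a ∧ (∀ n, a (-n) = a n) ∧
      AntitoneOn (cosSeries a) (Icc 0 π) ∧ (∀ x, 0 ≤ cosSeries a x) ∧
      (∀ n, N * (symb c α n * a n) = cosCoeff (fun x => cosSeries a x ^ 2) n) ∧
      Admissible c α C (cosSeries a) ∧
      ∫ x in (0 : ℝ)..π, cosSeries a x ^ 3 = ∫ x in (0 : ℝ)..π, f x ^ 3 := by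
  have hα' : 1 / 2 < α := by linarith
  set J := ∫ x in (0 : ℝ)..π, f x ^ 3 with hJdef
  set g : ℝ → ℝ := fun x => f x ^ 2 with hgdef
  have hg : MemLp g 2 (volume.restrict (Ioc 0 π)) := hf.memLp_two_pow le_rfl
  have hganti : AntitoneOn g (Ioc 0 π) := fun x hx y hy hxy =>
    pow_le_pow_left₀ (hf.nonneg y) (hf.antitone hx hy hxy) 2
  set b : ℤ → ℝ := fun n => 1 / symb c α n * cosCoeff g n with hbdef
  have hLb : ∀ n, symb c α n * b n = cosCoeff g n := fun n => by
    have := (symb_pos hc α n).ne'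
    simp only [hbdef]
    field_simp
  have hb : Summable b := summable_resolvent hc hα' hg
  have hbeven : ∀ n, b (-n) = b n := fun n => by
    simp only [hbdef, symb_neg, cosCoeff_neg]
  have hbanti : AntitoneOn (cosSeries b) (Icc 0 π) := resolvent_antitoneOn hc hα' hα₂ hg hganti
  have hbnonneg : ∀ x, 0 ≤ cosSeries b x :=
    resolvent_nonneg hc hα' hα₂ hg fun x => sq_nonneg _
  have hbcont := continuous_cosSeries hb
  have hP1 : HasSum (fun n => symb c α n * b n ^ 2)
      (1 / π * ∫ x in (0 : ℝ)..π, g x * cosSeries b x) := by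
    have := hasSum_cosCoeff_mul hg (memLp_two_of_continuous hbcont)
    simp only [cosCoeff_cosSeries hb hbeven, ← hLb] at this
    simpa only [sq, mul_assoc] using this
  have hP2 : HasSum (fun n => symb c α n * (b n * cosCoeff f n)) (J / π) := by
    have := hasSum_cosCoeff_mul hg hf.memLp_two
    simp only [← hLb, mul_assoc] at this
    convert this using 1
    rw [hJdef, div_eq_inv_mul, one_div]
    congr 1
  set N2 := 1 / π * ∫ x in (0 : ℝ)..π, g x * cosSeries b x with hN2
  have hterm : ∀ n, 0 ≤ symb c α n * b n ^ 2 := fun n =>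
    mul_nonneg (symb_pos hc α n).le (sq_nonneg _)
  have hN2pos : 0 < N2 := by
    refine lt_of_le_of_ne (hP1.nonneg hterm) fun h0 => ?_
    rw [← h0] at hP1
    have hb0 : ∀ n, b n = 0 := fun n => by
      have h1 := congrFun ((hasSum_zero_iff_of_nonneg hterm).1 hP1) n
      simpa [(symb_pos hc α n).ne'] using h1
    simp only [hb0, zero_mul, mul_zero] at hP2
    have := hP2.unique hasSum_zero
    have : 0 < J / π := div_pos hJ pi_pos
    linarith
  set N := √N2 with hN
  have hNpos : 0 < N := sqrt_pos.2 hN2pos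
  have hNsq : N ^ 2 = N2 := sq_sqrt hN2pos.le
  set a : ℤ → ℝ := fun n => 1 / N * b n with hadef
  have ha : Summable a := hb.mul_left _
  have haS : ∀ x, cosSeries a x = 1 / N * cosSeries b x := cosSeries_mul_left _ _
  have haeven : ∀ n, a (-n) = a n := fun n => by simp only [hadef, hbeven]
  have haanti : AntitoneOn (cosSeries a) (Icc 0 π) := fun x hx y hy hxy => by
    rw [haS, haS]
    exact mul_le_mul_of_nonneg_left (hbanti hx hy hxy) (by positivity)
  have hanonneg : ∀ x, 0 ≤ cosSeries a x := fun x => by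
    rw [haS]
    exact mul_nonneg (by positivity) (hbnonneg x)
  have hae : HasSum (fun n => symb c α n * a n ^ 2) 1 := by
    have h1 := hP1.mul_left (1 / N2)
    rw [one_div_mul_cancel hN2pos.ne'] at h1
    rwa [show (fun n => 1 / N2 * (symb c α n * b n ^ 2)) = fun n => symb c α n * a n ^ 2 from
      funext fun n => by simp only [hadef, ← hNsq]; ring] at h1
  have haAdm : Admissible c α C (cosSeries a) :=
    hC a ha haeven hae.summable hae.tsum_eq.le haanti hanonneg
  have hacont := continuous_cosSeries ha
  obtain ⟨hs, hs1⟩ := hf.summable_energy hc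
  obtain ⟨hle, heq⟩ := eq_of_energy_le (fun n => symb_pos hc α n) hNpos (hNsq ▸ hP1) hs hs1 hP2
  have hga : ∫ x in (0 : ℝ)..π, g x * cosSeries a x = π * N := by
    have : ∫ x in (0 : ℝ)..π, g x * cosSeries b x = π * N ^ 2 := by
      rw [hNsq, hN2]
      have := pi_ne_zero
      field_simp
    simp only [haS, mul_left_comm _ (1 / N), intervalIntegral.integral_const_mul, this]
    field_simp
  have hNle : N ≤ J / π := by
    have h1 := hmax _ haAdm
    have i1 : IntervalIntegrable (fun x => g x * cosSeries a x) volume 0 π :=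
      intervalIntegrable_mul_of_memLp_two pi_pos.le hg (memLp_two_of_continuous hacont)
    have i2 := hf.intervalIntegrable_pow (m := 3) (by norm_num)
    have h2 : ∫ x in (0 : ℝ)..π, (3 * (g x * cosSeries a x) - 2 * f x ^ 3) ≤
        ∫ x in (0 : ℝ)..π, cosSeries a x ^ 3 := by
      refine intervalIntegral.integral_mono_on pi_pos.le ((i1.const_mul 3).sub (i2.const_mul 2))
        ((hacont.pow 3).intervalIntegrable _ _) fun x _ => ?_
      have hv := hanonneg x
      have hu := hf.nonneg x
      simp only [hgdef]
      nlinarith [mul_nonneg (sq_nonneg (cosSeries a x - f x)) hv,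
        mul_nonneg (sq_nonneg (cosSeries a x - f x)) hu]
    rw [intervalIntegral.integral_sub (i1.const_mul 3) (i2.const_mul 2),
      intervalIntegral.integral_const_mul, intervalIntegral.integral_const_mul, hga] at h2
    rw [le_div_iff₀ pi_pos]
    linarith
  have hfa : ∀ n, cosCoeff f n = a n := fun n => by
    simp only [hadef, heq hNle n]
    field_simp
  have hfae : f =ᵐ[volume.restrict (Ioc 0 π)] cosSeries a :=
    ae_eq_of_cosCoeff_eq hf.memLp_two (memLp_two_of_continuous hacont) fun n => by
      rw [hfa, cosCoeff_cosSeries ha haeven]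
  refine ⟨a, N, hNpos, ha, haeven, haanti, hanonneg, fun n => ?_, haAdm, ?_⟩
  · have h1 : g =ᵐ[volume.restrict (Ioc 0 π)] fun x => cosSeries a x ^ 2 := by
      filter_upwards [hfae] with x hx
      simp only [hgdef, hx]
    rw [← cosCoeff_congr_ae h1, ← hLb]
    simp only [hadef]
    field_simp
  · rw [hJdef, intervalIntegral.integral_of_le pi_pos.le, intervalIntegral.integral_of_le pi_pos.le]
    refine integral_congr_ae ?_
    filter_upwards [hfae] with x hx
    rw [hx]

/-- Cosine coefficients of `t + 2 s cos x`. -/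
def twoMode (t s : ℝ) (n : ℤ) : ℝ :=
  (if n = 0 then t else 0) + ((if n = 1 then s else 0) + if n = -1 then s else 0)

theorem hasSum_twoMode_mul (F : ℝ → ℝ) (hF : F 0 = 0) (t s : ℝ) (e : ℤ → ℝ) :
    HasSum (fun n => F (twoMode t s n) * e n) (F t * e 0 + (F s * e 1 + F s * e (-1))) := by
  have h := (hasSum_ite_eq (0 : ℤ) (F t * e 0)).add
    ((hasSum_ite_eq (1 : ℤ) (F s * e 1)).add (hasSum_ite_eq (-1 : ℤ) (F s * e (-1))))
  rwa [show (fun n : ℤ => (if n = 0 then F t * e 0 else 0) + ((if n = 1 then F s * e 1 else 0) +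
    if n = -1 then F s * e (-1) else 0)) = fun n => F (twoMode t s n) * e n from ?_] at h
  ext n
  rcases eq_or_ne n 0 with rfl | h0
  · simp [twoMode]
  rcases eq_or_ne n 1 with rfl | h1
  · simp [twoMode]
  rcases eq_or_ne n (-1) with rfl | h2
  · simp [twoMode]
  · simp [twoMode, h0, h1, h2, hF]

theorem summable_twoMode (t s : ℝ) : Summable (twoMode t s) := by
  simpa using (hasSum_twoMode_mul id rfl t s fun _ => 1).summable

theorem cosSeries_twoMode (t s x : ℝ) : cosSeries (twoMode t s) x = t + 2 * s * cos x := by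
  have := (hasSum_twoMode_mul id rfl t s fun n => cos (n * x)).tsum_eq
  simp only [id] at this
  rw [cosSeries, this]
  simp
  ring

theorem twoMode_neg (t s : ℝ) (n : ℤ) : twoMode t s (-n) = twoMode t s n := by
  simp only [twoMode, neg_eq_iff_eq_neg, neg_neg, neg_zero]
  rw [add_comm (if n = -1 then s else 0)]

theorem hasSum_energy_twoMode (c : ℝ) {α : ℝ} (hα : α ≠ 0) (t s : ℝ) :
    HasSum (fun n => symb c α n * twoMode t s n ^ 2) (c * t ^ 2 + 2 * (c + 1) * s ^ 2) := by
  have := hasSum_twoMode_mul (fun y => y ^ 2) (by norm_num) t s (symb c α)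
  rw [symb_neg, symb_zero c hα, symb_one] at this
  convert this using 1
  · ext n
    ring
  · ring

theorem integral_cube_twoMode (t s : ℝ) :
    ∫ x in (0 : ℝ)..π, (t + 2 * s * cos x) ^ 3 = π * (t ^ 3 + 6 * t * s ^ 2) := by
  have h : ∀ x, (t + 2 * s * cos x) ^ 3 = (t ^ 3 + 12 * t * s ^ 2 * cos x ^ 2) +
      (6 * t ^ 2 * s * cos x + 8 * s ^ 3 * cos x ^ 3) := fun x => by ring
  simp only [h]
  rw [intervalIntegral.integral_add, intervalIntegral.integral_add, intervalIntegral.integral_add,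
    intervalIntegral.integral_const_mul, intervalIntegral.integral_const_mul,
    intervalIntegral.integral_const_mul, integral_cos_sq, integral_cos_pow_three, integral_cos]
  · simp
    ring
  all_goals exact Continuous.intervalIntegrable (by fun_prop) _ _

theorem twoMode_admissible {c α C : ℝ} (hα : α ≠ 0)
    (hC : ∀ b : ℤ → ℝ, Summable b → (∀ n, b (-n) = b n) →
      Summable (fun n => symb c α n * b n ^ 2) → ∑' n, symb c α n * b n ^ 2 ≤ 1 →
      AntitoneOn (cosSeries b) (Icc 0 π) → (∀ x, 0 ≤ cosSeries b x) →
      Admissible c α C (cosSeries b)) {t s : ℝ} (hs : 0 ≤ s) (hts : 2 * s ≤ t)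
    (he : c * t ^ 2 + 2 * (c + 1) * s ^ 2 ≤ 1) : Admissible c α C (cosSeries (twoMode t s)) := by
  have hE := hasSum_energy_twoMode c hα t s
  refine hC _ (summable_twoMode t s) (twoMode_neg t s) hE.summable (hE.tsum_eq.trans_le he) ?_ ?_
  · intro x hx y hy hxy
    rw [cosSeries_twoMode, cosSeries_twoMode]
    have := strictAntiOn_cos.antitoneOn hx hy hxy
    nlinarith
  · intro x
    rw [cosSeries_twoMode]
    nlinarith [neg_one_le_cos x]

/-- The value of the cubic functional on normalised constants is not maximal. -/
theorem exists_competitor {c : ℝ} (hc : 1 < c) : ∃ t s : ℝ, 0 < t ∧ 0 ≤ s ∧ 2 * s ≤ t ∧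
    c * t ^ 2 + 2 * (c + 1) * s ^ 2 ≤ 1 ∧
    ∀ u : ℝ, 0 ≤ u → c * u ^ 2 ≤ 1 → u ^ 3 < t ^ 3 + 6 * t * s ^ 2 := by
  set k : ℝ := (c + 1) / (2 * c) with hk
  have hc0 : 0 < c := by linarith
  have hk0 : 0 < k := by positivity
  have hk1 : k < 1 := by rw [hk, div_lt_one (by positivity)]; linarith
  set e : ℝ := 1 - k with he
  have he0 : 0 < e := by linarith
  have hke : c * (k * e) = (c + 1) * e / 2 := by rw [hk]; field_simp
  obtain ⟨t, ht⟩ : ∃ t, t = 1 / √(c * (1 + k * e)) := ⟨_, rfl⟩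
  have hpos : 0 < c * (1 + k * e) := by positivity
  have ht0 : 0 < t := by rw [ht]; positivity
  have ht2 : t ^ 2 * (c * (1 + k * e)) = 1 := by
    rw [ht, div_pow, sq_sqrt hpos.le]
    field_simp
  have hse : √e ^ 2 = e := sq_sqrt he0.le
  have hse1 : √e ≤ 1 := by
    rw [sqrt_le_one]
    linarith
  refine ⟨t, t * √e / 2, ht0, by positivity, ?_, ?_, fun u hu hcu => ?_⟩
  · nlinarith
  · rw [div_pow, mul_pow, hse]
    have : c * t ^ 2 + 2 * (c + 1) * (t ^ 2 * e / 2 ^ 2) = t ^ 2 * (c + (c + 1) * e / 2) := by ring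
    rw [this, ← hke]
    linarith
  · have h1 : t ^ 3 + 6 * t * (t * √e / 2) ^ 2 = t ^ 3 * (1 + 3 * e / 2) := by
      rw [div_pow, mul_pow, hse]; ring
    rw [h1]
    refine lt_of_pow_lt_pow_left₀ 2 (by positivity) ?_
    have h2 : u ^ 2 ≤ t ^ 2 * (1 + k * e) := by nlinarith
    have h3 : (u ^ 3) ^ 2 ≤ (t ^ 2 * (1 + k * e)) ^ 3 := by
      rw [← pow_mul, mul_comm, pow_mul]
      exact pow_le_pow_left₀ (sq_nonneg u) h2 3
    refine h3.trans_lt ?_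
    have h4 : (1 + k * e) ^ 3 < (1 + 3 * e / 2) ^ 2 := by
      have h5 : (1 + 3 * e / 2) ^ 2 - (1 + k * e) ^ 3 =
          e ^ 2 * (21 / 4 - 3 * k ^ 2 - k ^ 3 * e) := by
        rw [he]; ring
      have h6 : k ^ 2 ≤ 1 := pow_le_one₀ hk0.le hk1.le
      have h7 : k ^ 3 * e ≤ 1 := mul_le_one₀ (pow_le_one₀ hk0.le hk1.le) he0.le (by linarith)
      have h8 : 0 < e ^ 2 * (21 / 4 - 3 * k ^ 2 - k ^ 3 * e) :=
        mul_pos (by positivity) (by linarith)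
      linarith
    have h9 : (t ^ 3 * (1 + 3 * e / 2)) ^ 2 = (t ^ 2) ^ 3 * (1 + 3 * e / 2) ^ 2 := by ring
    rw [mul_pow, h9]
    exact mul_lt_mul_of_pos_left h4 (by positivity)

/-- Existence of a nonconstant nonnegative single-lobe wave. -/
theorem exists_nonconstant_wave {c α : ℝ} (hc : 1 < c) (hα : 5 / 9 < α) (hα₂ : α ≤ 2) :
    ∃ a : ℤ → ℝ, Summable a ∧ (∀ n, a (-n) = a n) ∧ AntitoneOn (cosSeries a) (Icc 0 π) ∧
      (∀ x, 0 ≤ cosSeries a x) ∧ ¬(∃ K, ∀ x, cosSeries a x = K) ∧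
      ∀ n, symb c α n * a n = cosCoeff (fun x => cosSeries a x ^ 2) n := by
  have hc0 : 0 < c := by linarith
  have hα0 : α ≠ 0 := by linarith
  obtain ⟨C, hC⟩ := exists_admissible_constant hc0 hα
  obtain ⟨t, s, ht, hs, hts, he, hu⟩ := exists_competitor hc
  have hw := twoMode_admissible hα0 hC hs hts he
  obtain ⟨f, hf, hmax⟩ := Admissible.exists_maximizer ⟨_, hw⟩
  have hwJ := hmax _ hw
  simp only [cosSeries_twoMode, integral_cube_twoMode] at hwJ
  have hJ : 0 < ∫ x in (0 : ℝ)..π, f x ^ 3 := lt_of_lt_of_le (by positivity) hwJ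
  obtain ⟨a, N, hN, ha, heven, hanti, h0, heq, hadm, haJ⟩ :=
    exists_wave_of_maximizer hc0 hα hα₂ hC hf hmax hJ
  have hS : ∀ x, cosSeries (fun n => 1 / N * a n) x = 1 / N * cosSeries a x :=
    cosSeries_mul_left _ _
  have hNi : 0 < 1 / N := by positivity
  refine ⟨fun n => 1 / N * a n, ha.mul_left _, fun n => by simp only [heven], ?_, fun x => ?_, ?_,
    fun n => ?_⟩
  · intro x hx y hy hxy
    rw [hS, hS]
    exact mul_le_mul_of_nonneg_left (hanti hx hy hxy) hNi.le
  · rw [hS]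
    exact mul_nonneg hNi.le (h0 x)
  · rintro ⟨K, hK⟩
    have hconst : ∀ x, cosSeries a x = N * K := fun x => by
      rw [← hK x, hS]
      field_simp
    have hE := hadm.energy {0}
    rw [Finset.sum_singleton, symb_zero c hα0, cosCoeff] at hE
    simp only [hconst, Int.cast_zero, zero_mul, cos_zero, mul_one,
      intervalIntegral.integral_const, sub_zero, smul_eq_mul] at hE
    rw [show 1 / π * (π * (N * K)) = N * K by field_simp] at hE
    have hK0 : 0 ≤ N * K := hconst 0 ▸ h0 0
    have hlt := hu _ hK0 hE
    rw [← haJ] at hwJ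
    simp only [hconst, intervalIntegral.integral_const, sub_zero, smul_eq_mul] at hwJ
    exact hlt.not_ge (le_of_mul_le_mul_left hwJ pi_pos)
  · have h1 : cosCoeff (fun x => cosSeries (fun n => 1 / N * a n) x ^ 2) n =
        (1 / N) ^ 2 * cosCoeff (fun x => cosSeries a x ^ 2) n := by
      simp only [cosCoeff, hS, mul_pow, mul_assoc, intervalIntegral.integral_const_mul]
      ring
    rw [h1, ← heq]
    field_simp

theorem memLp_two_indicator (p q : ℝ) :
    MemLp ((Ioc p q).indicator fun _ => (1 : ℝ)) 2 (volume.restrict (Ioc 0 π)) :=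
  (memLp_const 1).indicator measurableSet_Ioc

theorem cosCoeff_indicator {p q : ℝ} (hp : 0 ≤ p) (hpq : p ≤ q) (hq : q ≤ π) (n : ℤ) :
    cosCoeff ((Ioc p q).indicator fun _ => 1) n = 1 / π * ∫ t in p..q, cos (n * t) := by
  have h1 : ∀ t, (Ioc p q).indicator (fun _ => (1 : ℝ)) t * cos (n * t) =
      (Ioc p q).indicator (fun t => cos (n * t)) t := fun t => by
    by_cases ht : t ∈ Ioc p q <;> simp [ht]
  simp only [cosCoeff, h1]
  rw [intervalIntegral.integral_of_le pi_pos.le, intervalIntegral.integral_of_le hpq,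
    setIntegral_indicator measurableSet_Ioc,
    inter_eq_self_of_subset_right (Ioc_subset_Ioc hp hq)]

/-- The resolvent kernel averaged over a window of half-width `h`. -/
noncomputable def avgKernel (c α h : ℝ) : ℝ → ℝ :=
  cosSeries fun n : ℤ => 1 / symb c α n * sinc (n * h)

theorem cosCoeff_indicator_zero {h : ℝ} (hh : h ∈ Ioc 0 π) (n : ℤ) :
    cosCoeff ((Ioc 0 h).indicator fun _ => 1) n = h / π * sinc (n * h) := by
  rw [cosCoeff_indicator le_rfl hh.1.le hh.2]
  rcases eq_or_ne n 0 with rfl | hn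
  · simp; ring
  · have hn' : (n : ℝ) ≠ 0 := by exact_mod_cast hn
    rw [intervalIntegral.integral_comp_mul_left cos hn', integral_cos,
      sinc_of_ne_zero (mul_ne_zero hn' hh.1.ne')]
    have := hh.1.ne'
    simp only [mul_zero, sin_zero, sub_zero, smul_eq_mul]
    field_simp

theorem summable_avgKernel {c α : ℝ} (hc : 0 < c) (hα : 1 / 2 < α) {h : ℝ} (hh : h ∈ Ioc 0 π) :
    Summable fun n : ℤ => 1 / symb c α n * sinc (n * h) := by
  have := summable_resolvent hc hα (memLp_two_indicator 0 h)
  simp only [cosCoeff_indicator_zero hh] at this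
  have h0 : h / π ≠ 0 := div_ne_zero hh.1.ne' pi_ne_zero
  rw [← summable_mul_left_iff h0]
  exact this.congr fun n => by ring

theorem resolvent_indicator_zero (c α : ℝ) {h : ℝ} (hh : h ∈ Ioc 0 π) (x : ℝ) :
    resolvent c α ((Ioc 0 h).indicator fun _ => 1) x = h / π * avgKernel c α h x := by
  rw [resolvent, avgKernel, ← cosSeries_mul_left]
  congr 1
  ext n
  rw [cosCoeff_indicator_zero hh]
  ring

theorem avgKernel_nonneg {c α : ℝ} (hc : 0 < c) (hα : 1 / 2 < α) (hα₂ : α ≤ 2) {h : ℝ}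
    (hh : h ∈ Ioc 0 π) (x : ℝ) : 0 ≤ avgKernel c α h x := by
  have := resolvent_nonneg hc hα hα₂ (memLp_two_indicator 0 h)
    (indicator_nonneg fun _ _ => zero_le_one) x
  rw [resolvent_indicator_zero c α hh] at this
  exact nonneg_of_mul_nonneg_right this (div_pos hh.1 pi_pos)

theorem continuous_avgKernel {c α : ℝ} (hc : 0 < c) (hα : 1 / 2 < α) {h : ℝ}
    (hh : h ∈ Ioc 0 π) : Continuous (avgKernel c α h) :=
  continuous_cosSeries (summable_avgKernel hc hα hh)

theorem avgKernel_antitoneOn {c α : ℝ} (hc : 0 < c) (hα : 1 / 2 < α) (hα₂ : α ≤ 2) {h : ℝ}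
    (hh : h ∈ Ioc 0 π) : AntitoneOn (avgKernel c α h) (Icc 0 π) := by
  have := resolvent_antitoneOn hc hα hα₂ (memLp_two_indicator 0 h) fun x hx y hy hxy => by
    by_cases hy' : y ∈ Ioc 0 h
    · rw [indicator_of_mem hy', indicator_of_mem (show x ∈ Ioc 0 h from ⟨hx.1, hxy.trans hy'.2⟩)]
    · rw [indicator_of_notMem hy']
      exact indicator_nonneg (fun _ _ => zero_le_one) _
  intro x hx y hy hxy
  have := this hx hy hxy
  rw [resolvent_indicator_zero c α hh, resolvent_indicator_zero c α hh] at this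
  exact le_of_mul_le_mul_left this (div_pos hh.1 pi_pos)

theorem avgKernel_zero_pos {c α : ℝ} (hc : 0 < c) (hα : 1 / 2 < α) (hα₂ : α ≤ 2) {h : ℝ}
    (hh : h ∈ Ioc 0 π) : 0 < avgKernel c α h 0 := by
  have hmean := cosCoeff_cosSeries (summable_avgKernel hc hα hh)
    (fun n => by rw [symb_neg, Int.cast_neg, neg_mul, sinc_neg]) 0
  rw [symb_zero c (by linarith), Int.cast_zero, zero_mul, sinc_zero, mul_one] at hmean
  by_contra! hneg
  have hle : ∫ t in (0 : ℝ)..π, avgKernel c α h t * cos ((0 : ℤ) * t) ≤ 0 := by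
    rw [intervalIntegral.integral_of_le pi_pos.le]
    refine setIntegral_nonpos measurableSet_Ioc fun t ht => ?_
    rw [Int.cast_zero, zero_mul, cos_zero, mul_one]
    replace ht := Ioc_subset_Icc_self ht
    exact (avgKernel_antitoneOn hc hα hα₂ hh (left_mem_Icc.2 pi_pos.le) ht ht.1).trans hneg
  have hcpos : 0 < 1 / c := by positivity
  rw [← hmean, cosCoeff] at hcpos
  exact hcpos.not_ge (mul_nonpos_of_nonneg_of_nonpos (by positivity) hle)

theorem avgKernel_self (c α : ℝ) {h : ℝ} :
    avgKernel c α h h = avgKernel c α (2 * h) 0 := by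
  simp only [avgKernel, cosSeries]
  refine tsum_congr fun n => ?_
  rw [mul_assoc, mul_zero, cos_zero, mul_one]
  congr 1
  rcases eq_or_ne ((n : ℝ) * h) 0 with h0 | h0
  · rw [mul_left_comm, h0]; simp
  · rw [mul_left_comm, sinc_of_ne_zero h0, sinc_of_ne_zero (by positivity), sin_two_mul]
    field_simp

/-- The resolvent of the indicator of an interior window. -/
theorem resolvent_indicator {c α : ℝ} (hc : 0 < c) (hα : 1 / 2 < α) {h p : ℝ} (hh : 0 < h)
    (hp : h ≤ p) (hq : p + h ≤ π) (x : ℝ) :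
    resolvent c α ((Ioc (p - h) (p + h)).indicator fun _ => 1) x =
      h / π * (avgKernel c α h (x - p) + avgKernel c α h (x + p)) := by
  have hs := summable_avgKernel hc hα (h := h) ⟨hh, by linarith⟩
  rw [resolvent, avgKernel, cosSeries, cosSeries, cosSeries,
    ← (summable_mul_cos hs _).tsum_add (summable_mul_cos hs _), ← tsum_mul_left]
  refine tsum_congr fun n => ?_
  rw [cosCoeff_indicator (by linarith) (by linarith) hq, two_mul_sinc, mul_sub, mul_add, mul_add, cos_sub,
    cos_add]
  ring

theorem resolvent_sub_smul {c α : ℝ} (hc : 0 < c) (hα : 1 / 2 < α) {f g : ℝ → ℝ}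
    (hf : MemLp f 2 (volume.restrict (Ioc 0 π))) (hg : MemLp g 2 (volume.restrict (Ioc 0 π)))
    (e x : ℝ) :
    resolvent c α (f - e • g) x = resolvent c α f x - e * resolvent c α g x := by
  rw [resolvent, resolvent, resolvent, ← cosSeries_mul_left, cosSeries, cosSeries, cosSeries,
    ← (summable_mul_cos (summable_resolvent hc hα hf) x).tsum_sub
    (summable_mul_cos ((summable_resolvent hc hα hg).mul_left e) x)]
  refine tsum_congr fun n => ?_
  have : cosCoeff (e • g) n = e * cosCoeff g n := by
    simp only [cosCoeff, Pi.smul_apply, smul_eq_mul, mul_assoc,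
      intervalIntegral.integral_const_mul]
    ring
  rw [cosCoeff_sub (intervalIntegrable_of_memLp_two pi_pos.le hf)
    (intervalIntegrable_of_memLp_two pi_pos.le (hg.const_smul e)), this]
  ring

/-- A nonnegative nonconstant single-lobe solution has no zeros. -/
theorem cosSeries_pos_of_eq {c α : ℝ} (hc : 0 < c) (hα : 1 / 2 < α) (hα₂ : α ≤ 2) {a : ℤ → ℝ}
    (ha : Summable a) (hanti : AntitoneOn (cosSeries a) (Icc 0 π)) (h0 : ∀ x, 0 ≤ cosSeries a x)
    (hne : ¬∃ K, ∀ x, cosSeries a x = K)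
    (heq : ∀ n, symb c α n * a n = cosCoeff (fun x => cosSeries a x ^ 2) n) (x : ℝ) :
    0 < cosSeries a x := by
  have hcont := continuous_cosSeries ha
  suffices hpos : ∀ x ∈ Icc 0 π, 0 < cosSeries a x by
    rw [← evenPer_cosSeries, evenPer]
    exact hpos _ ⟨arccos_nonneg _, arccos_le_pi _⟩
  by_contra! hzero
  have hres : resolvent c α (fun x => cosSeries a x ^ 2) = cosSeries a := by
    rw [resolvent]
    congr 1
    ext n
    rw [← heq, one_div, inv_mul_cancel_left₀ (symb_pos hc α n).ne']
  have hZc : IsCompact (Icc 0 π ∩ {x | cosSeries a x ≤ 0}) :=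
    isCompact_Icc.inter_right (isClosed_le hcont continuous_const)
  obtain ⟨r, ⟨hr, hr0⟩, hleast⟩ := hZc.exists_isLeast hzero
  have hr0' : cosSeries a r = 0 := le_antisymm hr0 (h0 r)
  have hrpos : 0 < r := by
    refine lt_of_le_of_ne hr.1 fun h => hne ⟨0, fun x => ?_⟩
    rw [← evenPer_cosSeries, evenPer]
    refine le_antisymm ?_ (h0 _)
    rw [← hr0', ← h]
    exact hanti (left_mem_Icc.2 pi_pos.le) ⟨arccos_nonneg _, arccos_le_pi _⟩ (arccos_nonneg _)
  have hbelow : ∀ x ∈ Ico 0 r, 0 < cosSeries a x := fun x hx => by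
    by_contra! h
    exact hx.2.not_ge (hleast ⟨⟨hx.1, hx.2.le.trans hr.2⟩, h⟩)
  obtain ⟨h, hh⟩ : ∃ h, h = r / 4 := ⟨_, rfl⟩
  have hhpos : 0 < h := by linarith
  have hmem : h ∈ Ioc 0 π := ⟨hhpos, by linarith [hr.2]⟩
  have hvan : ∀ p ∈ Ico h (r - h), avgKernel c α h (r - p) = 0 := fun p hp => by
    have hp1 := hp.1
    have hp2 := hp.2
    set e := cosSeries a (p + h) ^ 2 with he
    have hepos : 0 < e := pow_pos (hbelow _ ⟨by linarith, by linarith⟩) 2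
    set w : ℝ → ℝ := (Ioc (p - h) (p + h)).indicator fun _ => 1 with hw
    have hsq : MemLp (fun x => cosSeries a x ^ 2) 2 (volume.restrict (Ioc 0 π)) :=
      memLp_two_of_continuous (hcont.pow 2)
    have hwm : MemLp w 2 (volume.restrict (Ioc 0 π)) := memLp_two_indicator _ _
    have hge : ∀ x, 0 ≤ ((fun x => cosSeries a x ^ 2) - e • w) x := fun x => by
      simp only [Pi.sub_apply, Pi.smul_apply, smul_eq_mul, sub_nonneg]
      by_cases hx : x ∈ Ioc (p - h) (p + h)
      · rw [hw, indicator_of_mem hx, mul_one, he]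
        refine pow_le_pow_left₀ (h0 _) (hanti ⟨?_, ?_⟩ ⟨?_, ?_⟩ hx.2) 2 <;>
          linarith [hx.1, hx.2, hr.2]
      · rw [hw, indicator_of_notMem hx, mul_zero]
        exact sq_nonneg _
    have h1 := resolvent_nonneg hc hα hα₂ (hsq.sub (hwm.const_smul e)) hge r
    rw [resolvent_sub_smul hc hα hsq hwm, hres, hr0', hw, resolvent_indicator hc hα hhpos hp1 (by linarith [hr.2])] at h1
    have h3 := avgKernel_nonneg hc hα hα₂ hmem (r - p)
    have h4 := avgKernel_nonneg hc hα hα₂ hmem (r + p)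
    have h5 : 0 < e * (h / π) := mul_pos hepos (div_pos hhpos pi_pos)
    rw [← mul_assoc] at h1
    have h6 : avgKernel c α h (r - p) + avgKernel c α h (r + p) ≤ 0 := by
      by_contra! h7
      linarith [mul_pos h5 h7]
    linarith
  have hlim : avgKernel c α h (r - (r - h)) = 0 := by
    have hcl : r - h ∈ closure (Ico h (r - h)) := by
      rw [closure_Ico (by linarith)]
      exact ⟨by linarith, le_rfl⟩
    have hclosed : IsClosed {p | avgKernel c α h (r - p) = 0} :=
      isClosed_eq ((continuous_avgKernel hc hα hmem).comp (by fun_prop)) continuous_const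
    exact hclosed.closure_subset_iff.2 hvan hcl
  rw [sub_sub_cancel, avgKernel_self] at hlim
  exact (avgKernel_zero_pos hc hα hα₂ (h := 2 * h) ⟨by linarith, by linarith [hr.2]⟩).ne' hlim

theorem fourierCoeff2pi_eq_cosCoeff {f : ℝ → ℝ} (hf : Continuous f) (he : evenPer f = f) (n : ℤ) :
    fourierCoeff2pi f n = (cosCoeff f n : ℂ) := by
  have hneg : ∀ x, f (-x) = f x := fun x => by rw [← he, evenPer_neg]
  have h1 := fullCos_evenPer (hf.intervalIntegrable 0 π) (-π) n
  rw [he, fullCos, show -π + 2 * π = π by ring] at h1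
  rw [fourierCoeff2pi, integral_mul_exp (hf.intervalIntegrable _ _),
    integral_odd (F := fun x => f x * sin (n * x))
      (fun x => by rw [hneg, mul_neg, sin_neg, mul_neg]), ← h1]
  push_cast
  ring

theorem five_ninths_lt {α : ℝ} (h : Real.log 3 / Real.log 2 - 1 < α) : 5 / 9 < α := by
  have h2 : 0 < Real.log 2 := Real.log_pos (by norm_num)
  have h3 : 14 * Real.log 2 < 9 * Real.log 3 := by
    have := Real.log_lt_log (by norm_num) (show (2 : ℝ) ^ 14 < 3 ^ 9 by norm_num)
    rw [Real.log_pow, Real.log_pow] at this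
    exact_mod_cast this
  have h4 : 14 / 9 < Real.log 3 / Real.log 2 := by
    rw [lt_div_iff₀ h2]
    linarith
  linarith

end SingleLobe

theorem stmt0 (c α : ℝ) (hc : 1 < c)
    (hα₀ : Real.log 3 / Real.log 2 - 1 < α) (hα₂ : α ≤ 2) :
    ∃ ψ : ℝ → ℝ, Continuous ψ ∧ Function.Periodic ψ (2 * Real.pi) ∧
      (∀ x, ψ (-x) = ψ x) ∧
      ¬ (∃ C : ℝ, ∀ x, ψ x = C) ∧
      AntitoneOn ψ (Set.Icc 0 Real.pi) ∧
      (∀ x, 0 < ψ x) ∧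
      (∀ n : ℤ, ((c + |(n : ℝ)| ^ α : ℝ) : ℂ) * fourierCoeff2pi ψ n
        = fourierCoeff2pi (fun x => (ψ x) ^ 2) n) := by
  have hα := SingleLobe.five_ninths_lt hα₀
  obtain ⟨a, ha, heven, hanti, h0, hne, heq⟩ :=
    SingleLobe.exists_nonconstant_wave hc hα hα₂
  have hcont := SingleLobe.continuous_cosSeries ha
  have he := SingleLobe.evenPer_cosSeries a
  have he2 : SingleLobe.evenPer (fun x => SingleLobe.cosSeries a x ^ 2) =
      fun x => SingleLobe.cosSeries a x ^ 2 := by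
    funext x
    exact congrArg (· ^ 2) (congrFun he x)
  refine ⟨SingleLobe.cosSeries a, hcont, ?_, fun x => ?_, hne, hanti, fun x => ?_, fun n => ?_⟩
  · rw [← he]
    exact SingleLobe.evenPer_periodic _
  · rw [← he, SingleLobe.evenPer_neg]
  · exact SingleLobe.cosSeries_pos_of_eq (by linarith) (by linarith) hα₂ ha hanti h0 hne heq x
  · rw [SingleLobe.fourierCoeff2pi_eq_cosCoeff hcont he,
      SingleLobe.fourierCoeff2pi_eq_cosCoeff (f := fun x => SingleLobe.cosSeries a x ^ 2) (hcont.pow 2) he2, ← heq,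
      SingleLobe.cosCoeff_cosSeries ha heven, SingleLobe.symb]
    push_cast
    rfl
end

section
/- For every c > 1 and every α with log 3/log 2 − 1 < α ≤ 2, there exists a continuous 2π-periodic function φ : ℝ → ℝ that is even, nonconstant, nonincreasing on [0, π], satisfies φ(x) > −c for every x ∈ ℝ, and solves the stationary equation (c + D_α)φ + φ² = 0, i.e. for every n ∈ ℤ one has (c − |n|^α)·φ̂(n) + (φ²)̂(n) = 0. -/
open MeasureTheory

namespace PeriodicWave

open Real Set Filter Topology

/-! ### Normalised Lebesgue measure on a period -/

/-- Normalised Lebesgue measure on `(-π, π]`. -/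
noncomputable def circ : Measure ℝ :=
  ENNReal.ofReal (2 * π)⁻¹ • volume.restrict (Ioc (-π) π)

instance : IsProbabilityMeasure circ := by
  refine ⟨?_⟩
  have h : π - -π = 2 * π := by ring
  rw [circ, Measure.smul_apply, Measure.restrict_apply MeasurableSet.univ, univ_inter,
    Real.volume_Ioc, smul_eq_mul, h, ← ENNReal.ofReal_mul (by positivity),
    inv_mul_cancel₀ (by positivity), ENNReal.ofReal_one]

lemma integral_circ (f : ℝ → ℝ) : ∫ x, f x ∂circ = (2 * π)⁻¹ * ∫ x in (-π)..π, f x := by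
  rw [circ, integral_smul_measure, ENNReal.toReal_ofReal (by positivity), smul_eq_mul,
    intervalIntegral.integral_of_le (by linarith [pi_pos])]

lemma integral_circ_add {f : ℝ → ℝ} (hf : Function.Periodic f (2 * π)) (a : ℝ) :
    ∫ x, f (x + a) ∂circ = ∫ x, f x ∂circ := by
  rw [integral_circ, integral_circ, intervalIntegral.integral_comp_add_right]
  have := hf.intervalIntegral_add_eq (-π + a) (-π)
  rw [show -π + a + 2 * π = π + a by ring, show -π + 2 * π = π by ring] at this
  rw [this]

lemma integral_circ_neg (f : ℝ → ℝ) : ∫ x, f (-x) ∂circ = ∫ x, f x ∂circ := by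
  rw [integral_circ, integral_circ, intervalIntegral.integral_comp_neg, neg_neg]

lemma integral_circ_sub {f : ℝ → ℝ} (hf : Function.Periodic f (2 * π)) (a : ℝ) :
    ∫ x, f (a - x) ∂circ = ∫ x, f x ∂circ := by
  rw [← integral_circ_add hf a, ← integral_circ_neg (fun x => f (x + a))]
  simp only [neg_add_eq_sub]

lemma integrable_circ {f : ℝ → ℝ} (hf : Measurable f) {C : ℝ} (hC : ∀ x, |f x| ≤ C) :
    Integrable f circ :=
  Integrable.of_bound hf.aestronglyMeasurable C (ae_of_all _ hC)

lemma integrable_circ_of_continuous {f : ℝ → ℝ} (hf : Continuous f) : Integrable f circ := by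
  refine Integrable.smul_measure ?_ ENNReal.ofReal_ne_top
  exact (hf.integrableOn_Icc (a := -π) (b := π)).mono_set Ioc_subset_Icc_self

/-! ### Functions that are monotone in `cos x` -/

/-- Functions which are nondecreasing functions of `cos x`, that is, even `2π`-periodic functions
which are nonincreasing on `[0, π]`. -/
def CosMono (f : ℝ → ℝ) : Prop := ∀ ⦃x y⦄, cos x ≤ cos y → f x ≤ f y

namespace CosMono

variable {f g : ℝ → ℝ}

lemma congr (hf : CosMono f) {x y : ℝ} (h : cos x = cos y) : f x = f y :=
  le_antisymm (hf h.le) (hf h.ge)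

lemma periodic (hf : CosMono f) : Function.Periodic f (2 * π) := fun x =>
  hf.congr (cos_add_two_pi x)

lemma even (hf : CosMono f) (x : ℝ) : f (-x) = f x := hf.congr (cos_neg x)

lemma antitoneOn (hf : CosMono f) : AntitoneOn f (Icc 0 π) := fun _ hx _ hy hxy =>
  hf (cos_le_cos_of_nonneg_of_le_pi hx.1 hy.2 hxy)

lemma cos_arccos_min (t : ℝ) : cos (arccos t) = max (-1) (min t 1) := by
  rcases le_total t (-1) with h | h
  · rw [arccos_of_le_neg_one h, cos_pi]; simp [h]
  · rcases le_total t 1 with h' | h'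
    · rw [cos_arccos h h']; simp [h, h']
    · rw [arccos_of_one_le h', cos_zero]; simp [h']

lemma monotone_arccos (hf : CosMono f) : Monotone (fun t => f (arccos t)) := fun s t hst => by
  refine hf ?_
  rw [cos_arccos_min, cos_arccos_min]
  gcongr

lemma arccos_cos (hf : CosMono f) (x : ℝ) : f (arccos (cos x)) = f x :=
  hf.congr (Real.cos_arccos (neg_one_le_cos x) (cos_le_one x))

lemma measurable (hf : CosMono f) : Measurable f := by
  have : f = (fun t => f (arccos t)) ∘ cos := funext fun x => (hf.arccos_cos x).symm
  rw [this]
  exact hf.monotone_arccos.measurable.comp measurable_cos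

lemma add (hf : CosMono f) (hg : CosMono g) : CosMono (fun x => f x + g x) :=
  fun _ _ h => add_le_add (hf h) (hg h)

lemma const (a : ℝ) : CosMono (fun _ => a) := fun _ _ _ => le_rfl

lemma const_mul (hf : CosMono f) {a : ℝ} (ha : 0 ≤ a) : CosMono (fun x => a * f x) :=
  fun _ _ h => mul_le_mul_of_nonneg_left (hf h) ha

lemma sq (hf : CosMono f) (h0 : ∀ x, 0 ≤ f x) : CosMono (fun x => f x ^ 2) :=
  fun x _ h => pow_le_pow_left₀ (h0 x) (hf h) 2

end CosMono

/-- `f` is monotone in `cos x` and takes values in `[0, M]`. -/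
structure Cone (M : ℝ) (f : ℝ → ℝ) : Prop where
  mono : CosMono f
  nonneg : ∀ x, 0 ≤ f x
  le : ∀ x, f x ≤ M

namespace Cone

variable {M : ℝ} {f : ℝ → ℝ}

lemma abs_le (hf : Cone M f) (x : ℝ) : |f x| ≤ M := by
  rw [abs_of_nonneg (hf.nonneg x)]; exact hf.le x

lemma bound_nonneg (hf : Cone M f) : 0 ≤ M := (hf.nonneg 0).trans (hf.le 0)

lemma integrable (hf : Cone M f) : Integrable f circ :=
  integrable_circ hf.mono.measurable hf.abs_le

lemma sq (hf : Cone M f) : Cone (M ^ 2) (fun x => f x ^ 2) :=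
  ⟨hf.mono.sq hf.nonneg, fun _ => sq_nonneg _,
    fun x => pow_le_pow_left₀ (hf.nonneg x) (hf.le x) 2⟩

end Cone

/-! ### Cosine coefficients -/

/-- The real Fourier coefficients of an even function. -/
noncomputable def cosCoeff (f : ℝ → ℝ) (n : ℤ) : ℝ := ∫ x, f x * cos (n * x) ∂circ

lemma cos_int_periodic (n : ℤ) : Function.Periodic (fun x => cos (n * x)) (2 * π) := fun x => by
  simp only [mul_add]
  exact cos_add_int_mul_two_pi _ n

lemma integrable_mul_cos {f : ℝ → ℝ} (hf : Integrable f circ) (n : ℤ) :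
    Integrable (fun x => f x * cos (n * x)) circ := by
  refine hf.mul_bdd (c := 1) (by fun_prop) (ae_of_all _ fun x => ?_)
  exact abs_cos_le_one _

lemma cosCoeff_zero (f : ℝ → ℝ) : cosCoeff f 0 = ∫ x, f x ∂circ := by simp [cosCoeff]

lemma cosCoeff_neg (f : ℝ → ℝ) (n : ℤ) : cosCoeff f (-n) = cosCoeff f n := by simp [cosCoeff]

lemma cosCoeff_add {f g : ℝ → ℝ} (hf : Integrable f circ) (hg : Integrable g circ) (n : ℤ) :
    cosCoeff (fun x => f x + g x) n = cosCoeff f n + cosCoeff g n := by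
  simp only [cosCoeff, add_mul]
  exact integral_add (integrable_mul_cos hf n) (integrable_mul_cos hg n)

lemma cosCoeff_sub {f g : ℝ → ℝ} (hf : Integrable f circ) (hg : Integrable g circ) (n : ℤ) :
    cosCoeff (fun x => f x - g x) n = cosCoeff f n - cosCoeff g n := by
  simp only [cosCoeff, sub_mul]
  exact integral_sub (integrable_mul_cos hf n) (integrable_mul_cos hg n)

lemma cosCoeff_const_mul (a : ℝ) (f : ℝ → ℝ) (n : ℤ) :
    cosCoeff (fun x => a * f x) n = a * cosCoeff f n := by
  simp only [cosCoeff, mul_assoc]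
  exact integral_const_mul _ _

lemma integral_sin_mul {f : ℝ → ℝ} (hf : ∀ x, f (-x) = f x) (b : ℝ) :
    ∫ x, f x * sin (b * x) ∂circ = 0 := by
  have := integral_circ_neg (fun x => f x * sin (b * x))
  simp only [hf, mul_neg, sin_neg, integral_neg] at this
  linarith

lemma cosCoeff_one (n : ℤ) : cosCoeff (fun _ => 1) n = if n = 0 then 1 else 0 := by
  split_ifs with h
  · subst h; simp [cosCoeff]
  · have hn : (n : ℝ) ≠ 0 := by exact_mod_cast h
    simp only [cosCoeff, one_mul, integral_circ]
    rw [intervalIntegral.integral_comp_mul_left _ hn, integral_cos]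
    simp [sin_int_mul_pi]

lemma cosCoeff_const (a : ℝ) (n : ℤ) : cosCoeff (fun _ => a) n = if n = 0 then a else 0 := by
  have := cosCoeff_const_mul a (fun _ => 1) n
  rw [cosCoeff_one] at this
  simpa using this

lemma cosCoeff_cos (m n : ℤ) :
    cosCoeff (fun x => cos (m * x)) n = (if n = m then 1 / 2 else 0) + if n = -m then 1 / 2 else 0 := by
  have h1 := cosCoeff_one (n - m)
  have h2 := cosCoeff_one (n + m)
  simp only [sub_eq_zero, add_eq_zero_iff_eq_neg] at h1 h2
  have : cosCoeff (fun x => cos (m * x)) n =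
      1 / 2 * cosCoeff (fun _ => 1) (n - m) + 1 / 2 * cosCoeff (fun _ => 1) (n + m) := by
    simp only [cosCoeff]
    rw [← integral_const_mul, ← integral_const_mul, ← integral_add]
    · congr 1; ext x
      push_cast
      rw [sub_mul, add_mul, cos_sub, cos_add]; ring
    all_goals exact integrable_circ_of_continuous (by fun_prop)
  rw [this, h1, h2]
  split_ifs <;> simp

lemma fourierCoeff2pi_eq_cosCoeff {f : ℝ → ℝ} (hf : Integrable f circ) (he : ∀ x, f (-x) = f x)
    (n : ℤ) : fourierCoeff2pi f n = cosCoeff f n := by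
  have hexp : ∀ x : ℝ, (f x : ℂ) * Complex.exp (-(Complex.I * (n : ℂ) * (x : ℂ))) =
      ((f x * cos (n * x) : ℝ) : ℂ) - ((f x * sin (n * x) : ℝ) : ℂ) * Complex.I := fun x => by
    have : -(Complex.I * (n : ℂ) * (x : ℂ)) = ((-(n * x) : ℝ) : ℂ) * Complex.I := by
      push_cast; ring
    rw [this, Complex.exp_mul_I, ← Complex.ofReal_cos, ← Complex.ofReal_sin, cos_neg, sin_neg]
    push_cast; ring
  have hint : ∀ g : ℝ → ℝ, Integrable g circ → IntervalIntegrable g volume (-π) π := fun g hg => by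
    rw [intervalIntegrable_iff_integrableOn_Ioc_of_le (by linarith [pi_pos])]
    refine (integrable_smul_measure ?_ ENNReal.ofReal_ne_top).1 hg
    simp [pi_pos]
  have hsin : Integrable (fun x => f x * sin (n * x)) circ :=
    hf.mul_bdd (c := 1) (by fun_prop) (ae_of_all _ fun x => abs_sin_le_one _)
  have h0 := integral_sin_mul he n
  rw [integral_circ] at h0
  have h0' : ∫ x in (-π)..π, f x * sin (n * x) = 0 := by
    rcases mul_eq_zero.1 h0 with h | h
    · exact absurd h (by positivity)
    · exact h
  simp only [fourierCoeff2pi, hexp]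
  have hc := (hint _ (integrable_mul_cos hf n))
  have hs := hint _ hsin
  have hc' : IntervalIntegrable (fun x => ((f x * cos (n * x) : ℝ) : ℂ)) volume (-π) π :=
    ⟨hc.1.ofReal, hc.2.ofReal⟩
  have hs' : IntervalIntegrable (fun x => ((f x * sin (n * x) : ℝ) : ℂ)) volume (-π) π :=
    ⟨hs.1.ofReal, hs.2.ofReal⟩
  rw [intervalIntegral.integral_sub hc' (hs'.mul_const _), intervalIntegral.integral_mul_const,
    intervalIntegral.integral_ofReal, intervalIntegral.integral_ofReal, h0', cosCoeff,
    integral_circ]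
  push_cast
  ring

/-- Parseval's identity for bounded even functions. -/
lemma hasSum_sq_cosCoeff {f : ℝ → ℝ} (hf : Measurable f) {C : ℝ} (hC : ∀ x, |f x| ≤ C)
    (he : ∀ x, f (-x) = f x) :
    HasSum (fun n => cosCoeff f n ^ 2) (∫ x, f x ^ 2 ∂circ) := by
  have hpi : -π < π := by linarith [pi_pos]
  have hL2 : MemLp (fun x => (f x : ℂ)) 2 (volume.restrict (Ioc (-π) π)) := by
    refine MemLp.of_bound (by fun_prop) C (ae_of_all _ fun x => ?_)
    simpa using hC x
  have h := hasSum_sq_fourierCoeffOn hpi hL2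
  have hcoeff : ∀ n, fourierCoeffOn hpi (fun x => (f x : ℂ)) n = cosCoeff f n := fun n => by
    rw [← fourierCoeff2pi_eq_cosCoeff (integrable_circ hf hC) he, fourierCoeffOn_eq_integral,
      fourierCoeff2pi, Complex.real_smul]
    congr 1
    · push_cast; ring
    · refine intervalIntegral.integral_congr fun x _ => ?_
      simp only [smul_eq_mul]
      rw [mul_comm, fourier_coe_apply]
      congr 2
      have : (π : ℂ) ≠ 0 := by exact_mod_cast pi_ne_zero
      push_cast
      field_simp
      ring
  simp only [hcoeff, Complex.norm_real, norm_eq_abs, sq_abs] at h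
  rw [integral_circ]
  convert h using 1
  rw [smul_eq_mul]; congr 2; ring

/-- The polarised form of Parseval's identity. -/
lemma hasSum_cosCoeff_mul {f g : ℝ → ℝ} (hf : Measurable f) (hg : Measurable g) {A B : ℝ}
    (hA : ∀ x, |f x| ≤ A) (hB : ∀ x, |g x| ≤ B)
    (hfe : ∀ x, f (-x) = f x) (hge : ∀ x, g (-x) = g x) :
    HasSum (fun n => cosCoeff f n * cosCoeff g n) (∫ x, f x * g x ∂circ) := by
  have hfi := integrable_circ hf hA
  have hgi := integrable_circ hg hB
  have hab : ∀ x, |f x + g x| ≤ A + B := fun x => (abs_add_le _ _).trans (add_le_add (hA x) (hB x))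
  have hab' : ∀ x, |f x - g x| ≤ A + B := fun x => (abs_sub _ _).trans (add_le_add (hA x) (hB x))
  have h1 := hasSum_sq_cosCoeff (hf.add hg) hab (fun x => by simp [hfe, hge])
  have h2 := hasSum_sq_cosCoeff (hf.sub hg) hab' (fun x => by simp [hfe, hge])
  have hsum : (fun n => cosCoeff f n * cosCoeff g n) =
      fun n => 1 / 4 * (cosCoeff (f + g) n ^ 2 - cosCoeff (f - g) n ^ 2) := by
    ext n
    rw [show f + g = fun x => f x + g x from rfl, show f - g = fun x => f x - g x from rfl,
      cosCoeff_add hfi hgi, cosCoeff_sub hfi hgi]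
    ring
  have hint : ∫ x, f x * g x ∂circ =
      1 / 4 * (∫ x, (f + g) x ^ 2 ∂circ - ∫ x, (f - g) x ^ 2 ∂circ) := by
    rw [← integral_sub, ← integral_const_mul]
    · congr 1; ext x; simp only [Pi.add_apply, Pi.sub_apply]; ring
    · refine integrable_circ (C := (A + B) ^ 2) (by fun_prop) fun x => ?_
      rw [abs_pow]; exact pow_le_pow_left₀ (abs_nonneg _) (hab x) 2
    · refine integrable_circ (C := (A + B) ^ 2) (by fun_prop) fun x => ?_
      rw [abs_pow]; exact pow_le_pow_left₀ (abs_nonneg _) (hab' x) 2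
  rw [hsum, hint]
  exact (h1.sub h2).mul_left (1 / 4)

/-- Bounded even functions with the same coefficients agree almost everywhere. -/
lemma ae_eq_of_cosCoeff_eq {f g : ℝ → ℝ} (hf : Measurable f) (hg : Measurable g) {A B : ℝ}
    (hA : ∀ x, |f x| ≤ A) (hB : ∀ x, |g x| ≤ B)
    (hfe : ∀ x, f (-x) = f x) (hge : ∀ x, g (-x) = g x)
    (h : ∀ n, cosCoeff f n = cosCoeff g n) : f =ᵐ[circ] g := by
  have hab : ∀ x, |f x - g x| ≤ A + B := fun x => (abs_sub _ _).trans (add_le_add (hA x) (hB x))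
  have hs := hasSum_sq_cosCoeff (hf.sub hg) hab (fun x => by simp [hfe, hge])
  have h0 : ∀ n, cosCoeff (f - g) n ^ 2 = 0 := fun n => by
    have := cosCoeff_sub (integrable_circ hf hA) (integrable_circ hg hB) n
    rw [show f - g = fun x => f x - g x from rfl, this, h]; simp
  simp only [h0] at hs
  have hz := hs.unique hasSum_zero
  have hi : Integrable (fun x => (f - g) x ^ 2) circ := by
    refine integrable_circ (C := (A + B) ^ 2) (by fun_prop) fun x => ?_
    rw [abs_pow]; exact pow_le_pow_left₀ (abs_nonneg _) (hab x) 2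
  have := (integral_eq_zero_iff_of_nonneg (fun x => sq_nonneg _) hi).1 hz
  filter_upwards [this] with x hx
  have : (f x - g x) ^ 2 = 0 := hx
  exact sub_eq_zero.1 (pow_eq_zero_iff two_ne_zero |>.1 this)

/-! ### Helly's selection principle -/

lemma exists_subseq_tendsto_of_countable {D : Set ℝ} (hD : D.Countable) {M : ℝ} {F : ℕ → ℝ → ℝ}
    (hF : ∀ k x, F k x ∈ Icc 0 M) :
    ∃ σ : ℕ → ℕ, StrictMono σ ∧ ∀ x ∈ D, ∃ l, Tendsto (fun k => F (σ k) x) atTop (𝓝 l) := by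
  have : Countable D := hD.to_subtype
  have hc : IsCompact (Set.pi univ fun _ : D => Icc (0 : ℝ) M) :=
    isCompact_univ_pi fun _ => isCompact_Icc
  obtain ⟨l, -, σ, hσ, hl⟩ := hc.tendsto_subseq (x := fun k (d : D) => F k d)
    fun k d _ => hF k d
  exact ⟨σ, hσ, fun x hx => ⟨l ⟨x, hx⟩, tendsto_pi_nhds.1 hl ⟨x, hx⟩⟩⟩

/-- A uniformly bounded sequence of monotone functions has an everywhere convergent subsequence. -/
lemma exists_subseq_tendsto_of_monotone {M : ℝ} {F : ℕ → ℝ → ℝ} (hmono : ∀ k, Monotone (F k))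
    (hF : ∀ k x, F k x ∈ Icc 0 M) :
    ∃ σ : ℕ → ℕ, StrictMono σ ∧ ∀ x, ∃ l, Tendsto (fun k => F (σ k) x) atTop (𝓝 l) := by
  obtain ⟨σ, hσ, hl⟩ := exists_subseq_tendsto_of_countable (countable_range ((↑) : ℚ → ℝ)) hF
  have hbdd : ∀ x, IsBoundedUnder (· ≤ ·) atTop fun k => F (σ k) x := fun x =>
    isBoundedUnder_of ⟨M, fun k => (hF _ x).2⟩
  have hcobdd : ∀ x, IsCoboundedUnder (· ≤ ·) atTop fun k => F (σ k) x := fun x =>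
    (isBoundedUnder_of ⟨0, fun k => (hF _ x).1⟩ : IsBoundedUnder (· ≥ ·) atTop
      fun k => F (σ k) x).isCoboundedUnder_le
  let G : ℝ → ℝ := fun x => limsup (fun k => F (σ k) x) atTop
  have hGmono : Monotone G := fun x y hxy =>
    limsup_le_limsup (Eventually.of_forall fun k => hmono _ hxy) (hcobdd x) (hbdd y)
  have hGq : ∀ q : ℚ, Tendsto (fun k => F (σ k) q) atTop (𝓝 (G q)) := fun q => by
    obtain ⟨l, hl⟩ := hl q ⟨q, rfl⟩
    have hq : G q = l := hl.limsup_eq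
    rwa [hq]
  have hcont : ∀ x, ContinuousAt G x → Tendsto (fun k => F (σ k) x) atTop (𝓝 (G x)) := by
    intro x hx
    refine tendsto_order.2 ⟨fun a ha => ?_, fun a ha => ?_⟩
    · obtain ⟨b, hb, hb'⟩ := exists_Ioc_subset_of_mem_nhds (hx.eventually (lt_mem_nhds ha))
        (exists_lt x)
      obtain ⟨q, hq, hqx⟩ := exists_rat_btwn hb
      filter_upwards [(hGq q).eventually (lt_mem_nhds (hb' ⟨hq, hqx.le⟩))] with k hk
      exact hk.trans_le (hmono _ hqx.le)
    · obtain ⟨b, hb, hb'⟩ := exists_Ico_subset_of_mem_nhds (hx.eventually (gt_mem_nhds ha))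
        (exists_gt x)
      obtain ⟨q, hxq, hq⟩ := exists_rat_btwn hb
      filter_upwards [(hGq q).eventually (gt_mem_nhds (hb' ⟨hxq.le, hq⟩))] with k hk
      exact (hmono _ hxq.le).trans_lt hk
  obtain ⟨τ, hτ, hl'⟩ := exists_subseq_tendsto_of_countable hGmono.countable_not_continuousAt
    (F := fun k => F (σ k)) fun k x => hF _ x
  refine ⟨σ ∘ τ, hσ.comp hτ, fun x => ?_⟩
  by_cases hx : ContinuousAt G x
  · exact ⟨G x, (hcont x hx).comp hτ.tendsto_atTop⟩
  · exact hl' x hx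

lemma exists_subseq_tendsto_of_cone {M : ℝ} {f : ℕ → ℝ → ℝ} (hf : ∀ k, Cone M (f k)) :
    ∃ σ : ℕ → ℕ, StrictMono σ ∧
      ∃ g, Cone M g ∧ ∀ x, Tendsto (fun k => f (σ k) x) atTop (𝓝 (g x)) := by
  obtain ⟨σ, hσ, hl⟩ := exists_subseq_tendsto_of_monotone
    (F := fun k t => f k (arccos t)) (fun k => (hf k).mono.monotone_arccos)
    (fun k x => ⟨(hf k).nonneg _, (hf k).le _⟩)
  choose l hl using fun x => hl (cos x)
  simp only [(hf _).mono.arccos_cos] at hl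
  refine ⟨σ, hσ, l, ⟨fun x y hxy => ?_, fun x => ?_, fun x => ?_⟩, hl⟩
  · exact le_of_tendsto_of_tendsto' (hl x) (hl y) fun k => (hf _).mono hxy
  · exact ge_of_tendsto' (hl x) fun k => (hf _).nonneg x
  · exact le_of_tendsto' (hl x) fun k => (hf _).le x

lemma tendsto_cosCoeff {M : ℝ} {f : ℕ → ℝ → ℝ} {g : ℝ → ℝ} (hf : ∀ k, Cone M (f k))
    (hg : ∀ x, Tendsto (fun k => f k x) atTop (𝓝 (g x))) (n : ℤ) :
    Tendsto (fun k => cosCoeff (f k) n) atTop (𝓝 (cosCoeff g n)) := by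
  refine tendsto_integral_of_dominated_convergence (fun _ => M)
    (fun k => (integrable_mul_cos (hf k).integrable n).aestronglyMeasurable)
    (integrable_const _) (fun k => ae_of_all _ fun x => ?_) (ae_of_all _ fun x => ?_)
  · rw [norm_mul, norm_eq_abs, norm_eq_abs]
    calc |f k x| * |cos (n * x)| ≤ M * 1 :=
          mul_le_mul ((hf k).abs_le x) (abs_cos_le_one _) (abs_nonneg _) (hf k).bound_nonneg
      _ = M := mul_one M
  · exact (hg x).mul_const _

/-! ### Fourier multipliers preserving the cone -/

lemma CosMono.convolution_integrand_nonneg {k u : ℝ → ℝ} (hk : CosMono k) (hu : CosMono u)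
    {x y : ℝ} (hxy : cos x ≤ cos y) (t : ℝ) :
    0 ≤ (u t - u (x + y - t)) * (k (y - t) - k (x - t)) := by
  have key : (cos t - cos (x + y - t)) * (cos (y - t) - cos (x - t)) =
      2 * (cos y - cos x) * sin ((x + y) / 2 - t) ^ 2 := by
    rw [cos_sub_cos t, cos_sub_cos (y - t), cos_sub_cos y x,
      show (t + (x + y - t)) / 2 = (x + y) / 2 by ring,
      show (t - (x + y - t)) / 2 = -((x + y) / 2 - t) by ring,
      show (y - t + (x - t)) / 2 = (x + y) / 2 - t by ring,
      show (y - t - (x - t)) / 2 = (y - x) / 2 by ring,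
      show (y + x) / 2 = (x + y) / 2 by ring, sin_neg]
    ring
  have h0 : 0 ≤ (cos t - cos (x + y - t)) * (cos (y - t) - cos (x - t)) := by
    rw [key]
    exact mul_nonneg (mul_nonneg zero_le_two (sub_nonneg.2 hxy)) (sq_nonneg _)
  rcases mul_nonneg_iff.1 h0 with ⟨h1, h2⟩ | ⟨h1, h2⟩
  · exact mul_nonneg (sub_nonneg.2 (hu (sub_nonneg.1 h1))) (sub_nonneg.2 (hk (sub_nonneg.1 h2)))
  · exact mul_nonneg_of_nonpos_of_nonpos (sub_nonpos.2 (hu (sub_nonpos.1 h1)))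
      (sub_nonpos.2 (hk (sub_nonpos.1 h2)))

section Convolution

variable {B M : ℝ} {k u : ℝ → ℝ}

/-- Convolution on the circle. -/
noncomputable def conv (k u : ℝ → ℝ) (x : ℝ) : ℝ := ∫ t, k (x - t) * u t ∂circ

lemma abs_mul_le_of_cone (hk : Cone B k) (hu : Cone M u) (x y : ℝ) : |k x * u y| ≤ B * M := by
  rw [abs_mul]
  exact mul_le_mul (hk.abs_le x) (hu.abs_le y) (abs_nonneg _) hk.bound_nonneg

lemma integrable_conv (hk : Cone B k) (hu : Cone M u) (x : ℝ) :
    Integrable (fun t => k (x - t) * u t) circ := by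
  have := hk.mono.measurable
  have := hu.mono.measurable
  exact integrable_circ (by fun_prop) fun t => abs_mul_le_of_cone hk hu _ _

lemma CosMono.conv (hk : Cone B k) (hu : Cone M u) : CosMono (conv k u) := by
  intro x y hxy
  have hper : Function.Periodic (fun t => (k (y - t) - k (x - t)) * u t) (2 * π) := fun t => by
    simp only [← sub_sub, hu.mono.periodic t, hk.mono.periodic.sub_eq]
  have hint : Integrable (fun t => (k (y - t) - k (x - t)) * u t) circ := by
    simp only [sub_mul]
    exact (integrable_conv hk hu y).sub (integrable_conv hk hu x)
  have hm := hk.mono.measurable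
  have hm' := hu.mono.measurable
  have hint' : Integrable
      (fun t => (k (y - (x + y - t)) - k (x - (x + y - t))) * u (x + y - t)) circ := by
    refine integrable_circ (C := B * M + B * M) (by fun_prop) fun t => ?_
    rw [sub_mul]
    exact (abs_sub _ _).trans (add_le_add (abs_mul_le_of_cone hk hu _ _)
      (abs_mul_le_of_cone hk hu _ _))
  have h1 : PeriodicWave.conv k u y - PeriodicWave.conv k u x =
      ∫ t, (k (y - t) - k (x - t)) * u t ∂circ := by
    rw [PeriodicWave.conv, PeriodicWave.conv,
      ← integral_sub (integrable_conv hk hu y) (integrable_conv hk hu x)]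
    simp only [sub_mul]
  have h2 := integral_circ_sub hper (x + y)
  have h3 : 0 ≤ ∫ t, ((k (y - t) - k (x - t)) * u t +
      (k (y - (x + y - t)) - k (x - (x + y - t))) * u (x + y - t)) ∂circ := by
    refine integral_nonneg fun t => ?_
    have := hk.mono.convolution_integrand_nonneg hu.mono hxy t
    have e1 : k (y - (x + y - t)) = k (x - t) := by
      rw [show y - (x + y - t) = -(x - t) by ring, hk.mono.even]
    have e2 : k (x - (x + y - t)) = k (y - t) := by
      rw [show x - (x + y - t) = -(y - t) by ring, hk.mono.even]
    simp only [Pi.zero_apply, e1, e2]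
    linarith
  rw [integral_add hint hint', h2, ← h1] at h3
  linarith

lemma Cone.conv (hk : Cone B k) (hu : Cone M u) : Cone (cosCoeff k 0 * M) (conv k u) := by
  refine ⟨CosMono.conv hk hu, fun x => integral_nonneg fun t => mul_nonneg (hk.nonneg _)
    (hu.nonneg _), fun x => ?_⟩
  have hm := hk.mono.measurable
  have hi : Integrable (fun t => k (x - t)) circ :=
    integrable_circ (by fun_prop) fun t => hk.abs_le _
  calc PeriodicWave.conv k u x ≤ ∫ t, k (x - t) * M ∂circ :=
        integral_mono (integrable_conv hk hu x) (hi.mul_const _) fun t =>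
          mul_le_mul_of_nonneg_left (hu.le t) (hk.nonneg _)
    _ = cosCoeff k 0 * M := by
        rw [integral_mul_const, cosCoeff_zero, integral_circ_sub hk.mono.periodic]

lemma cosCoeff_conv (hk : Cone B k) (hu : Cone M u) (n : ℤ) :
    cosCoeff (conv k u) n = cosCoeff k n * cosCoeff u n := by
  have hm := hk.mono.measurable
  have hm' := hu.mono.measurable
  have hint : Integrable (Function.uncurry fun x t => k (x - t) * u t * cos (n * x))
      (circ.prod circ) := by
    refine Integrable.of_bound (C := B * M) ?_ (ae_of_all _ fun p => ?_)
    · exact Measurable.aestronglyMeasurable (by unfold Function.uncurry; fun_prop)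
    · simp only [Function.uncurry]
      rw [norm_mul, norm_eq_abs, norm_eq_abs]
      calc _ ≤ B * M * 1 := mul_le_mul (abs_mul_le_of_cone hk hu _ _) (abs_cos_le_one _)
              (abs_nonneg _) (mul_nonneg hk.bound_nonneg hu.bound_nonneg)
        _ = B * M := mul_one _
  have hinner : ∀ t, ∫ x, k (x - t) * cos (n * x) ∂circ = cosCoeff k n * cos (n * t) := fun t => by
    have hper : Function.Periodic (fun x => k (x - t) * cos (n * x)) (2 * π) := fun x => by
      have h1 := cos_int_periodic n x
      have h2 := hk.mono.periodic (x - t)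
      simp only at h1 ⊢
      rw [h1, ← h2]; congr 2; ring
    rw [← integral_circ_add hper t]
    have h0 := integral_sin_mul hk.mono.even n
    have hki := hk.integrable
    have hs : Integrable (fun x => k x * sin (n * x)) circ :=
      hki.mul_bdd (c := 1) (by fun_prop) (ae_of_all _ fun x => abs_sin_le_one _)
    calc ∫ x, k (x + t - t) * cos (n * (x + t)) ∂circ
        = ∫ x, (k x * cos (n * x) * cos (n * t) - k x * sin (n * x) * sin (n * t)) ∂circ := by
          congr 1; ext x; rw [add_sub_cancel_right, mul_add, cos_add]; ring
      _ = cosCoeff k n * cos (n * t) := by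
          rw [integral_sub ((integrable_mul_cos hki n).mul_const _) (hs.mul_const _),
            integral_mul_const, integral_mul_const, h0, zero_mul, sub_zero, cosCoeff]
  calc cosCoeff (conv k u) n = ∫ x, ∫ t, k (x - t) * u t * cos (n * x) ∂circ ∂circ := by
        simp only [cosCoeff, conv, integral_mul_const]
    _ = ∫ t, ∫ x, k (x - t) * u t * cos (n * x) ∂circ ∂circ := integral_integral_swap hint
    _ = ∫ t, cosCoeff k n * (u t * cos (n * t)) ∂circ := by
        congr 1; ext t
        rw [show cosCoeff k n * (u t * cos (n * t)) = u t * (cosCoeff k n * cos (n * t)) by ring,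
          ← hinner, ← integral_const_mul]
        congr 1; ext x; ring
    _ = cosCoeff k n * cosCoeff u n := by rw [integral_const_mul]; rfl

end Convolution

/-- Multipliers `m` acting on the cone as the convolution with a nonnegative kernel that is
monotone in `cos x`. -/
def ConePreserving (m : ℤ → ℝ) : Prop :=
  ∀ ⦃M : ℝ⦄ ⦃u : ℝ → ℝ⦄, Cone M u →
    ∃ v, Cone (m 0 * M) v ∧ ∀ n, cosCoeff v n = m n * cosCoeff u n

namespace ConePreserving

variable {m m' : ℤ → ℝ}

lemma of_kernel {B : ℝ} {k : ℝ → ℝ} (hk : Cone B k) : ConePreserving (cosCoeff k) :=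
  fun _ u hu => ⟨conv k u, hk.conv hu, cosCoeff_conv hk hu⟩

lemma one : ConePreserving 1 := fun M u hu => ⟨u, by simpa using hu, by simp⟩

lemma zero : ConePreserving 0 := fun M u hu =>
  ⟨fun _ => 0, ⟨CosMono.const 0, fun _ => le_rfl, fun _ => by simp⟩, fun n => by simp [cosCoeff]⟩

lemma add (h : ConePreserving m) (h' : ConePreserving m') : ConePreserving (m + m') := by
  intro M u hu
  obtain ⟨v, hv, hv'⟩ := h hu
  obtain ⟨w, hw, hw'⟩ := h' hu
  refine ⟨fun x => v x + w x, ⟨hv.mono.add hw.mono, fun x => add_nonneg (hv.nonneg x) (hw.nonneg x),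
    fun x => ?_⟩, fun n => ?_⟩
  · rw [Pi.add_apply, add_mul]; exact add_le_add (hv.le x) (hw.le x)
  · rw [cosCoeff_add hv.integrable hw.integrable, hv', hw', Pi.add_apply, add_mul]

lemma const_smul (h : ConePreserving m) {a : ℝ} (ha : 0 ≤ a) : ConePreserving (a • m) := by
  intro M u hu
  obtain ⟨v, hv, hv'⟩ := h hu
  refine ⟨fun x => a * v x, ⟨hv.mono.const_mul ha, fun x => mul_nonneg ha (hv.nonneg x),
    fun x => ?_⟩, fun n => ?_⟩
  · rw [Pi.smul_apply, smul_eq_mul, mul_assoc]; exact mul_le_mul_of_nonneg_left (hv.le x) ha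
  · rw [cosCoeff_const_mul, hv', Pi.smul_apply, smul_eq_mul, mul_assoc]

lemma mul (h : ConePreserving m) (h' : ConePreserving m') : ConePreserving (m * m') := by
  intro M u hu
  obtain ⟨v, hv, hv'⟩ := h' hu
  obtain ⟨w, hw, hw'⟩ := h hv
  refine ⟨w, ?_, fun n => ?_⟩
  · rwa [Pi.mul_apply, mul_assoc]
  · rw [hw', hv', Pi.mul_apply, mul_assoc]

lemma pow (h : ConePreserving m) (i : ℕ) : ConePreserving (m ^ i) := by
  induction i with
  | zero => simpa using one
  | succ i ih => rw [pow_succ]; exact ih.mul h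

lemma sum {ι : Type*} (s : Finset ι) {f : ι → ℤ → ℝ} (h : ∀ i ∈ s, ConePreserving (f i)) :
    ConePreserving (∑ i ∈ s, f i) := by
  classical
  induction s using Finset.induction_on with
  | empty => simpa using zero
  | insert i s hi ih =>
    rw [Finset.sum_insert hi]
    exact (h i (Finset.mem_insert_self i s)).add
      (ih fun j hj => h j (Finset.mem_insert_of_mem hj))

lemma of_tendsto {f : ℕ → ℤ → ℝ} (h : ∀ k, ConePreserving (f k))
    (hm : ∀ n, Tendsto (fun k => f k n) atTop (𝓝 (m n))) : ConePreserving m := by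
  intro M u hu
  choose v hv hv' using fun k => h k hu
  obtain ⟨B, hB⟩ := ((hm 0).mul_const M).bddAbove_range
  have hvB : ∀ k, Cone B (v k) := fun k =>
    ⟨(hv k).mono, (hv k).nonneg, fun x => ((hv k).le x).trans (hB ⟨k, rfl⟩)⟩
  obtain ⟨σ, hσ, g, hg, hl⟩ := exists_subseq_tendsto_of_cone hvB
  refine ⟨g, ⟨hg.mono, hg.nonneg, fun x => ?_⟩, fun n => ?_⟩
  · exact le_of_tendsto_of_tendsto' (hl x) (((hm 0).mul_const M).comp hσ.tendsto_atTop)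
      fun k => (hv _).le x
  · have h1 := tendsto_cosCoeff (fun k => hvB (σ k)) hl n
    simp only [hv'] at h1
    exact tendsto_nhds_unique h1 (((hm n).comp hσ.tendsto_atTop).mul_const _)

lemma inv_sub (h : ConePreserving m) {A : ℝ} (hA : ∀ n, |m n| < A) :
    ConePreserving (fun n => (A - m n)⁻¹) := by
  have hA0 : 0 < A := (abs_nonneg _).trans_lt (hA 0)
  refine of_tendsto (f := fun N => ∑ i ∈ Finset.range N, (A⁻¹ * A⁻¹ ^ i) • m ^ i)
    (fun N => sum _ fun i _ => (h.pow i).const_smul (by positivity)) fun n => ?_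
  have hr : |A⁻¹ * m n| < 1 := by
    rw [abs_mul, abs_of_pos (inv_pos.2 hA0), inv_mul_lt_iff₀ hA0, mul_one]
    exact hA n
  have hs := ((hasSum_geometric_of_abs_lt_one hr).mul_left A⁻¹).tendsto_sum_nat
  have e : A⁻¹ * (1 - A⁻¹ * m n)⁻¹ = (A - m n)⁻¹ := by
    rw [← mul_inv, mul_sub, mul_one, mul_inv_cancel_left₀ hA0.ne']
  rw [e] at hs
  refine hs.congr fun N => ?_
  simp only [Finset.sum_apply, Pi.smul_apply, Pi.pow_apply, smul_eq_mul]
  exact Finset.sum_congr rfl fun i _ => by rw [mul_pow]; ring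

end ConePreserving

/-! ### The kernel of `(s - d²/dx²)⁻¹` -/

/-- The periodic Green function of `s - d²/dx²`. -/
noncomputable def resolventKernel (s x : ℝ) : ℝ :=
  π / (√s * sinh (π * √s)) * cosh (√s * (π - arccos (cos x)))

lemma sqrt_mul_sinh_pos {s : ℝ} (hs : 0 < s) : 0 < √s * sinh (π * √s) :=
  mul_pos (sqrt_pos.2 hs) (sinh_pos_iff.2 (mul_pos pi_pos (sqrt_pos.2 hs)))

lemma resolventKernel_lower {s : ℝ} (hs : 0 < s) (x : ℝ) :
    π / (√s * sinh (π * √s)) ≤ resolventKernel s x :=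
  le_mul_of_one_le_right (div_pos pi_pos (sqrt_mul_sinh_pos hs)).le (one_le_cosh _)

lemma resolventKernel_pos {s : ℝ} (hs : 0 < s) (x : ℝ) : 0 < resolventKernel s x :=
  (div_pos pi_pos (sqrt_mul_sinh_pos hs)).trans_le (resolventKernel_lower hs x)

lemma cosMono_resolventKernel {s : ℝ} (hs : 0 < s) : CosMono (resolventKernel s) := by
  intro x y hxy
  refine mul_le_mul_of_nonneg_left ?_ (div_pos pi_pos (sqrt_mul_sinh_pos hs)).le
  rw [cosh_le_cosh, abs_of_nonneg (mul_nonneg (sqrt_nonneg _) (sub_nonneg.2 (arccos_le_pi _))),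
    abs_of_nonneg (mul_nonneg (sqrt_nonneg _) (sub_nonneg.2 (arccos_le_pi _)))]
  exact mul_le_mul_of_nonneg_left (sub_le_sub_left (antitone_arccos hxy) _) (sqrt_nonneg _)

lemma cone_resolventKernel {s : ℝ} (hs : 0 < s) :
    Cone (resolventKernel s 0) (resolventKernel s) :=
  ⟨cosMono_resolventKernel hs, fun x => (resolventKernel_pos hs x).le,
    fun x => cosMono_resolventKernel hs (by rw [cos_zero]; exact cos_le_one x)⟩

lemma measurable_resolventKernel : Measurable fun p : ℝ × ℝ => resolventKernel p.1 p.2 := by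
  have := measurable_arccos
  unfold resolventKernel
  fun_prop

lemma continuousOn_resolventKernel (x : ℝ) : ContinuousOn (fun s => resolventKernel s x) (Ioi 0) := by
  unfold resolventKernel
  refine ContinuousOn.mul (ContinuousOn.div (by fun_prop) (by fun_prop) fun s hs => ?_)
    (by fun_prop)
  exact (sqrt_mul_sinh_pos hs).ne'

lemma integral_cosh_mul_cos {a : ℝ} (ha : 0 < a) (b : ℝ) (hb : sin (b * π) = 0) :
    ∫ x in (0)..π, cosh (a * (π - x)) * cos (b * x) = a * sinh (π * a) / (a ^ 2 + b ^ 2) := by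
  have hab : a ^ 2 + b ^ 2 ≠ 0 := by positivity
  have hderiv : ∀ x : ℝ, HasDerivAt
      (fun x => (-(a * sinh (a * (π - x)) * cos (b * x)) +
        b * cosh (a * (π - x)) * sin (b * x)) / (a ^ 2 + b ^ 2))
      (cosh (a * (π - x)) * cos (b * x)) x := fun x => by
    have h1 : HasDerivAt (fun x : ℝ => a * (π - x)) (a * -1) x :=
      ((hasDerivAt_id x).const_sub π).const_mul a
    have h2 : HasDerivAt (fun x : ℝ => b * x) (b * 1) x := (hasDerivAt_id x).const_mul b
    have h := ((((h1.sinh.const_mul a).mul h2.cos).neg).add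
      ((h1.cosh.const_mul b).mul h2.sin)).div_const (a ^ 2 + b ^ 2)
    refine h.congr_deriv ?_
    rw [div_eq_iff hab]
    ring
  rw [intervalIntegral.integral_eq_sub_of_hasDerivAt (fun x _ => hderiv x)
    (Continuous.intervalIntegrable (by fun_prop) _ _), hb]
  simp only [sub_self, mul_zero, sinh_zero, zero_mul, sub_zero, cos_zero, sin_zero, mul_one]
  rw [mul_comm a π]
  ring

lemma cosCoeff_resolventKernel {s : ℝ} (hs : 0 < s) (n : ℤ) :
    cosCoeff (resolventKernel s) n = (s + (n : ℝ) ^ 2)⁻¹ := by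
  have hev : ∫ x in (-π)..π, resolventKernel s x * cos (n * x) =
      2 * ∫ x in (0)..π, resolventKernel s x * cos (n * x) := by
    have hc : Continuous fun x => resolventKernel s x * cos (n * x) := by
      have := continuous_arccos
      unfold resolventKernel
      fun_prop
    rw [← intervalIntegral.integral_add_adjacent_intervals (b := 0)
      (hc.intervalIntegrable _ _) (hc.intervalIntegrable _ _)]
    have := intervalIntegral.integral_comp_neg (a := 0) (b := π)
      (fun x => resolventKernel s x * cos (n * x))
    simp only [(cosMono_resolventKernel hs).even, mul_neg, cos_neg, neg_zero] at this
    rw [← this]; ring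
  have hcongr : ∫ x in (0)..π, resolventKernel s x * cos (n * x) =
      ∫ x in (0)..π, π / (√s * sinh (π * √s)) * (cosh (√s * (π - x)) * cos (n * x)) := by
    refine intervalIntegral.integral_congr fun x hx => ?_
    rw [uIcc_of_le pi_pos.le] at hx
    simp only [resolventKernel]
    rw [Real.arccos_cos hx.1 hx.2]; ring
  have h0 := sqrt_mul_sinh_pos hs
  have h1 := sqrt_pos.2 hs
  have h2 : 0 < sinh (π * √s) := sinh_pos_iff.2 (mul_pos pi_pos h1)
  rw [cosCoeff, integral_circ, hev, hcongr, intervalIntegral.integral_const_mul,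
    integral_cosh_mul_cos h1 _ (sin_int_mul_pi n), sq_sqrt hs.le]
  have h3 : s + (n : ℝ) ^ 2 ≠ 0 := by positivity
  field_simp

/-! ### Superpositions of resolvent kernels -/

section Mixture

variable {δ R β : ℝ}

/-- The kernel `∫ s ^ β (s - d²/dx²)⁻¹ ds`, integrated over `[δ, R]`. -/
noncomputable def mixedKernel (δ R β x : ℝ) : ℝ :=
  ∫ s in δ..R, s ^ β * resolventKernel s x

lemma continuousOn_rpow_mul_resolventKernel (β x : ℝ) :
    ContinuousOn (fun s => s ^ β * resolventKernel s x) (Ioi 0) :=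
  (continuousOn_id.rpow_const fun _ hs => Or.inl (ne_of_gt hs)).mul (continuousOn_resolventKernel x)

lemma intervalIntegrable_of_continuousOn_Ioi {f : ℝ → ℝ} (hf : ContinuousOn f (Ioi 0)) {a b : ℝ}
    (ha : 0 < a) (hb : 0 < b) : IntervalIntegrable f volume a b :=
  (hf.mono fun _ hs => (lt_min ha hb).trans_le hs.1).intervalIntegrable

lemma cosMono_mixedKernel (hδ : 0 < δ) (hR : δ ≤ R) : CosMono (mixedKernel δ R β) := by
  intro x y hxy
  have h := fun x => intervalIntegrable_of_continuousOn_Ioi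
    (continuousOn_rpow_mul_resolventKernel β x) hδ (hδ.trans_le hR)
  refine intervalIntegral.integral_mono_on hR (h x) (h y) fun s hs => ?_
  have hs0 : 0 < s := hδ.trans_le hs.1
  exact mul_le_mul_of_nonneg_left (cosMono_resolventKernel hs0 hxy) (rpow_nonneg hs0.le _)

lemma exists_mixedKernel_lower (β : ℝ) : ∃ κ > 0, ∀ δ R : ℝ, 0 < δ → δ ≤ 1 → 2 ≤ R →
    ∀ x, κ ≤ mixedKernel δ R β x := by
  refine ⟨mixedKernel 1 2 β π, ?_, fun δ R hδ hδ1 hR x => ?_⟩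
  · refine intervalIntegral.intervalIntegral_pos_of_pos_on
      (intervalIntegrable_of_continuousOn_Ioi (continuousOn_rpow_mul_resolventKernel β π)
        one_pos two_pos) (fun s hs => ?_) one_lt_two
    have hs0 : 0 < s := one_pos.trans hs.1
    exact mul_pos (rpow_pos_of_pos hs0 _) (resolventKernel_pos hs0 _)
  · calc mixedKernel 1 2 β π ≤ mixedKernel 1 2 β x :=
          cosMono_mixedKernel one_pos one_le_two (by rw [cos_pi]; exact neg_one_le_cos x)
      _ ≤ mixedKernel δ R β x := by
          refine intervalIntegral.integral_mono_interval hδ1 one_le_two hR ?_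
            (intervalIntegrable_of_continuousOn_Ioi (continuousOn_rpow_mul_resolventKernel β x)
              hδ (by linarith))
          refine (ae_restrict_iff' measurableSet_Ioc).2 (ae_of_all _ fun s hs => ?_)
          have hs0 : 0 < s := hδ.trans hs.1
          exact mul_nonneg (rpow_nonneg hs0.le _) (resolventKernel_pos hs0 _).le

lemma cosCoeff_mixedKernel (hδ : 0 < δ) (hR : δ ≤ R) (n : ℤ) :
    cosCoeff (mixedKernel δ R β) n = ∫ s in δ..R, s ^ β * (s + (n : ℝ) ^ 2)⁻¹ := by
  obtain ⟨C, hC⟩ := isCompact_Icc.exists_bound_of_continuousOn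
    ((continuousOn_rpow_mul_resolventKernel β 0).mono
      fun s (hs : s ∈ Icc δ R) => hδ.trans_le hs.1)
  have hint : Integrable (Function.uncurry fun x s => s ^ β * resolventKernel s x * cos (n * x))
      (circ.prod (volume.restrict (Ioc δ R))) := by
    refine Integrable.of_bound (C := C) ?_ ?_
    · refine Measurable.aestronglyMeasurable ?_
      have h := measurable_resolventKernel.comp measurable_swap
      exact ((by fun_prop : Measurable fun p : ℝ × ℝ => p.2 ^ β).mul h).mul (by fun_prop)
    · have := Measure.quasiMeasurePreserving_snd (μ := circ) (ν := volume.restrict (Ioc δ R))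
      filter_upwards [this.ae (ae_restrict_mem measurableSet_Ioc)] with p hp
      have hs0 : 0 < p.2 := hδ.trans hp.1
      have h1 := hC p.2 (Ioc_subset_Icc_self hp)
      have h2 := (cone_resolventKernel hs0).le p.1
      have h3 := (resolventKernel_pos hs0 p.1).le
      have h4 : 0 ≤ p.2 ^ β := rpow_nonneg hs0.le _
      simp only [Function.uncurry]
      rw [norm_mul, norm_of_nonneg (mul_nonneg h4 h3)]
      calc _ ≤ p.2 ^ β * resolventKernel p.2 p.1 * 1 :=
            mul_le_mul_of_nonneg_left (abs_cos_le_one _) (mul_nonneg h4 h3)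
        _ ≤ p.2 ^ β * resolventKernel p.2 0 := by
            rw [mul_one]; exact mul_le_mul_of_nonneg_left h2 h4
        _ ≤ C := (le_abs_self _).trans h1
  calc cosCoeff (mixedKernel δ R β) n
      = ∫ x, (∫ s in Ioc δ R, s ^ β * resolventKernel s x * cos (n * x)) ∂circ := by
        simp only [cosCoeff, mixedKernel, integral_mul_const, intervalIntegral.integral_of_le hR]
    _ = ∫ s in Ioc δ R, (∫ x, s ^ β * resolventKernel s x * cos (n * x) ∂circ) :=
        integral_integral_swap hint
    _ = ∫ s in δ..R, s ^ β * (s + (n : ℝ) ^ 2)⁻¹ := by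
        rw [intervalIntegral.integral_of_le hR]
        refine setIntegral_congr_fun measurableSet_Ioc fun s hs => ?_
        simp only [mul_assoc]
        rw [integral_const_mul, ← cosCoeff_resolventKernel (hδ.trans hs.1)]
        rfl

end Mixture

/-! ### The multiplier `(c + |n| ^ α)⁻¹` -/

lemma Cone.abs_cosCoeff_le {M : ℝ} {f : ℝ → ℝ} (hf : Cone M f) (n : ℤ) :
    |cosCoeff f n| ≤ cosCoeff f 0 := by
  rw [cosCoeff_zero]
  refine (abs_integral_le_integral_abs).trans
    (integral_mono (integrable_mul_cos hf.integrable n).abs hf.integrable fun x => ?_)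
  simp only
  rw [abs_mul, abs_of_nonneg (hf.nonneg x)]
  exact mul_le_of_le_one_right (hf.nonneg x) (abs_cos_le_one _)

lemma CosMono.cone_sub_const {k : ℝ → ℝ} (hk : CosMono k) {κ : ℝ} (hκ : ∀ x, κ ≤ k x) :
    Cone (k 0 - κ) (fun x => k x - κ) :=
  ⟨fun _ _ h => sub_le_sub_right (hk h) κ, fun x => sub_nonneg.2 (hκ x),
    fun x => sub_le_sub_right (hk (by rw [cos_zero]; exact cos_le_one x)) κ⟩

lemma CosMono.cosCoeff_sub_const {k : ℝ → ℝ} (hk : CosMono k) {κ : ℝ} (hκ : ∀ x, κ ≤ k x) (n : ℤ) :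
    cosCoeff (fun x => k x - κ) n = cosCoeff k n - if n = 0 then κ else 0 := by
  have h1 : Integrable k circ := by
    have := (hk.cone_sub_const hκ).integrable.add (integrable_const κ)
    refine this.congr (ae_of_all _ fun x => ?_)
    simp
  rw [cosCoeff_sub h1 (integrable_const κ), cosCoeff_const]

lemma exists_conePreserving_two {c : ℝ} (hc : 0 < c) :
    ∃ κ > 0, ConePreserving fun n => (c + |(n : ℝ)| ^ (2 : ℝ))⁻¹ - if n = 0 then κ else 0 := by
  refine ⟨_, div_pos pi_pos (sqrt_mul_sinh_pos hc), ?_⟩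
  have hk := cosMono_resolventKernel hc
  convert ConePreserving.of_kernel (hk.cone_sub_const (resolventKernel_lower hc)) using 1
  ext n
  rw [hk.cosCoeff_sub_const (resolventKernel_lower hc), cosCoeff_resolventKernel hc, rpow_two,
    sq_abs]

lemma exists_conePreserving_of_lt_two {c α : ℝ} (hc : 0 < c) (h0 : 0 < α) (h2 : α < 2) :
    ∃ κ > 0, ConePreserving fun n => (c + |(n : ℝ)| ^ α)⁻¹ - if n = 0 then κ else 0 := by
  set β := α / 2 with hβ
  have hβ' : β ∈ Ioo (0 : ℝ) 1 := ⟨by positivity, by rw [hβ]; linarith⟩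
  obtain ⟨κ, hκ, hlow⟩ := exists_mixedKernel_lower β
  set C := ∫ t in Ioi 0, rpowIntegrand₀₁ β t 1 with hC
  have hC0 : 0 < C := integral_rpowIntegrand₀₁_one_pos hβ'
  set δ : ℕ → ℝ := fun N => ((N : ℝ) + 1)⁻¹ with hδ
  set R : ℕ → ℝ := fun N => (N : ℝ) + 2 with hR
  have hδ0 : ∀ N, 0 < δ N := fun N => by positivity
  have hδ1 : ∀ N, δ N ≤ 1 := fun N => inv_le_one_of_one_le₀ (by linarith [N.cast_nonneg (α := ℝ)])
  have hR2 : ∀ N, 2 ≤ R N := fun N => by simp [hR]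
  have hδR : ∀ N, δ N ≤ R N := fun N => by linarith [hδ1 N, hR2 N]
  have hmono : ∀ N, CosMono (mixedKernel (δ N) (R N) β) := fun N =>
    cosMono_mixedKernel (hδ0 N) (hδR N)
  have hlow' : ∀ N x, κ ≤ mixedKernel (δ N) (R N) β x := fun N x =>
    hlow _ _ (hδ0 N) (hδ1 N) (hR2 N) x
  set m : ℕ → ℤ → ℝ := fun N => cosCoeff fun x => mixedKernel (δ N) (R N) β x - κ with hm
  have hcone := fun N => (hmono N).cone_sub_const (hlow' N)
  have hmn : ∀ N n, |m N n| < c * C + (m N 0 + κ) := fun N n =>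
    ((hcone N).abs_cosCoeff_le n).trans_lt (by
      have : 0 < c * C := by positivity
      simp only [hm]; linarith)
  have hlim : ∀ n : ℤ, Tendsto (fun N => m N 0 + κ - m N n) atTop
      (𝓝 (C * |(n : ℝ)| ^ α + if n = 0 then κ else 0)) := fun n => by
    have hx : 0 ≤ (n : ℝ) ^ 2 := sq_nonneg _
    have hcov : AECover (volume.restrict (Ioi (0 : ℝ))) atTop fun N => Ioc (δ N) (R N) := by
      have hδt : Tendsto δ atTop (𝓝 0) := tendsto_inv_atTop_zero.comp
        (tendsto_atTop_add_const_right _ _ tendsto_natCast_atTop_atTop)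
      have hRt : Tendsto R atTop atTop :=
        tendsto_atTop_add_const_right _ _ tendsto_natCast_atTop_atTop
      refine ⟨(ae_restrict_mem measurableSet_Ioi).mono fun s hs => ?_, fun _ => measurableSet_Ioc⟩
      exact (hδt.eventually_lt_const hs).and (hRt.eventually_ge_atTop s)
    have e : ((n : ℝ) ^ 2) ^ β = |(n : ℝ)| ^ α := by
      rw [← sq_abs, ← rpow_natCast, ← rpow_mul (abs_nonneg _), hβ]
      congr 1
      push_cast
      ring
    have h := hcov.integral_tendsto_of_countably_generated
      (integrableOn_rpowIntegrand₀₁_Ioi hβ' hx)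
    rw [integral_rpowIntegrand₀₁_eq_rpow_mul_const hβ' hx, ← hC, mul_comm _ C, e] at h
    refine (h.add_const (if n = 0 then κ else 0)).congr fun N => ?_
    have hsub : Ioc (δ N) (R N) ∩ Ioi 0 = Ioc (δ N) (R N) :=
      inter_eq_left.2 fun s hs => (hδ0 N).trans hs.1
    have hint : ∀ j : ℤ, IntervalIntegrable (fun s : ℝ => s ^ β * (s + (j : ℝ) ^ 2)⁻¹) volume
        (δ N) (R N) := fun j => by
      refine intervalIntegrable_of_continuousOn_Ioi (ContinuousOn.mul
        (continuousOn_id.rpow_const fun s hs => Or.inl (ne_of_gt hs))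
        (ContinuousOn.inv₀ (by fun_prop) fun s hs => ?_)) (hδ0 N) ((hδ0 N).trans_le (hδR N))
      have : (0 : ℝ) < s := hs
      positivity
    simp only [hm]
    rw [(hmono N).cosCoeff_sub_const (hlow' N), (hmono N).cosCoeff_sub_const (hlow' N),
      cosCoeff_mixedKernel (hδ0 N) (hδR N), cosCoeff_mixedKernel (hδ0 N) (hδR N), if_pos rfl,
      Measure.restrict_restrict measurableSet_Ioc, hsub,
      ← intervalIntegral.integral_of_le (hδR N)]
    have : ∫ s in (δ N)..(R N), rpowIntegrand₀₁ β s ((n : ℝ) ^ 2) =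
        (∫ s in (δ N)..(R N), s ^ β * (s + ((0 : ℤ) : ℝ) ^ 2)⁻¹) -
          ∫ s in (δ N)..(R N), s ^ β * (s + (n : ℝ) ^ 2)⁻¹ := by
      rw [← intervalIntegral.integral_sub (hint 0) (hint n)]
      refine intervalIntegral.integral_congr fun s _ => ?_
      simp only [rpowIntegrand₀₁]
      simp [mul_sub]
    rw [this]
    ring
  have hgood : ConePreserving fun n => (c * C + (C * |(n : ℝ)| ^ α + if n = 0 then κ else 0))⁻¹ := by
    refine ConePreserving.of_tendsto
      (fun N => (ConePreserving.of_kernel (hcone N)).inv_sub (hmn N)) fun n => ?_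
    refine Tendsto.inv₀ ?_ ?_
    · refine ((hlim n).const_add (c * C)).congr fun N => ?_
      simp only [hm]; ring
    · have : 0 ≤ |(n : ℝ)| ^ α := by positivity
      split_ifs <;> positivity
  refine ⟨c⁻¹ - (c + κ / C)⁻¹, ?_, ?_⟩
  · exact sub_pos.2 (inv_strictAnti₀ hc (by linarith [div_pos hκ hC0]))
  · convert hgood.const_smul hC0.le using 1
    ext n
    simp only [Pi.smul_apply, smul_eq_mul]
    split_ifs with hn
    · subst hn
      simp only [Int.cast_zero, abs_zero, zero_rpow h0.ne', add_zero, mul_zero, zero_add]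
      field_simp
      ring
    · have : c + |(n : ℝ)| ^ α ≠ 0 := by positivity
      rw [add_zero, sub_zero, ← mul_comm C c, ← mul_add, mul_inv, mul_inv_cancel_left₀ hC0.ne']

/-- The multiplier `(c + |n| ^ α)⁻¹` is given by a kernel that is monotone in `cos x` and bounded
below by a positive constant. -/
lemma exists_conePreserving {c α : ℝ} (hc : 0 < c) (h0 : 0 < α) (h2 : α ≤ 2) :
    ∃ κ > 0, ConePreserving fun n => (c + |(n : ℝ)| ^ α)⁻¹ - if n = 0 then κ else 0 := by
  rcases h2.lt_or_eq with h | rfl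
  · exact exists_conePreserving_of_lt_two hc h0 h
  · exact exists_conePreserving_two hc

/-! ### Cosine series and the inverse of a Fourier multiplier -/

lemma cos_int_mul_congr {x y : ℝ} (h : cos x = cos y) (n : ℤ) : cos (n * x) = cos (n * y) := by
  obtain ⟨k, hk | hk⟩ := cos_eq_cos_iff.1 h
  · rw [hk, ← cos_add_int_mul_two_pi (n * x) (n * k)]
    congr 1; push_cast; ring
  · rw [hk, ← cos_neg (n * x), ← cos_add_int_mul_two_pi (-(n * x)) (n * k)]
    congr 1; push_cast; ring

section CosSeries

variable {a : ℤ → ℝ}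

lemma continuous_tsum_mul_cos (ha : Summable fun n => |a n|) :
    Continuous fun x => ∑' n : ℤ, a n * cos (n * x) :=
  continuous_tsum (fun n => by fun_prop) ha fun n x => by
    rw [norm_mul]
    exact mul_le_of_le_one_right (abs_nonneg _) (abs_cos_le_one _)

lemma abs_tsum_mul_cos_le (ha : Summable fun n => |a n|) (x : ℝ) :
    |∑' n : ℤ, a n * cos (n * x)| ≤ ∑' n, |a n| :=
  tsum_of_norm_bounded (f := fun n : ℤ => a n * cos (n * x)) ha.hasSum fun n => by
    rw [norm_mul]
    exact mul_le_of_le_one_right (abs_nonneg _) (abs_cos_le_one _)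

lemma cosCoeff_tsum_mul_cos (ha : Summable fun n => |a n|) (hneg : ∀ n, a (-n) = a n) (n : ℤ) :
    cosCoeff (fun x => ∑' m : ℤ, a m * cos (m * x)) n = a n := by
  have hint : ∀ m : ℤ, Integrable (fun x => a m * cos (m * x) * cos (n * x)) circ := fun m =>
    integrable_circ_of_continuous (by fun_prop)
  have hle : ∀ m : ℤ, ∫ x, ‖a m * cos (m * x) * cos (n * x)‖ ∂circ ≤ |a m| := fun m => by
    calc _ ≤ ∫ _, |a m| ∂circ := by
          refine integral_mono (hint m).norm (integrable_const _) fun x => ?_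
          simp only
          rw [norm_mul, norm_mul]
          exact (mul_le_of_le_one_right (by positivity) (abs_cos_le_one _)).trans
            (mul_le_of_le_one_right (abs_nonneg _) (abs_cos_le_one _))
      _ = |a m| := by simp
  have h := hasSum_integral_of_summable_integral_norm hint
    (Summable.of_nonneg_of_le (fun m => integral_nonneg fun x => norm_nonneg _) hle ha)
  have h1 : ∀ m : ℤ, ∫ x, a m * cos (m * x) * cos (n * x) ∂circ =
      (if m = n then a n / 2 else 0) + if m = -n then a n / 2 else 0 := fun m => by
    have := cosCoeff_const_mul (a m) (fun x => cos (m * x)) n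
    rw [cosCoeff_cos] at this
    refine Eq.trans this ?_
    rw [mul_add]
    congr 1
    · by_cases e : m = n
      · rw [if_pos e.symm, if_pos e, e]; ring
      · rw [if_neg (Ne.symm e), if_neg e, mul_zero]
    · by_cases e : m = -n
      · rw [if_pos (by rw [e, neg_neg]), if_pos e, e, hneg]; ring
      · rw [if_neg fun e' => e (by rw [e', neg_neg]), if_neg e, mul_zero]
  have h2 : HasSum (fun m : ℤ => ∫ x, a m * cos (m * x) * cos (n * x) ∂circ)
      (a n / 2 + a n / 2) := by
    simp only [h1]
    exact (hasSum_ite_eq n _).add (hasSum_ite_eq (-n) _)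
  rw [← add_halves (a n), h2.unique h, cosCoeff]
  congr 1
  ext x
  exact (tsum_mul_right).symm

end CosSeries

lemma dense_of_ae_circ {f g : ℝ → ℝ} (hf : Function.Periodic f (2 * π))
    (hg : Function.Periodic g (2 * π)) (h : f =ᵐ[circ] g) : Dense {x | f x = g x} := by
  have h1 : ∀ᵐ x ∂volume.restrict (Ioc (-π) π), f x = g x := by
    rw [circ] at h
    exact (Measure.ae_ennreal_smul_measure_iff (by simp [pi_pos])).1 h
  intro x
  rw [_root_.mem_closure_iff]
  intro O hO hx
  obtain ⟨k, hk⟩ := (existsUnique_sub_zsmul_mem_Ioc two_pi_pos x (-π)).exists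
  rw [show -π + 2 * π = π by ring] at hk
  have hO' : IsOpen ((fun y => y + k • (2 * π)) ⁻¹' O) := hO.preimage (by fun_prop)
  have hne : ((fun y => y + k • (2 * π)) ⁻¹' O ∩ Ioo (-π) π).Nonempty := by
    have hcl : x - k • (2 * π) ∈ closure (Ioo (-π) π) := by
      rw [closure_Ioo (by linarith [pi_pos])]
      exact Ioc_subset_Icc_self hk
    exact _root_.mem_closure_iff.1 hcl _ hO' (by simpa using hx)
  have hpos := (hO'.inter isOpen_Ioo).measure_pos volume hne
  have h2 := (ae_restrict_iff' measurableSet_Ioc).1 h1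
  obtain ⟨y, hy, hy'⟩ : ∃ y ∈ (fun y => y + k • (2 * π)) ⁻¹' O ∩ Ioo (-π) π,
      (y ∈ Ioc (-π) π → f y = g y) := by
    by_contra! hcon
    refine hpos.ne' (measure_mono_null (fun y hy => ?_) h2)
    exact fun h => (hcon y hy).2 (h (hcon y hy).1)
  refine ⟨y + k • (2 * π), hy.1, ?_⟩
  change f _ = g _
  rw [hf.zsmul k y, hg.zsmul k y]
  exact hy' (Ioo_subset_Ioc_self hy.2)

lemma CosMono.of_ae_eq {f g : ℝ → ℝ} (hf : Continuous f) (hc : ∀ x y, cos x = cos y → f x = f y)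
    (hg : CosMono g) (h : f =ᵐ[circ] g) : CosMono f := by
  have hper : Function.Periodic f (2 * π) := fun x => hc _ _ (cos_add_two_pi x)
  have hd := dense_of_ae_circ hper hg.periodic h
  intro x y hxy
  rcases hxy.eq_or_lt with e | hlt
  · exact (hc _ _ e).le
  have hU : IsOpen {p : ℝ × ℝ | cos p.1 < cos p.2} :=
    isOpen_lt (by fun_prop) (by fun_prop)
  have hcl : IsClosed {p : ℝ × ℝ | f p.1 ≤ f p.2} := isClosed_le (by fun_prop) (by fun_prop)
  have hsub : {p : ℝ × ℝ | cos p.1 < cos p.2} ∩ ({x | f x = g x} ×ˢ {x | f x = g x}) ⊆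
      {p : ℝ × ℝ | f p.1 ≤ f p.2} := by
    rintro ⟨p, q⟩ ⟨hpq, hp, hq⟩
    change f p ≤ f q
    rw [show f p = g p from hp, show f q = g q from hq]
    exact hg hpq.le
  have hmem : (x, y) ∈ {p : ℝ × ℝ | cos p.1 < cos p.2} := hlt
  exact closure_minimal hsub hcl ((hd.prod hd).open_subset_closure_inter hU hmem)

/-- Even positive symbols whose inverse is square summable and is given by a kernel that is monotone
in `cos x` and bounded below by a positive constant. -/
structure GoodSymbol (ω : ℤ → ℝ) : Prop where
  pos : ∀ n, 0 < ω n
  neg : ∀ n, ω (-n) = ω n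
  summable : Summable fun n => (ω n)⁻¹ ^ 2
  cone : ∃ κ > 0, ConePreserving fun n => (ω n)⁻¹ - if n = 0 then κ else 0

lemma GoodSymbol.exists_inverse {ω : ℤ → ℝ} (hω : GoodSymbol ω) {B : ℝ} {u : ℝ → ℝ} (hu : Cone B u)
    (hu0 : 0 < cosCoeff u 0) :
    ∃ V : ℝ → ℝ, Continuous V ∧ CosMono V ∧ (∀ x, 0 < V x) ∧
      (∀ n, cosCoeff V n = cosCoeff u n / ω n) ∧
      ∀ x, V x ≤ ((∑' n, (ω n)⁻¹ ^ 2) + ∫ x, u x ^ 2 ∂circ) / 2 := by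
  have hb := hasSum_sq_cosCoeff hu.mono.measurable hu.abs_le hu.mono.even
  set a : ℤ → ℝ := fun n => cosCoeff u n / ω n with ha_def
  have hle : ∀ n, |a n| ≤ ((ω n)⁻¹ ^ 2 + cosCoeff u n ^ 2) / 2 := fun n => by
    rw [ha_def, abs_le]
    simp only [div_eq_mul_inv]
    constructor <;> nlinarith [sq_nonneg ((ω n)⁻¹ - cosCoeff u n), sq_nonneg ((ω n)⁻¹ + cosCoeff u n)]
  have hsum := (hω.summable.hasSum.add hb).div_const 2
  have ha : Summable fun n => |a n| :=
    Summable.of_nonneg_of_le (fun n => abs_nonneg _) hle hsum.summable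
  have hneg : ∀ n, a (-n) = a n := fun n => by simp only [ha_def, cosCoeff_neg, hω.neg]
  set V : ℝ → ℝ := fun x => ∑' n : ℤ, a n * cos (n * x) with hV
  have hVc : Continuous V := continuous_tsum_mul_cos ha
  have hcongr : ∀ x y, cos x = cos y → V x = V y := fun x y hxy => by
    simp only [hV, cos_int_mul_congr hxy]
  have hcoeff := cosCoeff_tsum_mul_cos ha hneg
  obtain ⟨κ, hκ, hcone⟩ := hω.cone
  obtain ⟨v, hv, hvc⟩ := hcone hu
  set g : ℝ → ℝ := fun x => v x + κ * cosCoeff u 0 with hg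
  have hgm : CosMono g := hv.mono.add (CosMono.const _)
  have hae : V =ᵐ[circ] g := by
    refine ae_eq_of_cosCoeff_eq hVc.measurable hgm.measurable (abs_tsum_mul_cos_le ha)
      (fun x => (abs_add_le _ _).trans (add_le_add_left (hv.abs_le x) _))
      (fun x => hcongr _ _ (cos_neg x)) hgm.even fun n => ?_
    rw [hcoeff, hg, cosCoeff_add hv.integrable (integrable_const _), cosCoeff_const, hvc]
    simp only [ha_def]
    split_ifs with h
    · subst h; ring
    · ring
  have hVm := CosMono.of_ae_eq hVc hcongr hgm hae
  have hlow : ∀ x, κ * cosCoeff u 0 ≤ V x := by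
    have hd := dense_of_ae_circ hVm.periodic hgm.periodic hae
    have hcl : IsClosed {x | κ * cosCoeff u 0 ≤ V x} := isClosed_le continuous_const hVc
    intro x
    refine closure_minimal (fun y hy => ?_) hcl (hd x)
    change _ ≤ V y
    rw [show V y = g y from hy]
    exact le_add_of_nonneg_left (hv.nonneg y)
  refine ⟨V, hVc, hVm, fun x => (mul_pos hκ hu0).trans_le (hlow x), hcoeff, fun x => ?_⟩
  exact (le_abs_self _).trans ((abs_tsum_mul_cos_le ha x).trans
    (hasSum_le hle ha.hasSum hsum))

/-! ### The maximization problem -/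

/-- The functions of the cone with energy `∑ ω |ψ̂|²` at most `1`. -/
def Admissible (ω : ℤ → ℝ) (M : ℝ) (ψ : ℝ → ℝ) : Prop :=
  Cone M ψ ∧ ∀ s : Finset ℤ, ∑ n ∈ s, ω n * cosCoeff ψ n ^ 2 ≤ 1

lemma Cone.integrable_pow {M : ℝ} {f : ℝ → ℝ} (hf : Cone M f) (k : ℕ) :
    Integrable (fun x => f x ^ k) circ :=
  integrable_circ (hf.mono.measurable.pow_const k) (C := M ^ k) fun x => by
    rw [abs_pow]; exact pow_le_pow_left₀ (abs_nonneg _) (hf.abs_le x) k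

lemma exists_maximizer {ω : ℤ → ℝ} {M : ℝ} {ψ₀ : ℝ → ℝ} (h₀ : Admissible ω M ψ₀) :
    ∃ ψ, Admissible ω M ψ ∧ ∀ v, Admissible ω M v → ∫ x, v x ^ 3 ∂circ ≤ ∫ x, ψ x ^ 3 ∂circ := by
  set S : Set ℝ := (fun ψ : ℝ → ℝ => ∫ x, ψ x ^ 3 ∂circ) '' {ψ | Admissible ω M ψ} with hS
  have hne : S.Nonempty := ⟨_, ψ₀, h₀, rfl⟩
  have hbdd : BddAbove S := by
    refine ⟨M ^ 3, ?_⟩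
    rintro _ ⟨ψ, hψ, rfl⟩
    calc ∫ x, ψ x ^ 3 ∂circ ≤ ∫ _, M ^ 3 ∂circ :=
          integral_mono (hψ.1.integrable_pow 3) (integrable_const _) fun x =>
            pow_le_pow_left₀ (hψ.1.nonneg x) (hψ.1.le x) 3
      _ = M ^ 3 := by simp
  obtain ⟨z, -, hz, hzS⟩ := exists_seq_tendsto_sSup hne hbdd
  choose f hf hfz using hzS
  obtain ⟨σ, hσ, g, hg, hlim⟩ := exists_subseq_tendsto_of_cone fun k => (hf k).1
  have hcoef : ∀ n, Tendsto (fun k => cosCoeff (f (σ k)) n) atTop (𝓝 (cosCoeff g n)) := fun n =>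
    tendsto_cosCoeff (fun k => (hf (σ k)).1) hlim n
  refine ⟨g, ⟨hg, fun s => ?_⟩, fun v hv => ?_⟩
  · refine le_of_tendsto' (tendsto_finsetSum s fun n _ => ((hcoef n).pow 2).const_mul (ω n))
      fun k => (hf (σ k)).2 s
  · have h1 : Tendsto (fun k => ∫ x, f (σ k) x ^ 3 ∂circ) atTop (𝓝 (∫ x, g x ^ 3 ∂circ)) := by
      refine tendsto_integral_of_dominated_convergence (fun _ => M ^ 3)
        (fun k => ((hf (σ k)).1.integrable_pow 3).aestronglyMeasurable) (integrable_const _)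
        (fun k => ae_of_all _ fun x => ?_) (ae_of_all _ fun x => (hlim x).pow 3)
      rw [norm_pow]
      exact pow_le_pow_left₀ (norm_nonneg _) ((hf (σ k)).1.abs_le x) 3
    have h2 : Tendsto (fun k => ∫ x, f (σ k) x ^ 3 ∂circ) atTop (𝓝 (sSup S)) := by
      have := hz.comp hσ.tendsto_atTop
      refine this.congr fun k => ?_
      exact (hfz (σ k)).symm
    rw [tendsto_nhds_unique h1 h2]
    exact le_csSup hbdd ⟨v, hv, rfl⟩

lemma energy_defect_le {ω p b : ℤ → ℝ} (hω : ∀ n, 0 < ω n) {J L t : ℝ}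
    (hp : ∀ s : Finset ℤ, ∑ n ∈ s, ω n * p n ^ 2 ≤ 1) (hJ : HasSum (fun n => b n * p n) J)
    (hL : HasSum (fun n => b n * (b n / ω n)) L) (n : ℤ) :
    ω n * (p n - b n / ω n / t) ^ 2 ≤ 1 - 2 / t * J + L / t ^ 2 := by
  have hlim : Tendsto (fun s : Finset ℤ => 1 - 2 / t * ∑ m ∈ s, b m * p m +
      (∑ m ∈ s, b m * (b m / ω m)) / t ^ 2) atTop (𝓝 (1 - 2 / t * J + L / t ^ 2)) :=
    ((Tendsto.const_mul (2 / t) hJ).const_sub 1).add (Tendsto.div_const hL _)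
  refine ge_of_tendsto hlim ((eventually_ge_atTop {n}).mono fun s hs => ?_)
  calc ω n * (p n - b n / ω n / t) ^ 2 ≤ ∑ m ∈ s, ω m * (p m - b m / ω m / t) ^ 2 :=
        Finset.single_le_sum (f := fun m => ω m * (p m - b m / ω m / t) ^ 2)
          (fun m _ => mul_nonneg (hω m).le (sq_nonneg _)) (Finset.singleton_subset_iff.1 hs)
    _ = ∑ m ∈ s, (ω m * p m ^ 2 - 2 / t * (b m * p m) + b m * (b m / ω m) / t ^ 2) := by
        refine Finset.sum_congr rfl fun m _ => ?_
        have := (hω m).ne'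
        rcases eq_or_ne t 0 with rfl | ht
        · simp
        · field_simp; ring
    _ ≤ _ := by
        rw [Finset.sum_add_distrib, Finset.sum_sub_distrib, ← Finset.mul_sum, ← Finset.sum_div]
        linarith [hp s]

lemma exists_solution_of_maximizer {ω : ℤ → ℝ} (hω : GoodSymbol ω) {M : ℝ} {ψ : ℝ → ℝ}
    (hψ : Admissible ω M ψ)
    (hmax : ∀ v, Admissible ω M v → ∫ x, v x ^ 3 ∂circ ≤ ∫ x, ψ x ^ 3 ∂circ)
    (hJ : 0 < ∫ x, ψ x ^ 3 ∂circ) (hM : ∑' n, (ω n)⁻¹ ^ 2 ≤ M * ∫ x, ψ x ^ 3 ∂circ) :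
    ∃ v : ℝ → ℝ, Continuous v ∧ Admissible ω M v ∧ (∀ x, 0 < v x) ∧
      ∫ x, v x ^ 3 ∂circ = ∫ x, ψ x ^ 3 ∂circ ∧
      ∃ t > 0, ∀ n, cosCoeff (fun x => v x ^ 2) n = t * (ω n * cosCoeff v n) := by
  set J := ∫ x, ψ x ^ 3 ∂circ with hJdef
  have hcone := hψ.1
  have hu := hcone.sq
  set u : ℝ → ℝ := fun x => ψ x ^ 2 with hudef
  have hJM : J ≤ M * cosCoeff u 0 := by
    rw [cosCoeff_zero, ← integral_const_mul]
    refine integral_mono (hcone.integrable_pow 3) (hu.integrable.const_mul M) fun x => ?_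
    simp only [hudef]
    nlinarith [sq_nonneg (ψ x), hcone.le x]
  have hu0 : 0 < cosCoeff u 0 := by
    by_contra! h
    nlinarith [mul_nonneg hcone.bound_nonneg (neg_nonneg.2 h)]
  have hu2 : ∫ x, u x ^ 2 ∂circ ≤ M * J := by
    rw [hJdef, ← integral_const_mul]
    refine integral_mono (hu.integrable_pow 2) ((hcone.integrable_pow 3).const_mul M) fun x => ?_
    simp only [hudef]
    nlinarith [pow_nonneg (hcone.nonneg x) 3, hcone.le x]
  obtain ⟨V, hVc, hVm, hVpos, hVcoef, hVle⟩ := hω.exists_inverse hu hu0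
  have hVMJ : ∀ x, V x ≤ M * J := fun x => (hVle x).trans (by linarith)
  have hVcone : Cone (M * J) V := ⟨hVm, fun x => (hVpos x).le, hVMJ⟩
  have hLsum := hasSum_cosCoeff_mul hu.mono.measurable hVm.measurable hu.abs_le hVcone.abs_le
    hu.mono.even hVm.even
  simp only [hVcoef] at hLsum
  have hJsum : HasSum (fun n => cosCoeff u n * cosCoeff ψ n) J := by
    have h : J = ∫ x, u x * ψ x ∂circ := by simp only [hJdef, hudef, pow_succ]
    rw [h]
    exact hasSum_cosCoeff_mul hu.mono.measurable hcone.mono.measurable hu.abs_le hcone.abs_le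
      hu.mono.even hcone.mono.even
  set L := ∫ x, u x * V x ∂circ with hL
  have hL0 : 0 < L := by
    refine lt_of_lt_of_le ?_ (le_hasSum hLsum 0 fun n _ => ?_)
    · have := hω.pos 0
      positivity
    · rw [← mul_div_assoc]
      exact div_nonneg (mul_self_nonneg _) (hω.pos n).le
  set t := √L with ht
  have ht0 : 0 < t := sqrt_pos.2 hL0
  have htL : t ^ 2 = L := sq_sqrt hL0.le
  have hdef : ∀ n, ω n * (cosCoeff ψ n - cosCoeff u n / ω n / t) ^ 2 ≤ 2 - 2 / t * J := fun n => by
    have := energy_defect_le (t := t) hω.pos hψ.2 hJsum hLsum n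
    rw [htL, div_self hL0.ne'] at this
    linarith
  have hJt : J ≤ t := by
    have h1 := (mul_nonneg (hω.pos 0).le (sq_nonneg _)).trans (hdef 0)
    have h2 : 2 / t * J = 2 * (J / t) := by ring
    exact (div_le_one ht0).1 (by linarith)
  set v : ℝ → ℝ := fun x => t⁻¹ * V x with hv
  have hvcoef : ∀ n, cosCoeff v n = cosCoeff u n / ω n / t := fun n => by
    rw [hv, cosCoeff_const_mul, hVcoef]; ring
  have hvcone : Cone M v := by
    refine ⟨hVm.const_mul (inv_pos.2 ht0).le, fun x => (mul_pos (inv_pos.2 ht0) (hVpos x)).le,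
      fun x => ?_⟩
    rw [hv, inv_mul_le_iff₀ ht0]
    refine (hVMJ x).trans ?_
    rw [mul_comm t]
    exact mul_le_mul_of_nonneg_left hJt hcone.bound_nonneg
  have hvadm : Admissible ω M v := by
    refine ⟨hvcone, fun s => ?_⟩
    calc ∑ n ∈ s, ω n * cosCoeff v n ^ 2 = (∑ n ∈ s, cosCoeff u n * (cosCoeff u n / ω n)) / L := by
          rw [Finset.sum_div]
          refine Finset.sum_congr rfl fun n _ => ?_
          have := (hω.pos n).ne'
          rw [hvcoef, ← htL]
          field_simp
      _ ≤ 1 := (div_le_one hL0).2 (sum_le_hasSum s (fun n _ => by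
          rw [← mul_div_assoc]
          exact div_nonneg (mul_self_nonneg _) (hω.pos n).le) hLsum)
  have huv : ∫ x, u x * v x ∂circ = t := by
    have : ∀ x, u x * v x = t⁻¹ * (u x * V x) := fun x => by simp only [hv]; ring
    simp only [this]
    rw [integral_const_mul, ← hL, ← htL]
    field_simp
  have hint_uv : Integrable (fun x => u x * v x) circ :=
    hvcone.integrable.bdd_mul (c := M ^ 2) hu.integrable.aestronglyMeasurable
      (ae_of_all _ hu.abs_le)
  have htJ : t ≤ J := by
    have h1 : ∫ x, (3 * (u x * v x) - 2 * ψ x ^ 3) ∂circ ≤ ∫ x, v x ^ 3 ∂circ := by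
      refine integral_mono ((hint_uv.const_mul 3).sub ((hcone.integrable_pow 3).const_mul 2))
        (hvcone.integrable_pow 3) fun x => ?_
      have h2 : 0 ≤ (v x - ψ x) ^ 2 * (v x + 2 * ψ x) :=
        mul_nonneg (sq_nonneg _) (by linarith [hvcone.nonneg x, hcone.nonneg x])
      simp only [hudef]
      nlinarith
    rw [integral_sub (hint_uv.const_mul 3) ((hcone.integrable_pow 3).const_mul 2),
      integral_const_mul, integral_const_mul, huv] at h1
    linarith [hmax v hvadm]
  have hcoef : ∀ n, cosCoeff ψ n = cosCoeff v n := fun n => by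
    have h1 : 2 - 2 / t * J = 0 := by
      rw [le_antisymm hJt htJ]
      field_simp
      ring
    have h2 := hdef n
    rw [h1] at h2
    have h3 := nonpos_of_mul_nonpos_right h2 (hω.pos n)
    rw [hvcoef]
    exact sub_eq_zero.1 (pow_eq_zero_iff two_ne_zero |>.1 (le_antisymm h3 (sq_nonneg _)))
  have hae : ψ =ᵐ[circ] v := ae_eq_of_cosCoeff_eq hcone.mono.measurable hvcone.mono.measurable
    hcone.abs_le hvcone.abs_le hcone.mono.even hvcone.mono.even hcoef
  refine ⟨v, continuous_const.mul hVc, hvadm, fun x => mul_pos (inv_pos.2 ht0) (hVpos x),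
    integral_congr_ae (hae.symm.fun_comp (· ^ 3)), t, ht0, fun n => ?_⟩
  have h1 : cosCoeff (fun x => v x ^ 2) n = cosCoeff u n :=
    integral_congr_ae (hae.symm.mono fun x hx => by simp only [hudef, hx])
  have := (hω.pos n).ne'
  rw [h1, hvcoef]
  field_simp

/-! ### The symbol `c + |n| ^ α` -/

lemma half_lt_log_three_div_log_two_sub_one : 1 / 2 < log 3 / log 2 - 1 := by
  have h2 : 0 < log 2 := log_pos one_lt_two
  have h : log ((2 : ℝ) ^ 3) < log ((3 : ℝ) ^ 2) := log_lt_log (by norm_num) (by norm_num)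
  rw [log_pow, log_pow] at h
  push_cast at h
  have : 3 / 2 < log 3 / log 2 := by
    rw [lt_div_iff₀ h2]; linarith
  linarith

lemma goodSymbol {c α : ℝ} (hc : 0 < c) (hα : 1 / 2 < α) (hα₂ : α ≤ 2) :
    GoodSymbol fun n => c + |(n : ℝ)| ^ α where
  pos n := by positivity
  neg n := by simp
  summable := by
    have h := (summable_abs_int_rpow (b := 2 * α) (by linarith)).add
      (hasSum_ite_eq (0 : ℤ) (c⁻¹ ^ 2)).summable
    refine Summable.of_nonneg_of_le (fun n => sq_nonneg _) (fun n => ?_) h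
    rcases eq_or_ne n 0 with rfl | hn
    · have : α ≠ 0 := by linarith
      simp [zero_rpow this, rpow_nonneg]
    · have hn' : 0 < |(n : ℝ)| := abs_pos.2 (Int.cast_ne_zero.2 hn)
      rw [if_neg hn, add_zero, rpow_neg hn'.le, mul_comm, rpow_mul hn'.le, rpow_two, ← inv_pow]
      have : 0 < |(n : ℝ)| ^ α := rpow_pos_of_pos hn' _
      gcongr
      linarith
  cone := exists_conePreserving hc (by linarith) hα₂

/-! ### A nonconstant competitor -/

lemma integral_cos_odd (k : ℕ) (hk : Odd k) : ∫ x, cos x ^ k ∂circ = 0 := by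
  have h := integral_circ_sub (f := fun x => cos x ^ k)
    (fun x => by simp only [cos_add_two_pi]) π
  simp only [cos_pi_sub, hk.neg_pow, integral_neg] at h
  linarith

lemma integral_cos_sq : ∫ x, cos x ^ 2 ∂circ = 1 / 2 := by
  have h := cosCoeff_cos 1 1
  simp only [cosCoeff, Int.cast_one, one_mul, ← sq] at h
  rw [h]
  norm_num

lemma integral_one_add_cos_cube (ε : ℝ) :
    ∫ x, (1 + ε * cos x) ^ 3 ∂circ = 1 + 3 / 2 * ε ^ 2 := by
  have h : ∀ x, (1 + ε * cos x) ^ 3 =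
      1 + 3 * ε * cos x ^ 1 + 3 * ε ^ 2 * cos x ^ 2 + ε ^ 3 * cos x ^ 3 := fun x => by ring
  simp only [h]
  have hi : ∀ g : ℝ → ℝ, Continuous g → Integrable g circ := fun g hg =>
    integrable_circ_of_continuous hg
  rw [integral_add (hi _ (by fun_prop)) (hi _ (by fun_prop)),
    integral_add (hi _ (by fun_prop)) (hi _ (by fun_prop)),
    integral_add (hi _ (by fun_prop)) (hi _ (by fun_prop)),
    integral_const_mul, integral_const_mul, integral_const_mul, integral_cos_odd 1 odd_one,
    integral_cos_odd 3 (by decide), integral_cos_sq]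
  simp
  ring

lemma admissible_one_add_cos {ω : ℤ → ℝ} (hneg : ω (-1) = ω 1) (hpos : ∀ n, 0 < ω n)
    {q ε M : ℝ} (hq : 0 ≤ q) (hε : 0 ≤ ε) (hε1 : ε ≤ 1) (hM : 2 * q ≤ M)
    (henergy : q ^ 2 * (ω 0 + ω 1 * ε ^ 2 / 2) ≤ 1) :
    Admissible ω M fun x => q * (1 + ε * cos x) := by
  refine ⟨⟨?_, fun x => ?_, fun x => ?_⟩, fun s => ?_⟩
  · exact CosMono.const_mul (fun x y h => by
      simpa using mul_le_mul_of_nonneg_left h hε) hq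
  · exact mul_nonneg hq (by nlinarith [neg_one_le_cos x])
  · nlinarith [cos_le_one x, mul_nonneg hε (sub_nonneg.2 (cos_le_one x))]
  · have hcoef : ∀ n : ℤ, cosCoeff (fun x => q * (1 + ε * cos x)) n =
        q * ((if n = 0 then 1 else 0) +
          ε * ((if n = 1 then 1 / 2 else 0) + if n = -1 then 1 / 2 else 0)) := fun n => by
      have h1 := cosCoeff_cos 1 n
      simp only [Int.cast_one, one_mul] at h1
      rw [cosCoeff_const_mul, cosCoeff_add (integrable_const _)
        (integrable_circ_of_continuous (by fun_prop)), cosCoeff_const_mul, cosCoeff_one, h1]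
    have hsq : ∀ n : ℤ, ω n * cosCoeff (fun x => q * (1 + ε * cos x)) n ^ 2 =
        (if n = 0 then ω 0 * q ^ 2 else 0) + ((if n = 1 then ω 1 * (q * ε / 2) ^ 2 else 0) +
          if n = -1 then ω 1 * (q * ε / 2) ^ 2 else 0) := fun n => by
      rw [hcoef]
      by_cases h0 : n = 0
      · subst h0; norm_num
      by_cases h1 : n = 1
      · subst h1; simp; exact Or.inl (by ring)
      by_cases h2 : n = -1
      · subst h2; simp [hneg]; exact Or.inl (by ring)
      simp [h0, h1, h2]
    have hsum : HasSum (fun n : ℤ => ω n * cosCoeff (fun x => q * (1 + ε * cos x)) n ^ 2)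
        (ω 0 * q ^ 2 + (ω 1 * (q * ε / 2) ^ 2 + ω 1 * (q * ε / 2) ^ 2)) := by
      simp only [hsq]
      exact (hasSum_ite_eq _ _).add ((hasSum_ite_eq _ _).add (hasSum_ite_eq _ _))
    refine (sum_le_hasSum s (fun n _ => mul_nonneg (hpos n).le (sq_nonneg _)) hsum).trans ?_
    linarith

lemma exists_competitor {ω : ℤ → ℝ} {c : ℝ} (hc : 1 < c) (hpos : ∀ n, 0 < ω n)
    (h0 : ω 0 = c) (h1 : ω 1 = c + 1) (hneg : ω (-1) = ω 1) {M : ℝ} (hM : 2 * √(c⁻¹) ≤ M) :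
    ∃ v, Admissible ω M v ∧ √(c⁻¹) ^ 3 < ∫ x, v x ^ 3 ∂circ := by
  have hc0 : 0 < c := by linarith
  set r := √(c⁻¹) with hr
  have hr0 : 0 < r := sqrt_pos.2 (inv_pos.2 hc0)
  have hr2 : r ^ 2 = c⁻¹ := sq_sqrt (inv_pos.2 hc0).le
  set e := (c - 1) / (2 * c) with he
  have he0 : 0 < e := div_pos (by linarith) (by linarith)
  have he1 : e < 1 / 2 := by rw [he, div_lt_iff₀ (by linarith)]; linarith
  have hce : (c + 1) / 2 = c * (1 - e) := by rw [he]; field_simp; ring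
  set w := 1 + (1 - e) * e with hw
  have hw1 : 1 ≤ w := by nlinarith
  set q := r / √w with hq
  have hsw : 1 ≤ √w := one_le_sqrt.2 hw1
  have hq0 : 0 < q := div_pos hr0 (by linarith)
  have hqr : q ≤ r := div_le_self hr0.le hsw
  have hq2 : q ^ 2 = (c * w)⁻¹ := by
    rw [hq, div_pow, hr2, sq_sqrt (by linarith), mul_inv, div_eq_mul_inv]
  have hε2 : √e ^ 2 = e := sq_sqrt he0.le
  refine ⟨_, admissible_one_add_cos (q := q) (ε := √e) hneg hpos hq0.le (sqrt_nonneg _)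
    (sqrt_le_one.2 (by linarith)) (by linarith) ?_, ?_⟩
  · rw [h0, h1, hε2, hq2, show c + (c + 1) * e / 2 = c + (c + 1) / 2 * e by ring, hce,
      show c + c * (1 - e) * e = c * w by rw [hw]; ring]
    exact (inv_mul_cancel₀ (by positivity)).le
  · simp only [mul_pow]
    rw [integral_const_mul, integral_one_add_cos_cube, hε2]
    refine lt_of_pow_lt_pow_left₀ 2 (by positivity) ?_
    have hkey : w ^ 3 < (1 + 3 / 2 * e) ^ 2 := by
      rw [hw]
      nlinarith [pow_pos he0 2, pow_pos he0 3, pow_pos he0 4, pow_pos he0 5, pow_pos he0 6,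
        mul_pos (pow_pos he0 2) (sub_pos.2 he1), mul_pos (pow_pos he0 3) (sub_pos.2 he1),
        mul_pos (pow_pos he0 4) (sub_pos.2 he1), mul_pos (pow_pos he0 5) (sub_pos.2 he1)]
    have hr6 : (r ^ 3) ^ 2 = (c⁻¹) ^ 3 := by rw [← hr2]; ring
    have hq6 : (q ^ 3 * (1 + 3 / 2 * e)) ^ 2 = c⁻¹ ^ 3 * ((1 + 3 / 2 * e) ^ 2 / w ^ 3) := by
      rw [mul_pow, ← pow_mul, show 3 * 2 = 2 * 3 by rfl, pow_mul, hq2]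
      field_simp
    rw [hr6, hq6]
    exact lt_mul_of_one_lt_right (by positivity) ((one_lt_div (by positivity)).2 hkey)

/-! ### Solutions of `ω ψ̂ = (ψ²)^` -/

lemma exists_solution {ω : ℤ → ℝ} (hω : GoodSymbol ω) {c : ℝ} (hc : 1 < c)
    (h0 : ω 0 = c) (h1 : ω 1 = c + 1) :
    ∃ f : ℝ → ℝ, Continuous f ∧ CosMono f ∧ (∀ x, 0 < f x) ∧ (¬ ∃ C, ∀ x, f x = C) ∧
      ∀ n, cosCoeff (fun x => f x ^ 2) n = ω n * cosCoeff f n := by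
  set r := √(c⁻¹) with hr
  have hc0 : 0 < c := by linarith
  have hr0 : 0 < r := sqrt_pos.2 (inv_pos.2 hc0)
  set S := ∑' n, (ω n)⁻¹ ^ 2
  set M := max (2 * r) (S / r ^ 3) with hM
  obtain ⟨v₀, hv₀, hv₀J⟩ := exists_competitor hc hω.pos h0 h1 (hω.neg 1) (le_max_left _ _ : _ ≤ M)
  obtain ⟨ψ, hψ, hmax⟩ := exists_maximizer hv₀
  have hJ := hv₀J.trans_le (hmax v₀ hv₀)
  have hM0 : 0 ≤ M := hψ.1.bound_nonneg
  have hS : S ≤ M * ∫ x, ψ x ^ 3 ∂circ := by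
    calc S ≤ M * r ^ 3 := (div_le_iff₀ (by positivity)).1 (le_max_right _ _)
      _ ≤ _ := mul_le_mul_of_nonneg_left hJ.le hM0
  obtain ⟨v, hvc, hv, hvpos, hvJ, t, ht, hvt⟩ :=
    exists_solution_of_maximizer hω hψ hmax ((by positivity : 0 < r ^ 3).trans hJ) hS
  refine ⟨fun x => t⁻¹ * v x, continuous_const.mul hvc, hv.1.mono.const_mul (inv_pos.2 ht).le,
    fun x => mul_pos (inv_pos.2 ht) (hvpos x), ?_, fun n => ?_⟩
  · rintro ⟨C, hC⟩
    have hk : v = fun _ => t * C := funext fun x => by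
      rw [← hC x, mul_inv_cancel_left₀ ht.ne']
    have hk0 : 0 < t * C := by
      have := hvpos 0
      rwa [hk] at this
    have h2 := hv.2 {0}
    rw [Finset.sum_singleton, hk, cosCoeff_const, if_pos rfl, h0] at h2
    have h3 : t * C ≤ r := le_sqrt_of_sq_le (by
      rw [← one_div, le_div_iff₀ hc0]; linarith)
    rw [← hvJ, hk] at hJ
    simp only [integral_const, probReal_univ, one_smul] at hJ
    exact absurd (pow_le_pow_left₀ hk0.le h3 3) (not_le.2 hJ)
  · simp only [mul_pow]
    rw [cosCoeff_const_mul, cosCoeff_const_mul, hvt]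
    field_simp

end PeriodicWave


theorem stmt1 (c α : ℝ) (hc : 1 < c)
    (hα₀ : Real.log 3 / Real.log 2 - 1 < α) (hα₂ : α ≤ 2) :
    ∃ φ : ℝ → ℝ, Continuous φ ∧ Function.Periodic φ (2 * Real.pi) ∧
      (∀ x, φ (-x) = φ x) ∧
      ¬ (∃ C : ℝ, ∀ x, φ x = C) ∧
      AntitoneOn φ (Set.Icc 0 Real.pi) ∧
      (∀ x, -c < φ x) ∧
      (∀ n : ℤ, ((c - |(n : ℝ)| ^ α : ℝ) : ℂ) * fourierCoeff2pi φ n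
        + fourierCoeff2pi (fun x => (φ x) ^ 2) n = 0) := by
  have hα : 1 / 2 < α := PeriodicWave.half_lt_log_three_div_log_two_sub_one.trans hα₀
  have hα0 : α ≠ 0 := by linarith
  obtain ⟨f, hfc, hf, hpos, hconst, hcoef⟩ := PeriodicWave.exists_solution
    (PeriodicWave.goodSymbol (c := c) (by linarith) hα hα₂) hc (by simp [Real.zero_rpow hα0]) (by simp)
  have hφ : PeriodicWave.CosMono fun x => f x - c := fun x y h => sub_le_sub_right (hf h) c
  have hint : ∀ g : ℝ → ℝ, Continuous g → Integrable g PeriodicWave.circ := fun g hg =>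
    PeriodicWave.integrable_circ_of_continuous hg
  refine ⟨fun x => f x - c, by fun_prop, hφ.periodic, hφ.even, ?_, hφ.antitoneOn,
    fun x => by linarith [hpos x], fun n => ?_⟩
  · rintro ⟨C, hC⟩
    exact hconst ⟨C + c, fun x => by linarith [hC x]⟩
  · have hsq : (fun x => (f x - c) ^ 2) = fun x => (f x ^ 2 - 2 * c * f x) + c ^ 2 :=
      funext fun x => by ring
    rw [PeriodicWave.fourierCoeff2pi_eq_cosCoeff (hint _ (by fun_prop)) hφ.even,
      PeriodicWave.fourierCoeff2pi_eq_cosCoeff (hint _ (by fun_prop))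
        (fun x => by simp only [hf.even]), hsq,
      PeriodicWave.cosCoeff_add (hint _ (by fun_prop)) (hint _ (by fun_prop)),
      PeriodicWave.cosCoeff_sub (hint _ (by fun_prop)) (hint _ (by fun_prop)),
      PeriodicWave.cosCoeff_sub (hint _ (by fun_prop)) (hint _ (by fun_prop)),
      PeriodicWave.cosCoeff_const_mul, hcoef, PeriodicWave.cosCoeff_const,
      PeriodicWave.cosCoeff_const, ← Complex.ofReal_mul, ← Complex.ofReal_add,
      Complex.ofReal_eq_zero]
    split_ifs with hn
    · subst hn
      simp only [Int.cast_zero, abs_zero, Real.zero_rpow hα0]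
      ring
    · ring
end
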